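/- Corollary 2 (second-order necessary conditions for a strong minimum in the optimal control problem): If (x̂,û) is a strong minimum point of problem (19), then for any q = (h,v) ∈ K₀(x̂,û) there exist a nonzero tuple (λ₀,λ₁,λ₂) ∈ ℝ₊×(ℝ^{m₁})*₊×(ℝ^{m₂})* and a function p ∈ AC([t₀,t₁],(ℝ^n)*) such that: −ṗ(t) = p(t)φ̂_x(t) a.e.; p(t₀) = λ₀f̂_{0ζ₁} + f̂_{ζ₁}*λ₁ + ĝ_{ζ₁}*λ₂ and p(t₁) = −λ₀f̂_{0ζ₂} − f̂_{ζ₂}*λ₁ − ĝ_{ζ₂}*λ₂; max_{u∈U} H(t,x̂(t),u,p(t)) = H(t,x̂(t),û(t),p(t)) for a.e. t ∈ [t₀,t₁]; ⟨λ₁, f(x̂(t₀),x̂(t₁))⟩ = 0; and −∫_{t₀}^{t₁} H_{ww}(t,x̂(t),û(t),p(t))[q(t),q(t)] dt + λ₀ f̂₀''[η,η] + ⟨λ₁, f̂''[η,η]⟩ + ⟨λ₂, ĝ''[η,η]⟩ ≥ 0, where η = (h(t₀),h(t₁)). Moreover, if Λ(x̂,û,q) = ∅ for this q ∈ K₀(x̂,û),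 then every such tuple has λ₀ ≠ 0. -/

import Mathlib

open Set Topology Filter Matrix MeasureTheory intervalIntegral

namespace SOC
set_option linter.unusedSectionVars false

section Volterra
variable {E : Type*} [NormedAddCommGroup E] [NormedSpace ℝ E]

open Classical in
/-- The primitive of an integrable function, as a continuous function. -/
noncomputable def prim (t₀ t₁ : ℝ) (g : ℝ → E) : C(Icc t₀ t₁, E) :=
  if hg : IntegrableOn g (Icc t₀ t₁) ∧ t₀ ≤ t₁ then
    ⟨fun t => ∫ s in t₀..t, g s, by
      have := continuousOn_primitive_interval (μ := volume) (f := g) (a := t₀) (b := t₁)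
        (by rw [uIcc_of_le hg.2]; exact hg.1)
      rw [uIcc_of_le hg.2] at this
      exact this.domRestrict⟩
  else 0

theorem prim_apply {t₀ t₁ : ℝ} (ht : t₀ ≤ t₁) {g : ℝ → E} (hg : IntegrableOn g (Icc t₀ t₁))
    (t : Icc t₀ t₁) : prim t₀ t₁ g t = ∫ s in t₀..t, g s := by
  unfold prim
  rw [dif_pos ⟨hg, ht⟩]
  rfl

theorem ii_of_on {t₀ t₁ : ℝ} {g : ℝ → E} (hg : IntegrableOn g (Icc t₀ t₁)) {t : ℝ}
    (h : t ∈ Icc t₀ t₁) : IntervalIntegrable g volume t₀ t := by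
  rw [intervalIntegrable_iff_integrableOn_Ioc_of_le h.1]
  exact hg.mono_set (fun s hs => ⟨hs.1.le, hs.2.trans h.2⟩)

theorem on_of_ii {t₀ t₁ : ℝ} (ht : t₀ ≤ t₁) {g : ℝ → E} (hg : IntervalIntegrable g volume t₀ t₁) :
    IntegrableOn g (Icc t₀ t₁) := by
  rw [integrableOn_Icc_iff_integrableOn_Ioc]
  exact (intervalIntegrable_iff_integrableOn_Ioc_of_le ht).1 hg

theorem prim_add {t₀ t₁ : ℝ} (ht : t₀ ≤ t₁) {g₁ g₂ : ℝ → E} (h₁ : IntegrableOn g₁ (Icc t₀ t₁))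
    (h₂ : IntegrableOn g₂ (Icc t₀ t₁)) :
    prim t₀ t₁ (fun s => g₁ s + g₂ s) = prim t₀ t₁ g₁ + prim t₀ t₁ g₂ := by
  ext1 t
  rw [ContinuousMap.add_apply, prim_apply ht h₁, prim_apply ht h₂, prim_apply (g := fun s => g₁ s + g₂ s) ht (h₁.add h₂),
    intervalIntegral.integral_add (ii_of_on h₁ t.2) (ii_of_on h₂ t.2)]

theorem prim_sub {t₀ t₁ : ℝ} (ht : t₀ ≤ t₁) {g₁ g₂ : ℝ → E} (h₁ : IntegrableOn g₁ (Icc t₀ t₁))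
    (h₂ : IntegrableOn g₂ (Icc t₀ t₁)) :
    prim t₀ t₁ (fun s => g₁ s - g₂ s) = prim t₀ t₁ g₁ - prim t₀ t₁ g₂ := by
  ext1 t
  rw [ContinuousMap.sub_apply, prim_apply ht h₁, prim_apply ht h₂, prim_apply (g := fun s => g₁ s - g₂ s) ht (h₁.sub h₂),
    intervalIntegral.integral_sub (ii_of_on h₁ t.2) (ii_of_on h₂ t.2)]

theorem prim_smul {t₀ t₁ : ℝ} (ht : t₀ ≤ t₁) (c : ℝ) {g : ℝ → E} (h : IntegrableOn g (Icc t₀ t₁)) :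
    prim t₀ t₁ (fun s => c • g s) = c • prim t₀ t₁ g := by
  ext1 t
  rw [ContinuousMap.smul_apply, prim_apply ht h, prim_apply (g := fun s => c • g s) ht (h.smul c),
    intervalIntegral.integral_smul]

theorem prim_congr {t₀ t₁ : ℝ} (ht : t₀ ≤ t₁) {g₁ g₂ : ℝ → E}
    (h₁ : IntegrableOn g₁ (Icc t₀ t₁))
    (h : ∀ᵐ s ∂(volume.restrict (Icc t₀ t₁)), g₁ s = g₂ s) :
    prim t₀ t₁ g₁ = prim t₀ t₁ g₂ := by
  ext1 t
  have h₂ : IntegrableOn g₂ (Icc t₀ t₁) := h₁.congr h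
  rw [prim_apply ht h₁, prim_apply ht h₂]
  apply intervalIntegral.integral_congr_ae
  rw [ae_restrict_iff' measurableSet_Icc] at h
  filter_upwards [h] with s hs hs2
  rw [uIoc_of_le t.2.1] at hs2
  exact hs ⟨hs2.1.le, hs2.2.trans t.2.2⟩

theorem norm_prim_apply_le {t₀ t₁ : ℝ} (ht : t₀ ≤ t₁) {g : ℝ → E} {C : ℝ}
    (hg : IntegrableOn g (Icc t₀ t₁))
    (h : ∀ᵐ s ∂(volume.restrict (Icc t₀ t₁)), ‖g s‖ ≤ C) (t : Icc t₀ t₁) :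
    ‖prim t₀ t₁ g t‖ ≤ C * (t - t₀) := by
  rw [prim_apply ht hg]
  have := intervalIntegral.norm_integral_le_of_norm_le_const_ae (a := t₀) (b := t) (f := g) (C := C)
    (by
      rw [ae_restrict_iff' measurableSet_Icc] at h
      filter_upwards [h] with s hs hs2
      rw [uIoc_of_le t.2.1] at hs2
      exact hs ⟨hs2.1.le, hs2.2.trans t.2.2⟩)
  rwa [abs_of_nonneg (sub_nonneg.2 t.2.1)] at this

theorem norm_prim_le {t₀ t₁ : ℝ} (ht : t₀ ≤ t₁) {g : ℝ → E} {C : ℝ} (hC : 0 ≤ C)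
    (hg : IntegrableOn g (Icc t₀ t₁))
    (h : ∀ᵐ s ∂(volume.restrict (Icc t₀ t₁)), ‖g s‖ ≤ C) :
    ‖prim t₀ t₁ g‖ ≤ C * (t₁ - t₀) := by
  rw [ContinuousMap.norm_le _ (mul_nonneg hC (sub_nonneg.2 ht))]
  intro t
  refine (norm_prim_apply_le ht hg h t).trans ?_
  have := t.2.2
  gcongr

theorem norm_prim_le_integral {t₀ t₁ : ℝ} (ht : t₀ ≤ t₁) {g : ℝ → E} 
    (hg : IntegrableOn g (Icc t₀ t₁)) :
    ‖prim t₀ t₁ g‖ ≤ ∫ s in Icc t₀ t₁, ‖g s‖ := by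
  rw [ContinuousMap.norm_le _ (by positivity)]
  intro t
  rw [prim_apply ht hg]
  refine (intervalIntegral.norm_integral_le_integral_norm t.2.1).trans ?_
  rw [intervalIntegral.integral_of_le t.2.1]
  apply setIntegral_mono_set hg.norm (ae_of_all _ (fun _ => norm_nonneg _))
  exact (LE.le.eventuallyLE (fun s hs => ⟨hs.1.le, hs.2.trans t.2.2⟩))

/-- extension of a continuous function on the segment to the line -/
noncomputable def ev {t₀ t₁ : ℝ} (ht : t₀ ≤ t₁) (y : C(Icc t₀ t₁, E)) (s : ℝ) : E :=
  y (projIcc t₀ t₁ ht s)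

theorem ev_continuous {t₀ t₁ : ℝ} (ht : t₀ ≤ t₁) (y : C(Icc t₀ t₁, E)) : Continuous (ev ht y) :=
  y.continuous.comp continuous_projIcc

theorem norm_ev_le {t₀ t₁ : ℝ} (ht : t₀ ≤ t₁) (y : C(Icc t₀ t₁, E)) (s : ℝ) : ‖ev ht y s‖ ≤ ‖y‖ :=
  y.norm_coe_le_norm _

theorem ev_of_mem {t₀ t₁ : ℝ} (ht : t₀ ≤ t₁) (y : C(Icc t₀ t₁, E)) {s : ℝ} (hs : s ∈ Icc t₀ t₁) :
    ev ht y s = y ⟨s, hs⟩ := by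
  unfold ev; rw [projIcc_of_mem]

theorem integrableOn_of_bdd {F : Type*} [NormedAddCommGroup F] {t₀ t₁ : ℝ} {g : ℝ → F} {C : ℝ}
    (hg : AEStronglyMeasurable g (volume.restrict (Icc t₀ t₁)))
    (h : ∀ᵐ s ∂(volume.restrict (Icc t₀ t₁)), ‖g s‖ ≤ C) : IntegrableOn g (Icc t₀ t₁) :=
  Integrable.of_bound hg C h

variable {t₀ t₁ : ℝ} (ht : t₀ ≤ t₁) {A : ℝ → E →L[ℝ] E} {M : ℝ}

theorem volt_integrable (_ht : t₀ ≤ t₁) (hA : AEStronglyMeasurable A (volume.restrict (Icc t₀ t₁)))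
    (hM : ∀ᵐ s ∂(volume.restrict (Icc t₀ t₁)), ‖A s‖ ≤ M) {y : ℝ → E}
    (hy : ContinuousOn y (Icc t₀ t₁)) :
    IntegrableOn (fun s => A s (y s)) (Icc t₀ t₁) := by
  obtain ⟨B, hB⟩ := isCompact_Icc.exists_bound_of_continuousOn hy
  refine integrableOn_of_bdd (C := M * B) ?_ ?_
  · exact isBoundedBilinearMap_apply.continuous.comp_aestronglyMeasurable
      (hA.prodMk (hy.aestronglyMeasurable measurableSet_Icc))
  · filter_upwards [hM, ae_restrict_mem measurableSet_Icc] with s hs hs2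
    exact (A s).le_of_opNorm_le_of_le hs (hB s hs2)

/-- The Volterra operator. -/
noncomputable def volt (hM0 : 0 ≤ M) (hA : AEStronglyMeasurable A (volume.restrict (Icc t₀ t₁)))
    (hM : ∀ᵐ s ∂(volume.restrict (Icc t₀ t₁)), ‖A s‖ ≤ M) :
    C(Icc t₀ t₁, E) →L[ℝ] C(Icc t₀ t₁, E) :=
  LinearMap.mkContinuous
    { toFun := fun y => prim t₀ t₁ (fun s => A s (ev ht y s))
      map_add' := by
        intro y z
        rw [← prim_add ht (volt_integrable ht hA hM (ev_continuous ht y).continuousOn)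
          (volt_integrable ht hA hM (ev_continuous ht z).continuousOn)]
        simp [ev]
      map_smul' := by
        intro c y
        rw [RingHom.id_apply, 
          ← prim_smul ht c (volt_integrable ht hA hM (ev_continuous ht y).continuousOn)]
        simp [ev] } (M * (t₁ - t₀)) (by
      intro y
      refine (norm_prim_le (C := M * ‖y‖) ht (by positivity)
        (volt_integrable ht hA hM (ev_continuous ht y).continuousOn) ?_).trans (le_of_eq (by ring))
      filter_upwards [hM] with s hs
      exact (A s).le_of_opNorm_le_of_le hs (norm_ev_le ht y s))

theorem volt_apply (hM0 : 0 ≤ M) (hA : AEStronglyMeasurable A (volume.restrict (Icc t₀ t₁)))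
    (hM : ∀ᵐ s ∂(volume.restrict (Icc t₀ t₁)), ‖A s‖ ≤ M) (y : C(Icc t₀ t₁, E)) :
    volt ht hM0 hA hM y = prim t₀ t₁ (fun s => A s (ev ht y s)) := rfl

theorem volt_pow_le (hM0 : 0 ≤ M) (hA : AEStronglyMeasurable A (volume.restrict (Icc t₀ t₁)))
    (hM : ∀ᵐ s ∂(volume.restrict (Icc t₀ t₁)), ‖A s‖ ≤ M) (k : ℕ) (y : C(Icc t₀ t₁, E))
    (t : Icc t₀ t₁) :
    ‖((volt ht hM0 hA hM) ^ k) y t‖ ≤ (M * (t - t₀)) ^ k / k.factorial * ‖y‖ := by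
  induction k generalizing t with
  | zero => simpa using y.norm_coe_le_norm t
  | succ k ih =>
    rw [pow_succ', mul_apply_eq_comp, volt_apply,
      prim_apply ht (volt_integrable ht hA hM (ev_continuous ht _).continuousOn)]
    set z := ((volt ht hM0 hA hM) ^ k) y
    have h1 : ‖∫ s in t₀..t, A s (ev ht z s)‖ ≤
        ∫ s in t₀..t, M * ((M * (s - t₀)) ^ k / k.factorial * ‖y‖) := by
      apply intervalIntegral.norm_integral_le_of_norm_le t.2.1
      · rw [ae_restrict_iff' measurableSet_Icc] at hM
        filter_upwards [hM] with s hs hs2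
        have hs3 : s ∈ Icc t₀ t₁ := ⟨hs2.1.le, hs2.2.trans t.2.2⟩
        rw [ev_of_mem ht z hs3]
        exact (A s).le_of_opNorm_le_of_le (hs hs3) (ih ⟨s, hs3⟩)
      · apply Continuous.intervalIntegrable
        fun_prop
    refine h1.trans (le_of_eq ?_)
    have h2 : ∀ s : ℝ, M * ((M * (s - t₀)) ^ k / k.factorial * ‖y‖) =
      (M ^ (k+1) / k.factorial * ‖y‖) * (s - t₀) ^ k := by
      intro s; rw [mul_pow]; ring
    simp_rw [h2]
    rw [intervalIntegral.integral_const_mul, 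
      intervalIntegral.integral_comp_sub_right (fun s => s ^ k), integral_pow, Nat.factorial_succ]
    have : (k.factorial : ℝ) ≠ 0 := by positivity
    have h3 : ((k : ℝ) + 1) ≠ 0 := by positivity
    push_cast
    rw [mul_pow]
    field_simp
    simp

variable [CompleteSpace E]

theorem volt_isUnit (hM0 : 0 ≤ M) (hA : AEStronglyMeasurable A (volume.restrict (Icc t₀ t₁)))
    (hM : ∀ᵐ s ∂(volume.restrict (Icc t₀ t₁)), ‖A s‖ ≤ M) :
    IsUnit (1 - volt ht hM0 hA hM) := by
  set V := volt ht hM0 hA hM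
  have h1 : ∃ k : ℕ, (M * (t₁ - t₀)) ^ k / k.factorial < 1 :=
    ((FloorSemiring.tendsto_pow_div_factorial_atTop (M * (t₁ - t₀))).eventually_lt_const
      (by norm_num : (0:ℝ) < 1)).exists
  obtain ⟨k, hk⟩ := h1
  have h2 : ‖V ^ k‖ < 1 := by
    refine lt_of_le_of_lt (ContinuousLinearMap.opNorm_le_bound _ ?_ ?_) hk
    · have := sub_nonneg.2 ht
      positivity
    · intro y
      have h0 := sub_nonneg.2 ht
      rw [ContinuousMap.norm_le _ (by positivity)]
      intro t
      refine (volt_pow_le ht hM0 hA hM k y t).trans ?_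
      have := t.2.2
      have := sub_nonneg.2 t.2.1
      gcongr
  have h3 : IsUnit (1 - V ^ k) := (Units.oneSub (V ^ k) h2).isUnit
  rw [← mul_neg_geom_sum] at h3
  refine ((Commute.isUnit_mul_iff ?_).1 h3).1
  refine Commute.sub_left (Commute.one_left _) (Commute.sum_right _ _ _ ?_)
  intro i _
  exact (Commute.refl V).pow_right i

theorem volt_solve (hA : AEStronglyMeasurable A (volume.restrict (Icc t₀ t₁)))
    (hM : ∀ᵐ s ∂(volume.restrict (Icc t₀ t₁)), ‖A s‖ ≤ M) (b : C(Icc t₀ t₁, E)) :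
    ∃! y : C(Icc t₀ t₁, E), y - prim t₀ t₁ (fun s => A s (ev ht y s)) = b := by
  have hM' : ∀ᵐ s ∂(volume.restrict (Icc t₀ t₁)), ‖A s‖ ≤ |M| := by
    filter_upwards [hM] with s hs using hs.trans (le_abs_self M)
  obtain ⟨u, hu⟩ := volt_isUnit ht (abs_nonneg M) hA hM'
  have key : ∀ y, y - prim t₀ t₁ (fun s => A s (ev ht y s)) = (u : _ →L[ℝ] _) y := by
    intro y; rw [hu]; rfl
  refine ⟨(↑u⁻¹ : _ →L[ℝ] _) b, ?_, ?_⟩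
  · simp only [key]
    rw [← mul_apply_eq_comp, Units.mul_inv]; rfl
  · intro y hy
    simp only [key] at hy
    rw [← hy, ← mul_apply_eq_comp, Units.inv_mul]; rfl

end Volterra
end SOC

namespace SOC

section Rank

/-- distribution function of a set of finite measure -/
noncomputable def dfun (P : Set ℝ) (t : ℝ) : ℝ := (volume (P ∩ Iic t)).toReal

theorem dfun_add {t₀ t₁ : ℝ} {P : Set ℝ} (hP : P ⊆ Icc t₀ t₁) (s t : ℝ)
    (hst : s ≤ t) : dfun P s ≤ dfun P t ∧ dfun P t ≤ dfun P s + (t - s) := by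
  have hfin : ∀ u, volume (P ∩ Iic u) ≠ ⊤ := fun u =>
    ne_top_of_le_ne_top (by simp : volume (Icc t₀ t₁) ≠ ⊤)
      (measure_mono (inter_subset_left.trans hP))
  constructor
  · exact ENNReal.toReal_mono (hfin t) (measure_mono (inter_subset_inter_right _ (Iic_subset_Iic.2 hst)))
  · have h1 : volume (P ∩ Iic t) ≤ volume (P ∩ Iic s) + ENNReal.ofReal (t - s) := by
      rw [← Real.volume_Ioc]
      refine (measure_mono ?_).trans (measure_union_le _ _)
      intro u hu
      rcases le_or_gt u s with h | h
      · exact Or.inl ⟨hu.1, h⟩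
      · exact Or.inr ⟨h, hu.2⟩
    have := ENNReal.toReal_mono (ENNReal.add_ne_top.2 ⟨hfin s, by simp⟩) h1
    rwa [ENNReal.toReal_add (hfin s) (by simp), ENNReal.toReal_ofReal (by linarith)] at this

theorem dfun_continuous {t₀ t₁ : ℝ} {P : Set ℝ} (hP : P ⊆ Icc t₀ t₁) : Continuous (dfun P) := by
  have : LipschitzWith 1 (dfun P) := by
    apply LipschitzWith.of_le_add
    intro x y
    rcases le_total x y with h | h
    · linarith [(dfun_add hP x y h).1, dist_nonneg (x := x) (y := y)]
    · have := (dfun_add hP y x h).2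
      rw [Real.dist_eq, abs_of_nonneg (by linarith)]
      exact this
  exact this.continuous

theorem dfun_level {t₀ t₁ : ℝ} (ht : t₀ ≤ t₁) {P : Set ℝ} (hP : P ⊆ Icc t₀ t₁) 
    {s : ℝ} (hs0 : 0 ≤ s) (hs : s ≤ (volume P).toReal) :
    (volume (P ∩ {t | dfun P t < s})).toReal = s := by
  have hend : dfun P t₁ = (volume P).toReal := by
    unfold dfun
    have h : P ⊆ Iic t₁ := fun u hu => (hP hu).2
    rw [inter_eq_self_of_subset_left h]
  have hstart : dfun P t₀ = 0 := by
    unfold dfun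
    have : volume (P ∩ Iic t₀) ≤ volume {t₀} := measure_mono (fun u hu =>
      le_antisymm hu.2 (hP hu.1).1)
    rw [Real.volume_singleton, nonpos_iff_eq_zero] at this
    simp [this]
  have hcont := dfun_continuous hP
  have hivt := intermediate_value_Icc ht hcont.continuousOn
  obtain ⟨τ, hτ, hτs⟩ := hivt (show s ∈ Icc (dfun P t₀) (dfun P t₁) from
    ⟨by rw [hstart]; exact hs0, by rw [hend]; exact hs⟩)
  have hcomp : IsCompact (Icc t₀ t₁ ∩ {t | s ≤ dfun P t}) :=
    isCompact_Icc.inter_right (isClosed_le continuous_const hcont)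
  obtain ⟨τ0, hτ0⟩ := hcomp.exists_isLeast ⟨τ, hτ, hτs.ge⟩
  have h1 : dfun P τ0 = s := by
    apply le_antisymm _ hτ0.1.2
    rw [← hτs]
    exact (dfun_add hP τ0 τ (hτ0.2 ⟨hτ, hτs.ge⟩)).1
  have h2 : P ∩ {t | dfun P t < s} = P ∩ Iio τ0 := by
    ext u
    constructor
    · rintro ⟨h, h'⟩
      refine ⟨h, ?_⟩
      by_contra hc
      have := (dfun_add hP τ0 u (not_lt.1 hc)).1
      simp only [mem_ofPred_eq] at h'
      linarith
    · rintro ⟨h, h'⟩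
      refine ⟨h, ?_⟩
      by_contra hc
      have hc' : s ≤ dfun P u := not_lt.1 hc
      exact absurd (hτ0.2 ⟨hP h, hc'⟩) (not_le.2 h')
  rw [h2, ← h1]
  unfold dfun
  congr 1
  apply measure_congr
  exact (ae_eq_refl P).inter Iio_ae_eq_Iic

theorem rank_pieces {t₀ t₁ : ℝ} (ht : t₀ ≤ t₁) {ι : Type*} [Countable ι] [MeasurableSpace ι]
    [MeasurableSingletonClass ι] {σ : ℝ → ι} (hσ : Measurable σ) :
    ∃ ρ : ℝ → ℝ, Measurable ρ ∧ ∀ a b : ℝ, 0 ≤ a → a ≤ b → b ≤ 1 →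
      Measure.map σ ((volume.restrict (Icc t₀ t₁)).restrict {s | a ≤ ρ s ∧ ρ s < b}) =
        ENNReal.ofReal (b - a) • Measure.map σ (volume.restrict (Icc t₀ t₁)) := by
  obtain ⟨P, hPdef⟩ : ∃ P : ι → Set ℝ, ∀ c, P c = σ ⁻¹' {c} ∩ Icc t₀ t₁ := ⟨_, fun _ => rfl⟩
  have hPm : ∀ c, MeasurableSet (P c) := fun c => by
    rw [hPdef]; exact (hσ (measurableSet_singleton c)).inter measurableSet_Icc
  have hPs : ∀ c, P c ⊆ Icc t₀ t₁ := fun c => by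
    rw [hPdef]; exact inter_subset_right
  have hPfin : ∀ c, ∀ Q, volume (P c ∩ Q) ≠ ⊤ := fun c Q =>
    ne_top_of_le_ne_top (by simp : volume (Icc t₀ t₁) ≠ ⊤)
      (measure_mono (inter_subset_left.trans (hPs c)))
  obtain ⟨ρ, hρ⟩ : ∃ ρ : ℝ → ℝ, ρ = fun t => dfun (P (σ t)) t / (volume (P (σ t))).toReal :=
    ⟨_, rfl⟩
  have hρm : Measurable ρ := by
    have h1 : Measurable (fun p : ι × ℝ => dfun (P p.1) p.2 / (volume (P p.1)).toReal) := by
      apply measurable_from_prod_countable_right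
      intro c
      exact (dfun_continuous (hPs c)).measurable.div_const (volume (P c)).toReal
    have h2 : Measurable (fun t : ℝ => (σ t, t)) := hσ.prodMk measurable_id
    rw [hρ]; exact h1.comp h2
  have hset : ∀ b, MeasurableSet {s | ρ s < b} := fun b => measurableSet_lt hρm measurable_const
  -- one-sided levels
  have key : ∀ c b, 0 ≤ b → b ≤ 1 →
      (volume (P c ∩ {s | ρ s < b})).toReal = b * (volume (P c)).toReal := by
    intro c b hb0 hb1
    rcases eq_or_lt_of_le (ENNReal.toReal_nonneg (a := volume (P c))) with h0 | h0
    · rw [← h0, mul_zero]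
      apply le_antisymm _ ENNReal.toReal_nonneg
      rw [h0]
      exact ENNReal.toReal_mono (by simpa using hPfin c univ) (measure_mono inter_subset_left)
    · have : P c ∩ {s | ρ s < b} = P c ∩ {s | dfun (P c) s < b * (volume (P c)).toReal} := by
        ext u
        simp only [mem_inter_iff, mem_ofPred_eq, and_congr_right_iff]
        intro hu
        have : σ u = c := by rw [hPdef] at hu; exact hu.1
        rw [hρ]
        simp only [this]
        rw [div_lt_iff₀ h0]
      rw [this]
      refine dfun_level ht (hPs c) (by positivity) ?_
      nlinarith
  refine ⟨ρ, hρm, ?_⟩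
  intro a b ha hab hb
  have hBm : MeasurableSet {s | a ≤ ρ s ∧ ρ s < b} :=
    (measurableSet_le measurable_const hρm).inter (hset b)
  refine Measure.ext_of_singleton (fun c => ?_)
  rw [Measure.smul_apply, Measure.map_apply hσ (measurableSet_singleton c),
    Measure.map_apply hσ (measurableSet_singleton c),
    Measure.restrict_apply (hσ (measurableSet_singleton c)),
    Measure.restrict_apply ((hσ (measurableSet_singleton c)).inter hBm),
    Measure.restrict_apply (hσ (measurableSet_singleton c))]
  have e1 : σ ⁻¹' {c} ∩ {s | a ≤ ρ s ∧ ρ s < b} ∩ Icc t₀ t₁ =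
      (P c ∩ {s | ρ s < b}) \ (P c ∩ {s | ρ s < a}) := by
    ext u
    simp only [hPdef, mem_inter_iff, mem_ofPred_eq, Set.mem_sdiff, not_and, not_lt]
    tauto
  have hsub : P c ∩ {s | ρ s < a} ⊆ P c ∩ {s | ρ s < b} := fun u hu => ⟨hu.1, lt_of_lt_of_le hu.2 hab⟩
  rw [e1, ← hPdef, ← ENNReal.toReal_eq_toReal_iff' (ne_top_of_le_ne_top (hPfin c _) (measure_mono sdiff_subset))
    (by simpa using ENNReal.mul_ne_top ENNReal.ofReal_ne_top (by simpa using hPfin c univ)),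
    measure_sdiff hsub
      ((hPm c).inter (hset a)).nullMeasurableSet (hPfin c _),
    ENNReal.toReal_sub_of_le (measure_mono hsub) (hPfin c _),
    key c b (ha.trans hab) hb, key c a ha (hab.trans hb), smul_eq_mul, ENNReal.toReal_mul,
    ENNReal.toReal_ofReal (by linarith)]
  ring


theorem rank_exists {E : Type*} [NormedAddCommGroup E] [NormedSpace ℝ E]
    [FiniteDimensional ℝ E] {t₀ t₁ : ℝ} (ht : t₀ < t₁) {ζ : ℝ → E}
    (hζ : AEStronglyMeasurable ζ (volume.restrict (Icc t₀ t₁))) {C : ℝ}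
    (hC : ∀ᵐ s ∂(volume.restrict (Icc t₀ t₁)), ‖ζ s‖ ≤ C) {δ : ℝ} (hδ : 0 < δ) :
    ∃ ρ : ℝ → ℝ, Measurable ρ ∧
      (∀ a b : ℝ, 0 ≤ a → a ≤ b → b ≤ 1 →
        (volume.restrict (Icc t₀ t₁)) {s | a ≤ ρ s ∧ ρ s < b} = 
          ENNReal.ofReal ((b - a) * (t₁ - t₀))) ∧
      (∀ a b : ℝ, 0 ≤ a → a ≤ b → b ≤ 1 → ∀ t ∈ Icc t₀ t₁,
        ‖(∫ s in t₀..t, {s | a ≤ ρ s ∧ ρ s < b}.indicator ζ s) - (b - a) • ∫ s in t₀..t, ζ s‖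
          ≤ δ * (b - a)) := by
  classical
  set μ := volume.restrict (Icc t₀ t₁) with hμ
  haveI : CompleteSpace E := FiniteDimensional.complete ℝ E
  haveI : ProperSpace E := FiniteDimensional.proper_real E
  letI : MeasurableSpace E := borel E
  haveI : BorelSpace E := ⟨rfl⟩
  -- a strongly measurable representative
  obtain ⟨ζ', hζ'm, hζ'⟩ := hζ
  have hζ'M : Measurable ζ' := hζ'm.measurable
  have hT : 0 < t₁ - t₀ := sub_pos.2 ht
  obtain ⟨δ', hδ'0, hδ'⟩ : ∃ δ' > 0, 2 * (δ' * (t₁ - t₀)) ≤ δ / 2 := 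
    ⟨δ / (4 * (t₁ - t₀)), by positivity, by field_simp; norm_num⟩
  have hC0 : 0 ≤ |C| := abs_nonneg C
  obtain ⟨M, hM0, hM⟩ : ∃ M : ℝ, 0 < M ∧ 2 * (|C| * M⁻¹) ≤ δ / 2 := 
    ⟨4 * (|C| + 1) / δ, by positivity, by field_simp; linarith⟩
  have hdense : ∀ s, ∃ k : ℕ, dist (ζ' s) (TopologicalSpace.denseSeq E k) < δ' := fun s =>
    (TopologicalSpace.denseRange_denseSeq E).exists_dist_lt (ζ' s) hδ'0
  have hσ1 : Measurable (fun s => Nat.find (hdense s)) := by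
    apply measurable_find
    intro k
    exact measurableSet_lt (hζ'M.dist measurable_const) measurable_const
  have hσ2 : Measurable (fun s : ℝ => ⌊(s - t₀) * M⌋) := by
    apply Int.measurable_floor.comp
    fun_prop
  obtain ⟨σ, hσdef⟩ : ∃ σ : ℝ → ℕ × ℤ, ∀ s, σ s = (Nat.find (hdense s), ⌊(s - t₀) * M⌋) := 
    ⟨_, fun _ => rfl⟩
  have hσ : Measurable σ := by
    have : σ = fun s => (Nat.find (hdense s), ⌊(s - t₀) * M⌋) := funext hσdef
    rw [this]
    exact hσ1.prodMk hσ2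
  obtain ⟨ρ, hρm, hρ⟩ := rank_pieces ht.le hσ
  rw [← hμ] at hρ
  obtain ⟨z, hz⟩ : ∃ z : ℕ × ℤ → E, ∀ c, z c = TopologicalSpace.denseSeq E c.1 := ⟨_, fun _ => rfl⟩
  have hzσ : ∀ s, ‖ζ' s - z (σ s)‖ ≤ δ' := by
    intro s
    rw [← dist_eq_norm, hz, hσdef]
    exact (Nat.find_spec (hdense s)).le
  have hzm : Measurable z := measurable_of_countable z
  have hBm : ∀ a b : ℝ, MeasurableSet {s | a ≤ ρ s ∧ ρ s < b} := fun a b =>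
    (measurableSet_le measurable_const hρm).inter (measurableSet_lt hρm measurable_const)
  have hμuniv : μ univ = ENNReal.ofReal (t₁ - t₀) := by simp [hμ]
  have hBmeas : ∀ a b : ℝ, 0 ≤ a → a ≤ b → b ≤ 1 →
      μ {s | a ≤ ρ s ∧ ρ s < b} = ENNReal.ofReal ((b - a) * (t₁ - t₀)) := by
    intro a b ha hab hb
    have := congrArg (fun ν => ν univ) (hρ a b ha hab hb)
    simp only [Measure.map_apply hσ MeasurableSet.univ, Measure.smul_apply, preimage_univ,
      Measure.restrict_apply MeasurableSet.univ, univ_inter, hμuniv] at this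
    rw [this, smul_eq_mul, ← ENNReal.ofReal_mul (by linarith)]
  refine ⟨ρ, hρm, hBmeas, ?_⟩
  intro a b ha hab hb t htI
  set B := {s | a ≤ ρ s ∧ ρ s < b} with hB
  set S := Icc t₀ t with hS
  set j0 := ⌊(t - t₀) * M⌋ with hj0
  set G := σ ⁻¹' {c | c.2 < j0} with hG
  set H := σ ⁻¹' {c | c.2 = j0} with hH
  have hGm : MeasurableSet G := hσ (Set.to_countable _).measurableSet
  have hHm : MeasurableSet H := hσ (Set.to_countable _).measurableSet
  have hSm : MeasurableSet S := measurableSet_Icc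
  have hba : 0 ≤ b - a := sub_nonneg.2 hab
  set μB := μ.restrict B with hμB
  haveI : IsFiniteMeasure μ := ⟨by rw [hμuniv]; exact ENNReal.ofReal_lt_top⟩
  -- the two integrals
  have conv : ∀ g : ℝ → E, ∫ s in t₀..t, g s = ∫ s in S, g s ∂μ := by
    intro g
    rw [intervalIntegral.integral_of_le htI.1, ← integral_Icc_eq_integral_Ioc, hμ,
      Measure.restrict_restrict hSm, inter_eq_self_of_subset_left (Icc_subset_Icc_right htI.2)]
  have hI2 : ∫ s in t₀..t, ζ s = ∫ s in S, ζ' s ∂μ := by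
    rw [conv]
    exact integral_congr_ae (ae_restrict_of_ae hζ')
  have hI1 : ∫ s in t₀..t, B.indicator ζ s = ∫ s in S, ζ' s ∂μB := by
    rw [conv, MeasureTheory.integral_indicator (hBm a b), Measure.restrict_restrict (hBm a b), hμB,
      Measure.restrict_restrict hSm, inter_comm]
    exact integral_congr_ae (ae_restrict_of_ae hζ')
  have hHμ : (μ H).toReal ≤ M⁻¹ := by
    have : μ H ≤ ENNReal.ofReal M⁻¹ := by
      have e : (t₀ + (j0 + 1) * M⁻¹) - (t₀ + j0 * M⁻¹) = M⁻¹ := by ring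
      rw [← e, ← Real.volume_Ico]
      refine (Measure.restrict_apply_le _ _).trans (measure_mono ?_)
      intro s hs
      have h1 : ⌊(s - t₀) * M⌋ = j0 := by
        have : (σ s).2 = j0 := hs
        rwa [hσdef] at this
      rw [Int.floor_eq_iff] at h1
      constructor
      · have := (div_le_iff₀ hM0).2 (h1.1)
        rw [div_eq_mul_inv] at this; linarith
      · have := (lt_div_iff₀ hM0).2 (h1.2)
        rw [div_eq_mul_inv] at this; linarith
    exact (ENNReal.toReal_mono ENNReal.ofReal_ne_top this).trans
      (le_of_eq (ENNReal.toReal_ofReal (by positivity)))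
  have hHμB : (μB H).toReal = (b - a) * (μ H).toReal := by
    have := congrArg (fun ν => ν {c : ℕ × ℤ | c.2 = j0}) (hρ a b ha hab hb)
    simp only [Measure.map_apply hσ (Set.to_countable _).measurableSet, Measure.smul_apply] at this
    rw [← hB, ← hμB] at this
    change μB H = _ • μ H at this
    rw [this, smul_eq_mul, ENNReal.toReal_mul, ENNReal.toReal_ofReal hba]
  have hμBuniv : (μB univ).toReal = (b - a) * (t₁ - t₀) := by
    rw [hμB, Measure.restrict_apply MeasurableSet.univ, univ_inter, hBmeas a b ha hab hb,
      ENNReal.toReal_ofReal (by positivity)]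
  have hC' : ∀ᵐ s ∂μ, ‖ζ' s‖ ≤ |C| := by
    filter_upwards [hC, hζ'] with s h1 h2
    rw [← h2]; exact h1.trans (le_abs_self C)
  have hIntg : Integrable ζ' μ := Integrable.of_bound hζ'm.aestronglyMeasurable _ hC'
  have hzσm : Measurable (fun s => z (σ s)) := hzm.comp hσ
  have hintz : Integrable (fun s => z (σ s)) μ := by
    refine Integrable.of_bound hzσm.aestronglyMeasurable (|C| + δ') ?_
    filter_upwards [hC'] with s hs
    calc ‖z (σ s)‖ = ‖ζ' s - (ζ' s - z (σ s))‖ := by simp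
      _ ≤ ‖ζ' s‖ + ‖ζ' s - z (σ s)‖ := norm_sub_le _ _
      _ ≤ _ := add_le_add hs (hzσ s)
  -- general splitting for a measure `ν ≤ μ`
  have split : ∀ ν : Measure ℝ, ν ≤ μ → 
      ‖∫ s in S, ζ' s ∂ν - ∫ s in G, z (σ s) ∂ν‖ ≤ δ' * (ν univ).toReal + |C| * (ν H).toReal := by
    intro ν hν
    haveI : IsFiniteMeasure ν := ⟨lt_of_le_of_lt (hν univ) (by rw [hμuniv]; exact ENNReal.ofReal_lt_top)⟩
    have hIcc : ∀ᵐ s ∂ν, s ∈ Icc t₀ t₁ := by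
      have : ∀ᵐ s ∂μ, s ∈ Icc t₀ t₁ := ae_restrict_mem measurableSet_Icc
      exact hν.absolutelyContinuous.ae_le this
    have hGS : (G ∩ S : Set ℝ) =ᵐ[ν] G := by
      filter_upwards [hIcc] with s hs
      apply propext
      refine ⟨fun h => h.1, fun h => ⟨h, hs.1, ?_⟩⟩
      have h1 : ⌊(s - t₀) * M⌋ < j0 := by
        have : (σ s).2 < j0 := h
        rwa [hσdef] at this
      by_contra hc
      have : (t - t₀) * M ≤ (s - t₀) * M := by
        have := (not_le.1 hc).le
        gcongr
      exact absurd (Int.floor_le_floor this) (not_le.2 h1)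
    have e1 : ∫ s in S, ζ' s ∂ν = ∫ s in G, ζ' s ∂ν + ∫ s in S \ G, ζ' s ∂ν := by
      rw [← setIntegral_congr_set hGS, ← integral_inter_add_sdiff hGm
        (hIntg.mono_measure hν).integrableOn, inter_comm]
    have e2 : ‖∫ s in S \ G, ζ' s ∂ν‖ ≤ |C| * (ν H).toReal := by
      have h1 : ‖∫ s in S \ G, ζ' s ∂ν‖ ≤ |C| * (ν (S \ G)).toReal := by
        refine norm_setIntegral_le_of_norm_le_const_ae (measure_lt_top _ _) ?_
        have := hν.absolutelyContinuous.ae_le hC'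
        exact ae_restrict_of_ae this
      refine h1.trans ?_
      gcongr
      · exact measure_ne_top _ _
      · intro s hs
        have h1 : ¬ ((σ s).2 < j0) := hs.2
        have h2 : (σ s).2 ≤ j0 := by
          rw [hσdef]
          apply Int.floor_le_floor
          have := hs.1.2
          gcongr
        exact le_antisymm h2 (not_lt.1 h1)
    have e3 : ‖∫ s in G, ζ' s ∂ν - ∫ s in G, z (σ s) ∂ν‖ ≤ δ' * (ν univ).toReal := by
      rw [← integral_sub (hIntg.mono_measure hν).integrableOn (hintz.mono_measure hν).integrableOn]
      refine (norm_setIntegral_le_of_norm_le_const (measure_lt_top _ _) (fun s _ => hzσ s)).trans ?_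
      gcongr
      exact ENNReal.toReal_mono (measure_ne_top _ _) (measure_mono (subset_univ _))
    rw [e1]
    calc _ = ‖(∫ s in G, ζ' s ∂ν - ∫ s in G, z (σ s) ∂ν) + ∫ s in S \ G, ζ' s ∂ν‖ := by
            congr 1; abel
      _ ≤ _ := (norm_add_le _ _).trans (add_le_add e3 e2)
  have main : ∫ s in G, z (σ s) ∂μB = (b - a) • ∫ s in G, z (σ s) ∂μ := by
    have h1 : ∀ ν : Measure ℝ, ∫ s in G, z (σ s) ∂ν = ∫ c in {c | c.2 < j0}, z c ∂(Measure.map σ ν) :=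
      fun ν => (setIntegral_map (Set.to_countable _).measurableSet
        hzm.aestronglyMeasurable hσ.aemeasurable).symm
    rw [h1, h1, hρ a b ha hab hb, Measure.restrict_smul, MeasureTheory.integral_smul_measure,
      ENNReal.toReal_ofReal hba]
  rw [hI1, hI2]
  have s1 := split μB Measure.restrict_le_self
  have s2 := split μ le_rfl
  rw [hμBuniv, hHμB, main] at s1
  rw [hμuniv, ENNReal.toReal_ofReal hT.le] at s2
  have s2' : ‖(b - a) • (∫ s in S, ζ' s ∂μ - ∫ s in G, z (σ s) ∂μ)‖ ≤
      (b - a) * (δ' * (t₁ - t₀) + |C| * (μ H).toReal) := by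
    rw [norm_smul, Real.norm_of_nonneg hba]
    gcongr
  have hCM : |C| * (μ H).toReal ≤ |C| * M⁻¹ := by gcongr
  calc _ = ‖(∫ s in S, ζ' s ∂μB - (b - a) • ∫ s in G, z (σ s) ∂μ) -
        (b - a) • (∫ s in S, ζ' s ∂μ - ∫ s in G, z (σ s) ∂μ)‖ := by
          rw [smul_sub]; congr 1; abel
    _ ≤ _ := norm_sub_le _ _
    _ ≤ (b - a) * (2 * (δ' * (t₁ - t₀)) + 2 * (|C| * (μ H).toReal)) := by
      refine (add_le_add s1 s2').trans (le_of_eq (by ring))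
    _ ≤ (b - a) * δ := by
      gcongr
      linarith
    _ = _ := mul_comm _ _

end Rank
end SOC

namespace SOC

theorem sep_zero {W : Type*} [NormedAddCommGroup W] [NormedSpace ℝ W] [FiniteDimensional ℝ W]
    {C : Set W} (hC : Convex ℝ C) (hne : C.Nonempty) (h0 : (0:W) ∉ interior C) :
    ∃ l : W →ₗ[ℝ] ℝ, l ≠ 0 ∧ ∀ c ∈ C, 0 ≤ l c := by
  by_cases hi : (interior C).Nonempty
  · obtain ⟨f, hf⟩ := geometric_hahn_banach_open_point hC.interior isOpen_interior h0
    simp only [map_zero] at hf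
    refine ⟨-(f : W →ₗ[ℝ] ℝ), ?_, ?_⟩
    · intro h
      obtain ⟨w, hw⟩ := hi
      have h1 := hf w hw
      have h2 := congrArg (fun l : W →ₗ[ℝ] ℝ => l w) h
      simp at h2
      linarith
    · intro c hc
      have h1 : c ∈ closure (interior C) := by
        rw [hC.closure_interior_eq_closure_of_nonempty_interior hi]
        exact subset_closure hc
      have h2 : closure (interior C) ⊆ {w | f w ≤ 0} :=
        closure_minimal (fun w hw => (hf w hw).le) (isClosed_le f.continuous continuous_const)
      have h3 : f c ≤ 0 := h2 h1
      simpa using h3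
  · rw [hC.interior_nonempty_iff_affineSpan_eq_top] at hi
    have h1 : vectorSpan ℝ C < ⊤ := by
      rw [lt_top_iff_ne_top]
      intro h
      apply hi
      rw [← AffineSubspace.direction_eq_top_iff_of_nonempty, direction_affineSpan, h]
      exact (affineSpan_nonempty ℝ).2 hne
    obtain ⟨f, hf0, hf⟩ := Submodule.exists_le_ker_of_lt_top _ h1
    obtain ⟨c0, hc0⟩ := hne
    have hconst : ∀ c ∈ C, f c = f c0 := by
      intro c hc
      have := hf (vsub_mem_vectorSpan ℝ hc hc0)
      rw [LinearMap.mem_ker] at this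
      simp only [vsub_eq_sub, map_sub] at this
      linarith
    by_cases h : 0 ≤ f c0
    · exact ⟨f, hf0, fun c hc => (hconst c hc).symm ▸ h⟩
    · refine ⟨-f, neg_ne_zero.2 hf0, fun c hc => ?_⟩
      rw [LinearMap.neg_apply, hconst c hc]
      linarith

theorem nonneg_of_affine {A B : ℝ} (h : ∀ t : ℝ, 0 < t → 0 ≤ A + t * B) : 0 ≤ B := by
  by_contra hB
  push Not at hB
  have h1 := h ((|A| + 1) / (-B)) (by have := abs_nonneg A; apply div_pos <;> linarith)
  have h2 : (|A| + 1) / (-B) * B = -(|A| + 1) := by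
    rw [div_neg, neg_mul, div_mul_cancel₀ _ hB.ne]
  rw [h2] at h1
  have := le_abs_self A
  linarith

theorem nonneg_of_small {A B : ℝ} (h : ∀ t : ℝ, 0 < t → 0 ≤ A + t * B) : 0 ≤ A := by
  apply nonneg_of_affine (A := B)
  intro t ht
  have := h t⁻¹ (by positivity)
  have h2 : B + t * A = t * (A + t⁻¹ * B) := by field_simp; ring
  rw [h2]; positivity

/-- The cone attached to a finite family of needles. -/
def coneSet {W V κ : Type*} [AddCommGroup W] [Module ℝ W] [AddCommGroup V] [Module ℝ V]
    (D : V →ₗ[ℝ] W) (e : κ → W) (c0 : W) (Sg : Set W) (S : Finset κ) : Set W :=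
  {w | ∃ (a : V) (α : κ → ℝ) (s : W), (∀ k, 0 ≤ α k) ∧ s ∈ Sg ∧
    w = c0 + D a + ∑ k ∈ S, α k • e k + s}

theorem coneSet_convex {W V κ : Type*} [AddCommGroup W] [Module ℝ W] [AddCommGroup V] [Module ℝ V]
    (D : V →ₗ[ℝ] W) (e : κ → W) (c0 : W) {Sg : Set W} (hSg : Convex ℝ Sg) (S : Finset κ) :
    Convex ℝ (coneSet D e c0 Sg S) := by
  rintro _ ⟨a, α, s, hα, hs, rfl⟩ _ ⟨a', α', s', hα', hs', rfl⟩ x y hx hy hxy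
  refine ⟨x • a + y • a', fun k => x * α k + y * α' k, x • s + y • s', 
    fun k => add_nonneg (mul_nonneg hx (hα k)) (mul_nonneg hy (hα' k)), hSg hs hs' hx hy hxy, ?_⟩
  simp only [smul_add, add_smul, Finset.sum_add_distrib, map_add, map_smul, mul_smul, Finset.smul_sum]
  have : c0 = x • c0 + y • c0 := by rw [← add_smul, hxy, one_smul]
  nth_rewrite 3 [this]
  abel

theorem coneSet_mono {W V κ : Type*} [AddCommGroup W] [Module ℝ W] [AddCommGroup V] [Module ℝ V]
    (D : V →ₗ[ℝ] W) (e : κ → W) (c0 : W) (Sg : Set W) {S S' : Finset κ} (h : S ⊆ S') :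
    coneSet D e c0 Sg S ⊆ coneSet D e c0 Sg S' := by
  classical
  rintro _ ⟨a, α, s, hα, hs, rfl⟩
  refine ⟨a, fun k => if k ∈ S then α k else 0, s, ?_, hs, ?_⟩
  · intro k; dsimp only; split_ifs; exacts [hα k, le_rfl]
  · congr 2
    rw [← Finset.sum_subset h]
    · refine Finset.sum_congr rfl (fun k hk => by simp [hk])
    · intro k _ hk; simp [hk]

theorem cone_alt {W V κ F : Type*} [NormedAddCommGroup W] [NormedSpace ℝ W] [FiniteDimensional ℝ W]
    [AddCommGroup V] [Module ℝ V] [AddCommGroup F] [Module ℝ F]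
    (D : V →ₗ[ℝ] W) (e : κ → W) (c0 : W) {Sg : Set W} (hSg : Convex ℝ Sg) (hne : Sg.Nonempty)
    (hsc : ∀ s ∈ Sg, ∀ t : ℝ, 0 < t → t • s ∈ Sg)
    (π : W →ₗ[ℝ] F) (hπ : Function.Surjective π) (hπS : ∀ s ∈ Sg, π s = 0) :
    (∃ l : W →ₗ[ℝ] ℝ, l ≠ 0 ∧ (∀ a, l (D a) = 0) ∧ (∀ k, 0 ≤ l (e k)) ∧ (∀ s ∈ Sg, 0 ≤ l s) ∧
      0 ≤ l c0) ∨
    (∃ (N : ℕ) (k : Fin N → κ) (a : V) (α : Fin N → ℝ) (s : W), (∀ j, 0 < α j) ∧ s ∈ Sg ∧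
      c0 + D a + ∑ j, α j • e (k j) + s = 0 ∧
      ∀ w : F, ∃ (a : V) (α : Fin N → ℝ), π (D a + ∑ j, α j • e (k j)) = w) := by
  classical
  obtain ⟨C, hCdef⟩ : ∃ C : Set W, C = ⋃ S : Finset κ, coneSet D e c0 Sg S := ⟨_, rfl⟩
  have hCc : Convex ℝ C := by
    rw [hCdef]
    refine Directed.convex_iUnion ?_ (fun S => coneSet_convex D e c0 hSg S)
    intro S S'
    exact ⟨S ∪ S', coneSet_mono D e c0 Sg Finset.subset_union_left,
      coneSet_mono D e c0 Sg Finset.subset_union_right⟩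
  obtain ⟨s0, hs0⟩ := hne
  have hCne : C.Nonempty := by
    rw [hCdef]
    exact ⟨_, mem_iUnion.2 ⟨∅, 0, 0, s0, fun _ => le_rfl, hs0, rfl⟩⟩
  by_cases h0 : (0:W) ∈ interior C
  · right
    obtain ⟨b, hb1, hb2⟩ := exists_mem_interior_convexHull_affineBasis (mem_interior_iff_mem_nhds.1 h0)
    have hbC : ∀ i, ∃ S, b i ∈ coneSet D e c0 Sg S := by
      intro i
      have : b i ∈ C := hb2 (subset_convexHull ℝ _ (mem_range_self i))
      rw [hCdef] at this
      exact mem_iUnion.1 this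
    choose Si hSi using hbC
    obtain ⟨S, hS⟩ : ∃ S : Finset κ, S = Finset.univ.biUnion Si := ⟨_, rfl⟩
    have hIntg : coneSet D e c0 Sg S ∈ 𝓝 (0:W) := by
      refine mem_interior_iff_mem_nhds.1 (interior_mono ?_ hb1)
      refine convexHull_min ?_ (coneSet_convex D e c0 hSg S)
      rintro _ ⟨i, rfl⟩
      refine coneSet_mono D e c0 Sg ?_ (hSi i)
      rw [hS]
      exact Finset.subset_biUnion_of_mem Si (Finset.mem_univ i)
    have hsmall : ∀ w : W, ∃ t : ℝ, 0 < t ∧ t • w ∈ coneSet D e c0 Sg S := by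
      intro w
      have h1 : Tendsto (fun t : ℝ => t • w) (𝓝[>] 0) (𝓝 0) := by
        have : Tendsto (fun t : ℝ => t • w) (𝓝 0) (𝓝 ((0:ℝ) • w)) :=
          (continuous_id.smul continuous_const).tendsto 0
        rw [zero_smul] at this
        exact this.mono_left nhdsWithin_le_nhds
      have h2 := (h1.eventually hIntg).and self_mem_nhdsWithin
      obtain ⟨t, ht1, ht2⟩ := h2.exists
      exact ⟨t, ht2, ht1⟩
    have hsum : ∀ α : κ → ℝ, ∑ j : Fin S.card, α ((S.equivFin.symm j : S) : κ) • 
        e ((S.equivFin.symm j : S) : κ) = ∑ k ∈ S, α k • e k := by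
      intro α
      rw [Equiv.sum_comp S.equivFin.symm (fun x : S => α (x : κ) • e (x : κ)),
        Finset.sum_coe_sort S (fun k => α k • e k)]
    obtain ⟨θ, hθ, a, α, s, hα, hs, hEq⟩ := hsmall (-(c0 + ∑ k ∈ S, (1:ℝ) • e k + s0))
    have hθ1 : 0 < 1 + θ := by linarith
    refine ⟨S.card, fun j => ((S.equivFin.symm j : S) : κ), (1 + θ)⁻¹ • a,
      fun j => (1 + θ)⁻¹ * (α ((S.equivFin.symm j : S) : κ) + θ),
      (1 + θ)⁻¹ • (s + θ • s0), ?_, ?_, ?_, ?_⟩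
    · intro j
      have := hα ((S.equivFin.symm j : S) : κ)
      positivity
    · have := hSg hs hs0 (a := (1 + θ)⁻¹) (b := (1 + θ)⁻¹ * θ) (by positivity) (by positivity)
        (by field_simp)
      rwa [smul_add, smul_smul]
    · rw [hsum (fun k => (1 + θ)⁻¹ * (α k + θ))]
      have h1 : (1 + θ) • c0 + D a + ∑ k ∈ S, (α k + θ) • e k + (s + θ • s0) = 0 := by
        have : ∑ k ∈ S, (α k + θ) • e k = ∑ k ∈ S, α k • e k + θ • ∑ k ∈ S, e k := by
          rw [Finset.smul_sum, ← Finset.sum_add_distrib]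
          exact Finset.sum_congr rfl (fun k _ => add_smul _ _ _)
        rw [this, add_smul, one_smul]
        simp only [one_smul] at hEq
        have h2 : c0 + D a + ∑ k ∈ S, α k • e k + s + θ • (c0 + ∑ k ∈ S, e k + s0) = 0 := by
          rw [← hEq, smul_neg, neg_add_cancel]
        rw [← h2, smul_add, smul_add]
        abel
      have h2 := congrArg (fun w => (1 + θ)⁻¹ • w) h1
      simp only [smul_add, smul_zero, Finset.smul_sum] at h2
      rw [smul_smul, inv_mul_cancel₀ hθ1.ne', one_smul] at h2
      rw [← h2, map_smul]
      simp only [smul_add, mul_smul]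
    · intro w
      obtain ⟨w', rfl⟩ := hπ w
      obtain ⟨a0, α0, z0, -, hz0, hE0⟩ := mem_of_mem_nhds hIntg
      obtain ⟨t, ht, a1, α1, z1, -, hz1, hE1⟩ := hsmall w'
      refine ⟨t⁻¹ • (a1 - a0), fun j => t⁻¹ * (α1 ((S.equivFin.symm j : S) : κ) - 
        α0 ((S.equivFin.symm j : S) : κ)), ?_⟩
      rw [hsum (fun k => t⁻¹ * (α1 k - α0 k))]
      have h1 : w' = t⁻¹ • (D (a1 - a0) + ∑ k ∈ S, (α1 k - α0 k) • e k + (z1 - z0)) := by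
        have : D (a1 - a0) + ∑ k ∈ S, (α1 k - α0 k) • e k + (z1 - z0) = t • w' := by
          have hE2 : t • w' = c0 + D a1 + ∑ k ∈ S, α1 k • e k + z1 -
              (c0 + D a0 + ∑ k ∈ S, α0 k • e k + z0) := by rw [← hE0, ← hE1, sub_zero]
          rw [hE2]
          simp only [sub_smul, Finset.sum_sub_distrib, map_sub]
          abel
        rw [this, smul_smul, inv_mul_cancel₀ ht.ne', one_smul]
      have hz : π (z1 - z0) = 0 := by rw [map_sub, hπS z1 hz1, hπS z0 hz0, sub_zero]
      conv_rhs => rw [h1]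
      simp only [map_smul, map_add, hz, smul_zero, add_zero, smul_add, mul_smul, map_sum, Finset.smul_sum]
  · left
    obtain ⟨l, hl0, hl⟩ := sep_zero hCc hCne h0
    have key : ∀ (S : Finset κ) (a : V) (α : κ → ℝ) (s : W), (∀ k, 0 ≤ α k) → s ∈ Sg →
        0 ≤ l c0 + l (D a) + ∑ k ∈ S, α k * l (e k) + l s := by
      intro S a α s hα hs
      have := hl (c0 + D a + ∑ k ∈ S, α k • e k + s) (by
        rw [hCdef]; exact mem_iUnion.2 ⟨S, a, α, s, hα, hs, rfl⟩)
      simpa [map_add, map_sum] using this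
    have hD : ∀ a, 0 ≤ l (D a) := by
      intro a
      apply nonneg_of_affine (A := l c0 + l s0)
      intro t ht
      have := key ∅ (t • a) 0 s0 (fun _ => le_rfl) hs0
      simp only [map_smul, smul_eq_mul, Finset.sum_empty] at this
      linarith
    refine ⟨l, hl0, ?_, ?_, ?_, ?_⟩
    · intro a
      have h1 := hD a
      have h2 := hD (-a)
      simp only [map_neg] at h2
      linarith
    · intro k
      apply nonneg_of_affine (A := l c0 + l s0)
      intro t ht
      have := key {k} 0 (fun _ => t) s0 (fun _ => ht.le) hs0
      simp only [map_zero, Finset.sum_singleton] at this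
      linarith
    · intro s hs
      apply nonneg_of_affine (A := l c0)
      intro t ht
      have := key ∅ 0 0 (t • s) (fun _ => le_rfl) (hsc s hs t ht)
      simp only [map_zero, map_smul, smul_eq_mul, Finset.sum_empty] at this
      linarith
    · apply nonneg_of_small (B := l s0)
      intro t ht
      have := key ∅ 0 0 (t • s0) (fun _ => le_rfl) (hsc s0 hs0 t ht)
      simp only [map_zero, map_smul, smul_eq_mul, Finset.sum_empty] at this
      linarith

end SOC

namespace SOC

section Needle
variable {E : Type*} [NormedAddCommGroup E] [NormedSpace ℝ E]

/-- The level band of a rank function. -/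
def band (ρ : ℝ → ℝ) (a b : ℝ) : Set ℝ := {s | a ≤ ρ s ∧ ρ s < b}

theorem band_meas {ρ : ℝ → ℝ} (hρ : Measurable ρ) (a b : ℝ) : MeasurableSet (band ρ a b) :=
  (measurableSet_le measurable_const hρ).inter (measurableSet_lt hρ measurable_const)

theorem prim_sum {t₀ t₁ : ℝ} (ht : t₀ ≤ t₁) {ι : Type*} (S : Finset ι) {g : ι → ℝ → E}
    (h : ∀ i, IntegrableOn (g i) (Icc t₀ t₁)) :
    prim t₀ t₁ (fun s => ∑ i ∈ S, g i s) = ∑ i ∈ S, prim t₀ t₁ (g i) := by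
  classical
  induction S using Finset.induction_on with
  | empty =>
    simp only [Finset.sum_empty]
    ext1 t
    rw [prim_apply ht integrableOn_zero]
    simp
  | insert i S hi ih =>
    simp only [Finset.sum_insert hi]
    rw [prim_add ht (h i) (integrable_finsetSum _ (fun i _ => h i)), ih]

theorem ind_int {t₀ t₁ : ℝ} {ρ : ℝ → ℝ} (hρ : Measurable ρ) (a b : ℝ) {χ : ℝ → E}
    (hχ : IntegrableOn χ (Icc t₀ t₁)) :
    IntegrableOn ((band ρ a b).indicator χ) (Icc t₀ t₁) :=
  Integrable.indicator hχ (band_meas hρ a b)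

theorem needle0 {t₀ t₁ : ℝ} (ht : t₀ ≤ t₁) {ρ : ℝ → ℝ} (hρ : Measurable ρ) {a b : ℝ} (hab : a ≤ b)
    (hm : (volume.restrict (Icc t₀ t₁)) (band ρ a b) = ENNReal.ofReal ((b - a) * (t₁ - t₀)))
    {χ : ℝ → E} (hχ : IntegrableOn χ (Icc t₀ t₁)) {c : ℝ}
    (hc : ∀ᵐ s ∂(volume.restrict (Icc t₀ t₁)), ‖χ s‖ ≤ c) :
    ‖prim t₀ t₁ ((band ρ a b).indicator χ)‖ ≤ (b - a) * ((t₁ - t₀) * c) := by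
  refine (norm_prim_le_integral ht (ind_int hρ a b hχ)).trans ?_
  have h1 : ∀ s, ‖(band ρ a b).indicator χ s‖ = (band ρ a b).indicator (fun s => ‖χ s‖) s :=
    fun s => norm_indicator_eq_indicator_norm _ _
  simp only [h1]
  rw [MeasureTheory.integral_indicator (band_meas hρ a b)]
  have h2 := norm_setIntegral_le_of_norm_le_const_ae (μ := volume.restrict (Icc t₀ t₁))
    (s := band ρ a b) (f := fun s => ‖χ s‖) (C := c) (by rw [hm]; exact ENNReal.ofReal_lt_top)
    (ae_restrict_of_ae (by filter_upwards [hc] with s hs; simpa using hs))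
  rw [measureReal_def, hm, ENNReal.toReal_ofReal 
    (mul_nonneg (sub_nonneg.2 hab) (sub_nonneg.2 ht))] at h2
  refine (Real.le_norm_self _).trans (h2.trans (le_of_eq (by ring)))

theorem rank_fin [FiniteDimensional ℝ E] {t₀ t₁ : ℝ} (ht : t₀ < t₁) {N : ℕ} {ζ : Fin N → ℝ → E}
    (hζ : ∀ k, AEStronglyMeasurable (ζ k) (volume.restrict (Icc t₀ t₁))) {C : ℝ}
    (hC : ∀ k, ∀ᵐ s ∂(volume.restrict (Icc t₀ t₁)), ‖ζ k s‖ ≤ C) {δ : ℝ} (hδ : 0 < δ) :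
    ∃ ρ : ℝ → ℝ, Measurable ρ ∧
      (∀ a b : ℝ, 0 ≤ a → a ≤ b → b ≤ 1 →
        (volume.restrict (Icc t₀ t₁)) (band ρ a b) = ENNReal.ofReal ((b - a) * (t₁ - t₀))) ∧
      (∀ k, ∀ a b : ℝ, 0 ≤ a → a ≤ b → b ≤ 1 →
        ‖prim t₀ t₁ ((band ρ a b).indicator (ζ k)) - (b - a) • prim t₀ t₁ (ζ k)‖ ≤ δ * (b - a)) := by
  have hIntg : ∀ k, IntegrableOn (ζ k) (Icc t₀ t₁) := fun k => integrableOn_of_bdd (hζ k) (hC k)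
  have hm : AEStronglyMeasurable (fun s k => ζ k s) (volume.restrict (Icc t₀ t₁)) := by
    have := FiniteDimensional.proper_real E
    borelize E
    exact (aemeasurable_pi_lambda _ (fun k => (hζ k).aemeasurable)).aestronglyMeasurable
  have hC' : ∀ᵐ s ∂(volume.restrict (Icc t₀ t₁)), ‖(fun k => ζ k s)‖ ≤ |C| := by
    filter_upwards [ae_all_iff.2 hC] with s hs
    exact (pi_norm_le_iff_of_nonneg (abs_nonneg C)).2 (fun k => (hs k).trans (le_abs_self C))
  obtain ⟨ρ, hρ, h1, h2⟩ := rank_exists ht hm hC' hδ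
  refine ⟨ρ, hρ, h1, ?_⟩
  intro k a b ha hab hb
  rw [ContinuousMap.norm_le _ (mul_nonneg hδ.le (sub_nonneg.2 hab))]
  intro t
  rw [ContinuousMap.sub_apply, ContinuousMap.smul_apply, prim_apply ht.le (hIntg k),
    prim_apply ht.le (ind_int hρ a b (hIntg k))]
  refine le_trans ?_ (h2 a b ha hab hb t t.2)
  refine le_trans (le_of_eq ?_) (norm_le_pi_norm _ k)
  have hI : IntegrableOn (fun s k => ζ k s) (Icc t₀ t₁) := integrableOn_of_bdd hm hC'
  have e1 := (ContinuousLinearMap.proj (R := ℝ) (φ := fun _ : Fin N => E) k).intervalIntegral_comp_comm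
    (ii_of_on hI t.2)
  have e2 := (ContinuousLinearMap.proj (R := ℝ) (φ := fun _ : Fin N => E) k).intervalIntegral_comp_comm
    (ii_of_on (ind_int hρ a b hI) t.2)
  simp only [ContinuousLinearMap.proj_apply] at e1 e2
  rw [Pi.sub_apply, Pi.smul_apply, ← e1]
  change _ = ‖(∫ s in t₀..t, (band ρ a b).indicator (fun s k => ζ k s) s) k - _‖
  rw [← e2]
  congr 4
  ext s
  by_cases hs : s ∈ band ρ a b
  · simp [hs]
  · simp [hs]

theorem needle1 {t₀ t₁ : ℝ} (ht : t₀ ≤ t₁) {ρ : ℝ → ℝ} (hρ : Measurable ρ) {a b : ℝ} (hab : a ≤ b)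
    (hm : (volume.restrict (Icc t₀ t₁)) (band ρ a b) = ENNReal.ofReal ((b - a) * (t₁ - t₀)))
    {χ ζ : ℝ → E} (hχ : IntegrableOn χ (Icc t₀ t₁)) (hζ : IntegrableOn ζ (Icc t₀ t₁)) {c δ : ℝ}
    (hc : ∀ᵐ s ∂(volume.restrict (Icc t₀ t₁)), ‖χ s - ζ s‖ ≤ c)
    (hδ : ‖prim t₀ t₁ ((band ρ a b).indicator ζ) - (b - a) • prim t₀ t₁ ζ‖ ≤ δ * (b - a)) :
    ‖prim t₀ t₁ ((band ρ a b).indicator χ) - (b - a) • prim t₀ t₁ ζ‖ ≤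
      (b - a) * ((t₁ - t₀) * c + δ) := by
  have h1 : prim t₀ t₁ ((band ρ a b).indicator χ) =
      prim t₀ t₁ ((band ρ a b).indicator (fun s => χ s - ζ s)) + 
        prim t₀ t₁ ((band ρ a b).indicator ζ) := by
    rw [← prim_add ht (ind_int (χ := fun s => χ s - ζ s) hρ a b (hχ.sub hζ)) (ind_int hρ a b hζ)]
    congr 1
    ext s
    by_cases hs : s ∈ band ρ a b <;> simp [hs]
  rw [h1, add_sub_assoc]
  refine (norm_add_le _ _).trans ?_
  have h2 := needle0 ht hρ hab hm (χ := fun s => χ s - ζ s) (hχ.sub hζ) hc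
  linarith

theorem needle2 {t₀ t₁ : ℝ} (ht : t₀ ≤ t₁) {ρ : ℝ → ℝ} (hρ : Measurable ρ)
    (hm : ∀ a b : ℝ, 0 ≤ a → a ≤ b → b ≤ 1 →
        (volume.restrict (Icc t₀ t₁)) (band ρ a b) = ENNReal.ofReal ((b - a) * (t₁ - t₀)))
    {χ ζ : ℝ → E} (hχ : IntegrableOn χ (Icc t₀ t₁)) (hζ : IntegrableOn ζ (Icc t₀ t₁)) {c δ : ℝ}
    (hc : ∀ᵐ s ∂(volume.restrict (Icc t₀ t₁)), ‖χ s - ζ s‖ ≤ c)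
    (hδ : ∀ a b : ℝ, 0 ≤ a → a ≤ b → b ≤ 1 →
      ‖prim t₀ t₁ ((band ρ a b).indicator ζ) - (b - a) • prim t₀ t₁ ζ‖ ≤ δ * (b - a))
    {a b b' : ℝ} (ha : 0 ≤ a) (hb1 : a ≤ b) (hb2 : b ≤ 1) (hb1' : a ≤ b') (hb2' : b' ≤ 1) :
    ‖prim t₀ t₁ ((band ρ a b).indicator χ) - prim t₀ t₁ ((band ρ a b').indicator χ)
      - (b - b') • prim t₀ t₁ ζ‖ ≤ |b - b'| * ((t₁ - t₀) * c + δ) := by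
  have key : ∀ b b' : ℝ, a ≤ b' → b' ≤ b → b ≤ 1 → 
    ‖prim t₀ t₁ ((band ρ a b).indicator χ) - prim t₀ t₁ ((band ρ a b').indicator χ)
      - (b - b') • prim t₀ t₁ ζ‖ ≤ |b - b'| * ((t₁ - t₀) * c + δ) := by
    intro b b' h1 h2 h3
    have e : prim t₀ t₁ ((band ρ a b).indicator χ) - prim t₀ t₁ ((band ρ a b').indicator χ) =
        prim t₀ t₁ ((band ρ b' b).indicator χ) := by
      rw [← prim_sub ht (ind_int hρ a b hχ) (ind_int hρ a b' hχ)]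
      congr 1
      ext s
      simp only [indicator_apply, band, mem_ofPred_eq]
      split_ifs with q1 q2 q3 q3 q2 q3 q3
      · exact absurd q3.1 (not_le.2 q2.2)
      · simp
      · simp
      · exact absurd ⟨not_lt.1 (fun h => q2 ⟨q1.1, h⟩), q1.2⟩ q3
      · exact absurd ⟨q2.1, q2.2.trans_le h2⟩ q1
      · exact absurd ⟨q2.1, q2.2.trans_le h2⟩ q1
      · exact absurd ⟨h1.trans q3.1, q3.2⟩ q1
      · simp
    rw [e, abs_of_nonneg (sub_nonneg.2 h2)]
    exact needle1 ht hρ h2 (hm _ _ (ha.trans h1) h2 h3) hχ hζ hc (hδ _ _ (ha.trans h1) h2 h3)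
  rcases le_total b' b with h | h
  · exact key b b' hb1' h hb2
  · have := key b' b hb1 h hb2'
    have e : prim t₀ t₁ ((band ρ a b).indicator χ) - prim t₀ t₁ ((band ρ a b').indicator χ)
        - (b - b') • prim t₀ t₁ ζ = -(prim t₀ t₁ ((band ρ a b').indicator χ) -
          prim t₀ t₁ ((band ρ a b).indicator χ) - (b' - b) • prim t₀ t₁ ζ) := by
      rw [← neg_sub b' b, neg_smul]
      abel
    rw [abs_sub_comm, e, norm_neg]
    exact this

end Needle
end SOC

namespace SOC

section Fix
variable {E F : Type*} [NormedAddCommGroup E] [NormedSpace ℝ E] [NormedAddCommGroup F]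
  [NormedSpace ℝ F]

/-- endpoints -/
noncomputable def ends {t₀ t₁ : ℝ} (ht : t₀ ≤ t₁) : C(Icc t₀ t₁, E) →L[ℝ] E × E :=
  (ContinuousMap.evalCLM ℝ (projIcc t₀ t₁ ht t₀)).prod (ContinuousMap.evalCLM ℝ (projIcc t₀ t₁ ht t₁))

theorem ends_apply {t₀ t₁ : ℝ} (ht : t₀ ≤ t₁) (y : C(Icc t₀ t₁, E)) :
    ends ht y = (ev ht y t₀, ev ht y t₁) := rfl

theorem norm_ends_le {t₀ t₁ : ℝ} (ht : t₀ ≤ t₁) (y : C(Icc t₀ t₁, E)) : ‖ends ht y‖ ≤ ‖y‖ := by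
  rw [ends_apply, Prod.norm_mk]
  exact max_le (norm_ev_le ht y _) (norm_ev_le ht y _)

theorem linF_exists {t₀ t₁ : ℝ} (ht : t₀ ≤ t₁) {N : ℕ} {A : ℝ → E →L[ℝ] E} {M : ℝ}
    (hA : AEStronglyMeasurable A (volume.restrict (Icc t₀ t₁)))
    (hM : ∀ᵐ s ∂(volume.restrict (Icc t₀ t₁)), ‖A s‖ ≤ M) (Z : Fin N → C(Icc t₀ t₁, E))
    (Γ : E × E →L[ℝ] F) :
    ∃ L : (C(Icc t₀ t₁, E) × E × (Fin N → ℝ)) →L[ℝ] (C(Icc t₀ t₁, E) × F),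
      ∀ y a α, L (y, a, α) = (y - ContinuousMap.const _ a - prim t₀ t₁ (fun s => A s (ev ht y s))
        - ∑ k, α k • Z k, Γ (ends ht y)) := by
  have hM' : ∀ᵐ s ∂(volume.restrict (Icc t₀ t₁)), ‖A s‖ ≤ |M| := by
    filter_upwards [hM] with s hs using hs.trans (le_abs_self M)
  let p1 := ContinuousLinearMap.fst ℝ C(Icc t₀ t₁, E) (E × (Fin N → ℝ))
  let p2 := (ContinuousLinearMap.fst ℝ E (Fin N → ℝ)).comp
    (ContinuousLinearMap.snd ℝ C(Icc t₀ t₁, E) (E × (Fin N → ℝ)))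
  let p3 := (ContinuousLinearMap.snd ℝ E (Fin N → ℝ)).comp
    (ContinuousLinearMap.snd ℝ C(Icc t₀ t₁, E) (E × (Fin N → ℝ)))
  refine ⟨(p1 - (ContinuousLinearMap.const ℝ (M := E) (Icc t₀ t₁)).comp p2
    - (volt ht (abs_nonneg M) hA hM').comp p1
    - ∑ k, ((ContinuousLinearMap.proj (R := ℝ) (φ := fun _ : Fin N => ℝ) k).comp p3).smulRight (Z k)).prod
    ((Γ.comp (ends ht)).comp p1), ?_⟩
  intro y a α
  simp [p1, p2, p3, volt_apply]
  rfl

theorem fixpt [FiniteDimensional ℝ E] [CompleteSpace F] {t₀ t₁ : ℝ} (ht : t₀ < t₁) {N : ℕ}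
    {A : ℝ → E →L[ℝ] E} {M : ℝ}
    (hA : AEStronglyMeasurable A (volume.restrict (Icc t₀ t₁)))
    (hM : ∀ᵐ s ∂(volume.restrict (Icc t₀ t₁)), ‖A s‖ ≤ M)
    {β : ℝ → E} (hβ : IntegrableOn β (Icc t₀ t₁))
    {ζ : Fin N → ℝ → E} (hζ : ∀ k, AEStronglyMeasurable (ζ k) (volume.restrict (Icc t₀ t₁))) {Cζ : ℝ}
    (hCζ : ∀ k, ∀ᵐ s ∂(volume.restrict (Icc t₀ t₁)), ‖ζ k s‖ ≤ Cζ)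
    (Γ : E × E →L[ℝ] F) (γ : F) (ys : C(Icc t₀ t₁, E)) (as : E) (αs : Fin N → ℝ)
    (hαs : ∀ k, 0 < αs k)
    (hys : ys - ContinuousMap.const _ as - prim t₀ t₁ (fun s => A s (ev ht.le ys s)) - 
      prim t₀ t₁ β - ∑ k, αs k • prim t₀ t₁ (ζ k) = 0)
    (hgs : Γ (ends ht.le ys) + γ = 0)
    (hsurj : ∀ w : F, ∃ (y : C(Icc t₀ t₁, E)) (a : E) (α : Fin N → ℝ),
      y - ContinuousMap.const _ a - prim t₀ t₁ (fun s => A s (ev ht.le y s)) - 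
        ∑ k, α k • prim t₀ t₁ (ζ k) = 0 ∧ Γ (ends ht.le y) = w)
    {τ : ℝ} (hτ : 0 < τ) :
    ∃ c > 0, ∃ B > 0, ∃ e₀ > 0, ∀ e : ℝ, 0 < e → e < e₀ → 
      ∀ (Φ : ℝ → E → E) (ψ : Fin N → ℝ → E → E) (G : E × E → F),
      (∀ y : C(Icc t₀ t₁, E), ‖y‖ ≤ B → IntegrableOn (fun s => Φ s (ev ht.le y s)) (Icc t₀ t₁)) →
      (∀ k, ∀ y : C(Icc t₀ t₁, E), ‖y‖ ≤ B → 
        IntegrableOn (fun s => ψ k s (ev ht.le y s)) (Icc t₀ t₁)) →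
      (∀ᵐ s ∂(volume.restrict (Icc t₀ t₁)), ∀ ξ ξ' : E, ‖ξ‖ ≤ B → ‖ξ'‖ ≤ B →
        ‖Φ s ξ - Φ s ξ' - A s (ξ - ξ')‖ ≤ c * ‖ξ - ξ'‖) →
      (∀ᵐ s ∂(volume.restrict (Icc t₀ t₁)), ‖Φ s 0 - β s‖ ≤ c) →
      (∀ k, ∀ᵐ s ∂(volume.restrict (Icc t₀ t₁)), ∀ ξ ξ' : E, ‖ξ‖ ≤ B → ‖ξ'‖ ≤ B →
        ‖ψ k s ξ - ψ k s ξ'‖ ≤ c * ‖ξ - ξ'‖) →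
      (∀ k, ∀ᵐ s ∂(volume.restrict (Icc t₀ t₁)), ∀ ξ : E, ‖ξ‖ ≤ B → ‖ψ k s ξ - ζ k s‖ ≤ c) →
      (∀ w w' : E × E, ‖w‖ ≤ B → ‖w'‖ ≤ B → ‖G w - G w' - Γ (w - w')‖ ≤ c * ‖w - w'‖) →
      ‖G 0 - γ‖ ≤ c →
      ∃ (y : C(Icc t₀ t₁, E)) (a : E) (α : Fin N → ℝ) (ρ : ℝ → ℝ), Measurable ρ ∧
        (∀ k, 0 ≤ α k ∧ e * α k ≤ 1 / ((N:ℝ) + 1)) ∧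
        y = ContinuousMap.const _ a + prim t₀ t₁ (fun s => Φ s (ev ht.le y s) + 
          ∑ k : Fin N, e⁻¹ • (band ρ (((k:ℕ):ℝ) / (N + 1)) (((k:ℕ):ℝ) / (N + 1) + e * α k)).indicator 
            (fun s => ψ k s (ev ht.le y s)) s) ∧
        G (ends ht.le y) = 0 ∧ ‖y - ys‖ ≤ τ ∧ ‖y‖ ≤ B := by
  have hEc : CompleteSpace E := FiniteDimensional.complete ℝ E
  obtain ⟨T, hT, hT0⟩ : ∃ T : ℝ, T = t₁ - t₀ ∧ 0 < T := ⟨_, rfl, sub_pos.2 ht⟩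
  have hζI : ∀ k, IntegrableOn (ζ k) (Icc t₀ t₁) := fun k => integrableOn_of_bdd (hζ k) (hCζ k)
  obtain ⟨L, hL⟩ := linF_exists ht.le hA hM (fun k => prim t₀ t₁ (ζ k)) Γ
  have hLs : L.toLinearMap.range = ⊤ := by
    rw [LinearMap.range_eq_top]
    rintro ⟨b, w⟩
    obtain ⟨y1, hy1, -⟩ := volt_solve ht.le hA hM b
    obtain ⟨y2, a, α, hy2, hw⟩ := hsurj (w - Γ (ends ht.le y1))
    have e1 : L (y1, 0, 0) = (b, Γ (ends ht.le y1)) := by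
      rw [hL]
      rw [← hy1]
      have : ContinuousMap.const (Icc t₀ t₁) (0:E) = 0 := rfl
      rw [this]
      simp
    have e2 : L (y2, a, α) = (0, w - Γ (ends ht.le y1)) := by rw [hL, hy2, hw]
    refine ⟨(y1, 0, 0) + (y2, a, α), ?_⟩
    rw [map_add]
    change L _ + L _ = _
    rw [e1, e2]
    simp
  obtain ⟨S, hS⟩ := L.exists_nonlinearRightInverse_of_surjective hLs
  -- radius
  obtain ⟨zs, hzs⟩ : ∃ zs : C(Icc t₀ t₁, E) × E × (Fin N → ℝ), zs = (ys, as, αs) := ⟨_, rfl⟩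
  obtain ⟨r, hr0, hrτ, hr1, hrα⟩ : ∃ r : ℝ, 0 < r ∧ r ≤ τ ∧ r ≤ 1 ∧ ∀ k, r ≤ αs k := by
    have h1 : ∀ᶠ r : ℝ in 𝓝[>] 0, ∀ k, r ≤ αs k := by
      rw [eventually_all]
      intro k
      exact nhdsWithin_le_nhds ((eventually_lt_nhds (hαs k)).mono (fun r hr => hr.le))
    have h2 : ∀ᶠ r : ℝ in 𝓝[>] 0, r ≤ min τ 1 :=
      nhdsWithin_le_nhds ((eventually_lt_nhds (lt_min hτ one_pos)).mono (fun r hr => hr.le))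
    obtain ⟨r, ⟨h1, h2⟩, h3⟩ := ((h1.and h2).and self_mem_nhdsWithin).exists
    exact ⟨r, h3, h2.trans (min_le_left _ _), h2.trans (min_le_right _ _), h1⟩
  obtain ⟨B, hB, hB0⟩ : ∃ B : ℝ, B = ‖zs‖ + 1 ∧ 0 < B := ⟨_, rfl, by positivity⟩
  obtain ⟨K0, hK0, hK0p⟩ : ∃ K : ℝ, K = T + N * (B * T + T + 1) + 1 ∧ 0 < K := ⟨_, rfl, by positivity⟩
  obtain ⟨K1, hK1, hK1p⟩ : ∃ K : ℝ, K = (B + 1) * T + N * (B * (T + 1)) + (B + 1) ∧ 0 < K := 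
    ⟨_, rfl, by positivity⟩
  have hν : 0 < (S.nnnorm : ℝ)⁻¹ := by
    have : 0 < (S.nnnorm : ℝ) := hS
    positivity
  obtain ⟨ν, hνdef⟩ : ∃ ν : ℝ, ν = (S.nnnorm : ℝ)⁻¹ := ⟨_, rfl⟩
  rw [← hνdef] at hν
  obtain ⟨c, hc0, hc1, hc2⟩ : ∃ c : ℝ, 0 < c ∧ K0 * c ≤ ν / 2 ∧ K1 * c ≤ ν / 2 * r := by
    refine ⟨min (ν / 2 / K0) (ν / 2 * r / K1), by positivity, ?_, ?_⟩
    · rw [mul_comm, ← le_div_iff₀ hK0p]; exact min_le_left _ _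
    · rw [mul_comm, ← le_div_iff₀ hK1p]; exact min_le_right _ _
  refine ⟨c, hc0, B, hB0, 1 / (N + 1) / B, by positivity, ?_⟩
  intro e he he1 Φ ψ G hΦi hψi hΦ hΦ0 hψ hψ0 hG hG0
  obtain ⟨ρ, hρ, hρ1, hρ2⟩ := rank_fin ht hζ hCζ hc0
  have heB : e * B ≤ 1 / ((N:ℝ) + 1) := by
    rw [lt_div_iff₀ hB0] at he1; exact he1.le
  -- the nonlinear map
  obtain ⟨J, hJ⟩ : ∃ J : Fin N → ℝ → C(Icc t₀ t₁, E) → C(Icc t₀ t₁, E), ∀ k α y, J k α y = 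
    prim t₀ t₁ ((band ρ (((k:ℕ):ℝ) / (N + 1)) (((k:ℕ):ℝ) / (N + 1) + e * α)).indicator 
            (fun s => ψ k s (ev ht.le y s))) := ⟨_, fun _ _ _ => rfl⟩
  obtain ⟨P, hP⟩ : ∃ P : C(Icc t₀ t₁, E) → C(Icc t₀ t₁, E), ∀ y, P y = 
    prim t₀ t₁ (fun s => Φ s (ev ht.le y s)) := ⟨_, fun _ => rfl⟩
  obtain ⟨V, hV⟩ : ∃ V : C(Icc t₀ t₁, E) → C(Icc t₀ t₁, E), ∀ y, V y = 
    prim t₀ t₁ (fun s => A s (ev ht.le y s)) := ⟨_, fun _ => rfl⟩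
  obtain ⟨FF, hFF⟩ : ∃ FF : C(Icc t₀ t₁, E) × E × (Fin N → ℝ) → C(Icc t₀ t₁, E) × F, 
    ∀ z, FF z = (z.1 - ContinuousMap.const _ z.2.1 - P z.1 - ∑ k, e⁻¹ • J k (z.2.2 k) z.1,
      G (ends ht.le z.1)) := ⟨_, fun _ => rfl⟩
  have hball : ∀ z ∈ Metric.closedBall zs r, ‖z.1‖ ≤ B ∧ (∀ k, 0 ≤ z.2.2 k ∧ z.2.2 k ≤ B) ∧
      ‖z.1 - ys‖ ≤ r := by
    intro z hz
    rw [Metric.mem_closedBall, dist_eq_norm] at hz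
    have hzB : ‖z‖ ≤ B := by
      have : ‖z‖ ≤ ‖zs‖ + ‖z - zs‖ := by
        calc ‖z‖ = ‖zs + (z - zs)‖ := by congr 1; abel
          _ ≤ _ := norm_add_le _ _
      linarith
    have h3 : ‖z.2.2‖ ≤ B := (norm_snd_le z.2).trans ((norm_snd_le z).trans hzB)
    have h4 : ‖z.2.2 - αs‖ ≤ r := by
      have : (z - zs).2.2 = z.2.2 - αs := by rw [hzs]; rfl
      rw [← this]
      exact (norm_snd_le (z - zs).2).trans ((norm_snd_le (z - zs)).trans hz)
    refine ⟨(norm_fst_le z).trans hzB, ?_, ?_⟩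
    · intro k
      refine ⟨?_, (Real.le_norm_self _).trans ((norm_le_pi_norm _ k).trans h3)⟩
      have := (norm_le_pi_norm (z.2.2 - αs) k).trans h4
      rw [Pi.sub_apply, Real.norm_eq_abs, abs_le] at this
      have := hrα k
      linarith
    · have : (z - zs).1 = z.1 - ys := by rw [hzs]; rfl
      rw [← this]
      exact (norm_fst_le (z - zs)).trans hz
  have hkN : ∀ (k : Fin N) (α : ℝ), 0 ≤ α → α ≤ B → 0 ≤ ((k:ℕ):ℝ) / (N + 1) ∧
      ((k:ℕ):ℝ) / (N + 1) ≤ ((k:ℕ):ℝ) / (N + 1) + e * α ∧ ((k:ℕ):ℝ) / (N + 1) + e * α ≤ 1 := by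
    intro k α h1 h2
    refine ⟨by positivity, by have := mul_nonneg he.le h1; linarith, ?_⟩
    have h3 : e * α ≤ 1 / ((N:ℝ) + 1) := le_trans (by gcongr) heB
    have h4 : ((k:ℕ):ℝ) / (N + 1) + 1 / (N + 1) ≤ 1 := by
      rw [← add_div, div_le_one (by positivity)]
      have : ((k:ℕ):ℝ) ≤ N := by exact_mod_cast k.2.le
      linarith
    linarith
  have hVi : ∀ y : C(Icc t₀ t₁, E), IntegrableOn (fun s => A s (ev ht.le y s)) (Icc t₀ t₁) := fun y =>
    volt_integrable ht.le hA hM (ev_continuous ht.le y).continuousOn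
  have hVsub : ∀ y y', V (y - y') = V y - V y' := by
    intro y y'
    rw [hV, hV, hV, ← prim_sub ht.le (hVi y) (hVi y')]
    congr 1
    ext s
    rw [← map_sub]
    rfl
  have est1 : ∀ y y' : C(Icc t₀ t₁, E), ‖y‖ ≤ B → ‖y'‖ ≤ B → 
      ‖P y - P y' - V (y - y')‖ ≤ c * T * ‖y - y'‖ := by
    intro y y' hy hy'
    rw [hP, hP, hV, ← prim_sub ht.le (hΦi y hy) (hΦi y' hy'),
      ← prim_sub (g₁ := fun s => Φ s (ev ht.le y s) - Φ s (ev ht.le y' s)) ht.le 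
        ((hΦi y hy).sub (hΦi y' hy')) (hVi _)]
    refine (norm_prim_le (C := c * ‖y - y'‖) ht.le (by positivity) ?_ ?_).trans 
      (le_of_eq (by rw [hT]; ring))
    · exact ((hΦi y hy).sub (hΦi y' hy')).sub (hVi _)
    · filter_upwards [hΦ] with s hs
      refine (hs _ _ ((norm_ev_le _ _ _).trans hy) ((norm_ev_le _ _ _).trans hy')).trans ?_
      gcongr
      exact norm_ev_le ht.le (y - y') s
  have est2 : ∀ (k : Fin N) (α α' : ℝ) (y : C(Icc t₀ t₁, E)), 0 ≤ α → α ≤ B → 0 ≤ α' → α' ≤ B →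
      ‖y‖ ≤ B → ‖e⁻¹ • (J k α y - J k α' y) - (α - α') • prim t₀ t₁ (ζ k)‖ ≤ 
        |α - α'| * (T * c + c) := by
    intro k α α' y h1 h2 h1' h2' hy
    obtain ⟨q1, q2, q3⟩ := hkN k α h1 h2
    obtain ⟨-, q2', q3'⟩ := hkN k α' h1' h2'
    have h3 := needle2 ht.le hρ hρ1 (hψi k y hy) (hζI k) (c := c) (δ := c) (by
        filter_upwards [hψ0 k] with s hs using hs _ ((norm_ev_le _ _ _).trans hy))
      (hρ2 k) q1 q2 q3 q2' q3'
    rw [← hJ, ← hJ, ← hT] at h3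
    have e1 : ((k:ℕ):ℝ) / (N + 1) + e * α - (((k:ℕ):ℝ) / (N + 1) + e * α') = e * (α - α') := by ring
    rw [e1, abs_mul, abs_of_pos he] at h3
    have e2 : e⁻¹ • (J k α y - J k α' y) - (α - α') • prim t₀ t₁ (ζ k) = 
        e⁻¹ • (J k α y - J k α' y - (e * (α - α')) • prim t₀ t₁ (ζ k)) := by
      rw [smul_sub e⁻¹ (J k α y - J k α' y), smul_smul, ← mul_assoc, inv_mul_cancel₀ he.ne', one_mul]
    rw [e2, norm_smul, Real.norm_of_nonneg (by positivity)]
    calc _ ≤ e⁻¹ * (e * |α - α'| * (T * c + c)) := by gcongr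
      _ = _ := by field_simp
  have est3 : ∀ (k : Fin N) (α : ℝ) (y y' : C(Icc t₀ t₁, E)), 0 ≤ α → α ≤ B → ‖y‖ ≤ B → ‖y'‖ ≤ B → 
      ‖e⁻¹ • (J k α y - J k α y')‖ ≤ B * T * c * ‖y - y'‖ := by
    intro k α y y' h1 h2 hy hy'
    obtain ⟨q1, q2, q3⟩ := hkN k α h1 h2
    have e0 : J k α y - J k α y' = prim t₀ t₁ ((band ρ (((k:ℕ):ℝ) / (N + 1)) (((k:ℕ):ℝ) / (N + 1) + e * α)).indicator 
            (fun s => ψ k s (ev ht.le y s) - ψ k s (ev ht.le y' s))) := by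
      rw [hJ, hJ, ← prim_sub ht.le (ind_int hρ _ _ (hψi k y hy)) (ind_int hρ _ _ (hψi k y' hy'))]
      refine congrArg (prim t₀ t₁) (funext fun s => ?_)
      by_cases hs : s ∈ band ρ (((k:ℕ):ℝ) / (N + 1)) (((k:ℕ):ℝ) / (N + 1) + e * α) <;> simp [hs]
    have h3 := needle0 ht.le hρ q2 (hρ1 _ _ q1 q2 q3) 
      (χ := fun s => ψ k s (ev ht.le y s) - ψ k s (ev ht.le y' s))
      ((hψi k y hy).sub (hψi k y' hy')) (c := c * ‖y - y'‖) (by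
        filter_upwards [hψ k] with s hs
        refine (hs _ _ ((norm_ev_le _ _ _).trans hy) ((norm_ev_le _ _ _).trans hy')).trans ?_
        gcongr
        exact norm_ev_le ht.le (y - y') s)
    rw [← e0, ← hT] at h3
    rw [norm_smul, Real.norm_of_nonneg (by positivity)]
    calc _ ≤ e⁻¹ * ((((k:ℕ):ℝ) / (N + 1) + e * α - ((k:ℕ):ℝ) / (N + 1)) * (T * (c * ‖y - y'‖))) := by gcongr
      _ = α * T * c * ‖y - y'‖ := by field_simp; ring
      _ ≤ _ := by gcongr
  have happ : ApproximatesLinearOn FF L (Metric.closedBall zs r) (Real.toNNReal (K0 * c)) := by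
    intro z hz z' hz'
    obtain ⟨hz1, hz2, -⟩ := hball z hz
    obtain ⟨hz1', hz2', -⟩ := hball z' hz'
    obtain ⟨d, hd⟩ : ∃ d, d = ‖z - z'‖ := ⟨_, rfl⟩
    have hd0 : 0 ≤ d := hd ▸ norm_nonneg _
    have hdy : ‖z.1 - z'.1‖ ≤ d := hd ▸ norm_fst_le (z - z')
    have hdα : ∀ k, |z.2.2 k - z'.2.2 k| ≤ d := fun k => hd ▸
      (norm_le_pi_norm (z - z').2.2 k).trans ((norm_snd_le (z - z').2).trans (norm_snd_le (z - z')))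
    rw [Real.coe_toNNReal _ (by positivity), ← hd, hFF, hFF]
    have hLz : L (z - z') = _ := hL (z.1 - z'.1) (z.2.1 - z'.2.1) (z.2.2 - z'.2.2)
    rw [hLz, ← hV, hVsub]
    rw [Prod.mk_sub_mk, Prod.mk_sub_mk, Prod.norm_mk]
    have hc_sub : ContinuousMap.const (Icc t₀ t₁) (z.2.1 - z'.2.1) = 
      ContinuousMap.const (Icc t₀ t₁) z.2.1 - ContinuousMap.const (Icc t₀ t₁) z'.2.1 := rfl
    refine max_le ?_ ?_
    · have e1 : z.1 - ContinuousMap.const (Icc t₀ t₁) z.2.1 - P z.1 - ∑ k, e⁻¹ • J k (z.2.2 k) z.1 -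
          (z'.1 - ContinuousMap.const (Icc t₀ t₁) z'.2.1 - P z'.1 - ∑ k, e⁻¹ • J k (z'.2.2 k) z'.1) -
          (z.1 - z'.1 - ContinuousMap.const (Icc t₀ t₁) (z.2.1 - z'.2.1) - (V z.1 - V z'.1) - 
            ∑ k, (z.2.2 - z'.2.2) k • prim t₀ t₁ (ζ k)) = 
          -(P z.1 - P z'.1 - V (z.1 - z'.1)) - ∑ k, (e⁻¹ • (J k (z.2.2 k) z.1 - J k (z.2.2 k) z'.1) +
            (e⁻¹ • (J k (z.2.2 k) z'.1 - J k (z'.2.2 k) z'.1) - 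
              (z.2.2 k - z'.2.2 k) • prim t₀ t₁ (ζ k))) := by
        rw [hVsub, hc_sub]
        simp only [smul_sub, Finset.sum_add_distrib, Finset.sum_sub_distrib, Pi.sub_apply]
        abel
      rw [e1]
      refine (norm_sub_le _ _).trans ?_
      rw [norm_neg]
      have s1 : ‖P z.1 - P z'.1 - V (z.1 - z'.1)‖ ≤ c * T * d :=
        (est1 _ _ hz1 hz1').trans (by gcongr)
      have s2 : ∀ k, ‖e⁻¹ • (J k (z.2.2 k) z.1 - J k (z.2.2 k) z'.1) +
            (e⁻¹ • (J k (z.2.2 k) z'.1 - J k (z'.2.2 k) z'.1) - 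
              (z.2.2 k - z'.2.2 k) • prim t₀ t₁ (ζ k))‖ ≤ B * T * c * d + d * (T * c + c) := by
        intro k
        refine (norm_add_le _ _).trans (add_le_add ?_ ?_)
        · exact (est3 k _ _ _ (hz2 k).1 (hz2 k).2 hz1 hz1').trans (by gcongr)
        · exact (est2 k _ _ _ (hz2 k).1 (hz2 k).2 (hz2' k).1 (hz2' k).2 hz1').trans 
            (by gcongr; exact hdα k)
      have s3 := (norm_sum_le Finset.univ _).trans (Finset.sum_le_sum (fun k _ => s2 k))
      rw [Finset.sum_const, Finset.card_univ, Fintype.card_fin, nsmul_eq_mul] at s3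
      refine (add_le_add s1 s3).trans ?_
      rw [hK0]
      have : 0 ≤ c * d := by positivity
      linarith
    · have h1 := hG (ends ht.le z.1) (ends ht.le z'.1) ((norm_ends_le _ _).trans hz1) 
        ((norm_ends_le _ _).trans hz1')
      rw [map_sub (ends ht.le)]
      refine h1.trans ?_
      rw [← map_sub (ends ht.le)]
      have h2 : ‖ends ht.le (z.1 - z'.1)‖ ≤ d := (norm_ends_le _ _).trans hdy
      calc _ ≤ c * d := by gcongr
        _ = 1 * (c * d) := by ring
        _ ≤ K0 * (c * d) := by
          gcongr
          rw [hK0]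
          have : 0 ≤ T + N * (B * T + T + 1) := by positivity
          linarith
        _ = _ := by ring
  have hBys : ‖ys‖ ≤ B := (hball zs (Metric.mem_closedBall_self hr0.le)).1.trans' (by rw [hzs])
  have hBα : ∀ k, αs k ≤ B := fun k => by
    have := ((hball zs (Metric.mem_closedBall_self hr0.le)).2.1 k).2
    rwa [hzs] at this
  have hFz : ‖FF zs‖ ≤ K1 * c := by
    rw [hFF, Prod.norm_mk]
    have hK1a : (B + 1) * T * c + N * (B * (T * c + c)) ≤ K1 * c := by
      rw [hK1]
      have : 0 ≤ (B + 1) * c := by positivity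
      linarith
    have hK1b : (B + 1) * c ≤ K1 * c := by
      rw [hK1]
      have : 0 ≤ ((B + 1) * T + N * (B * (T + 1))) * c := by positivity
      linarith
    refine max_le ?_ ?_
    · refine le_trans ?_ hK1a
      have hJ0 : ∀ k, J k 0 ys = 0 := by
        intro k
        rw [hJ]
        have : band ρ (((k:ℕ):ℝ) / (N + 1)) (((k:ℕ):ℝ) / (N + 1) + e * 0) = ∅ := by
          ext s
          simp [band]
        rw [this, indicator_empty]
        ext1 t
        rw [prim_apply ht.le integrableOn_zero]
        simp
      have hV0 : V 0 = 0 := by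
        have := hVsub 0 0
        simpa using this
      have e1 : zs.1 - ContinuousMap.const (Icc t₀ t₁) zs.2.1 - P zs.1 - ∑ k, e⁻¹ • J k (zs.2.2 k) zs.1 =
          -(P ys - P 0 - V (ys - 0)) - (P 0 - prim t₀ t₁ β) - 
            ∑ k, (e⁻¹ • (J k (αs k) ys - J k 0 ys) - (αs k - 0) • prim t₀ t₁ (ζ k)) := by
        rw [hzs]
        simp only [hJ0, sub_zero, Finset.sum_sub_distrib]
        rw [← hV] at hys
        have h3 : ys - ContinuousMap.const (Icc t₀ t₁) as = V ys + prim t₀ t₁ β + 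
            ∑ k, αs k • prim t₀ t₁ (ζ k) := by
          rw [← sub_eq_zero, ← hys]; abel
        rw [h3]
        abel
      rw [e1]
      have s1 : ‖P ys - P 0 - V (ys - 0)‖ ≤ c * T * B := by
        refine (est1 ys 0 hBys (by simpa using hB0.le)).trans ?_
        rw [sub_zero]
        gcongr
      have s2 : ‖P 0 - prim t₀ t₁ β‖ ≤ c * T := by
        have h0 := hΦi 0 (by simpa using hB0.le)
        rw [hP, ← prim_sub ht.le h0 hβ, hT]
        refine norm_prim_le ht.le hc0.le (h0.sub hβ) ?_
        filter_upwards [hΦ0] with s hs using hs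
      have s3 : ∀ k, ‖e⁻¹ • (J k (αs k) ys - J k 0 ys) - (αs k - 0) • prim t₀ t₁ (ζ k)‖ ≤ 
          B * (T * c + c) := by
        intro k
        refine (est2 k _ _ _ (hαs k).le (hBα k) le_rfl hB0.le hBys).trans ?_
        rw [sub_zero, abs_of_pos (hαs k)]
        gcongr
        exact hBα k
      have s4 := (norm_sum_le Finset.univ _).trans (Finset.sum_le_sum (fun k _ => s3 k))
      rw [Finset.sum_const, Finset.card_univ, Fintype.card_fin, nsmul_eq_mul] at s4
      refine (norm_sub_le _ _).trans ?_
      have s5 := norm_sub_le (-(P ys - P 0 - V (ys - 0))) (P 0 - prim t₀ t₁ β)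
      rw [norm_neg] at s5
      linarith
    · refine le_trans ?_ hK1b
      have h1 := hG (ends ht.le ys) 0 ((norm_ends_le _ _).trans hBys) (by simpa using hB0.le)
      rw [sub_zero] at h1
      have e1 : G (ends ht.le zs.1) = (G (ends ht.le ys) - G 0 - Γ (ends ht.le ys)) + (G 0 - γ) := by
        rw [eq_neg_of_add_eq_zero_left hgs, hzs]
        abel
      rw [e1]
      have h2 : ‖ends ht.le ys‖ ≤ B := (norm_ends_le _ _).trans hBys
      have h3 : c * ‖ends ht.le ys‖ ≤ c * B := by gcongr
      refine (norm_add_le _ _).trans ?_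
      linarith
  have hsurjOn := happ.surjOn_closedBall_of_nonlinearRightInverse S hr0.le (le_refl _)
  have h0mem : (0 : C(Icc t₀ t₁, E) × F) ∈ Metric.closedBall (FF zs) 
      (((S.nnnorm : ℝ)⁻¹ - (Real.toNNReal (K0 * c) : ℝ)) * r) := by
    rw [Metric.mem_closedBall, dist_comm, dist_zero_right, ← hνdef, Real.coe_toNNReal _ (by positivity)]
    refine hFz.trans (hc2.trans ?_)
    gcongr
    linarith
  obtain ⟨z, hz, hz0⟩ := hsurjOn h0mem
  obtain ⟨hz1, hz2, hz3⟩ := hball z hz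
  rw [hFF, Prod.mk_eq_zero] at hz0
  refine ⟨z.1, z.2.1, z.2.2, ρ, hρ, ?_, ?_, hz0.2, hz3.trans hrτ, hz1⟩
  · intro k
    refine ⟨(hz2 k).1, le_trans ?_ heB⟩
    gcongr
    exact (hz2 k).2
  · have hi : ∀ k : Fin N, IntegrableOn (fun s => e⁻¹ • (band ρ (((k:ℕ):ℝ) / (N + 1)) 
        (((k:ℕ):ℝ) / (N + 1) + e * z.2.2 k)).indicator (fun s => ψ k s (ev ht.le z.1 s)) s) (Icc t₀ t₁) :=
      fun k => (ind_int hρ _ _ (hψi k _ hz1)).smul _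
    rw [prim_add ht.le (hΦi _ hz1) (integrable_finsetSum _ (fun k _ => hi k)),
      prim_sum ht.le Finset.univ hi, ← hP]
    have h3 : ∀ k : Fin N, prim t₀ t₁ (fun s => e⁻¹ • (band ρ (((k:ℕ):ℝ) / (N + 1)) 
        (((k:ℕ):ℝ) / (N + 1) + e * z.2.2 k)).indicator (fun s => ψ k s (ev ht.le z.1 s)) s) = 
          e⁻¹ • J k (z.2.2 k) z.1 := by
      intro k
      rw [hJ, prim_smul ht.le e⁻¹ (ind_int hρ _ _ (hψi k _ hz1))]
    rw [Finset.sum_congr rfl (fun k _ => h3 k)]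
    have h4 := hz0.1
    rw [← sub_eq_zero, ← h4]
    abel

end Fix
end SOC

namespace SOC

section Taylor
variable {X Y Z : Type*} [NormedAddCommGroup X] [NormedAddCommGroup Y] [NormedSpace ℝ Y]
  [NormedAddCommGroup Z] [NormedSpace ℝ Z]

theorem unif {O Q : Set X} (hO : IsOpen O) (hQ : IsCompact Q) (hQO : Q ⊆ O) {Ψ : X → Y}
    (hΨ : ContinuousOn Ψ O) {ω : ℝ} (hω : 0 < ω) :
    ∃ δ > 0, ∀ q ∈ Q, ∀ p, ‖p - q‖ < δ → p ∈ O ∧ ‖Ψ p - Ψ q‖ ≤ ω := by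
  have h1 := hQ.uniformContinuousAt_of_continuousAt Ψ
    (fun a ha => hΨ.continuousAt (hO.mem_nhds (hQO ha))) (Metric.dist_mem_uniformity hω)
  obtain ⟨δ1, hδ1, h2⟩ := Metric.mem_uniformity_dist.1 h1
  obtain ⟨δ2, hδ2, h3⟩ := hQ.exists_thickening_subset_open hO hQO
  refine ⟨min δ1 δ2, lt_min hδ1 hδ2, fun q hq p hp => ⟨h3 ?_, ?_⟩⟩
  · rw [Metric.mem_thickening_iff]
    exact ⟨q, hq, by rw [dist_eq_norm]; exact hp.trans_le (min_le_right _ _)⟩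
  · have := h2 (a := q) (b := p) (by
      rw [dist_comm, dist_eq_norm]; exact hp.trans_le (min_le_left _ _)) hq
    have h4 : dist (Ψ q) (Ψ p) < ω := this
    rw [dist_comm, dist_eq_norm] at h4
    exact h4.le

theorem tay1 {F : Z → Y} {w₀ : Z} {δ ω : ℝ} (hd : ∀ w, ‖w - w₀‖ < δ → DifferentiableAt ℝ F w)
    (hb : ∀ w, ‖w - w₀‖ < δ → ‖fderiv ℝ F w - fderiv ℝ F w₀‖ ≤ ω) {w₁ w₂ : Z}
    (h1 : ‖w₁ - w₀‖ < δ) (h2 : ‖w₂ - w₀‖ < δ) :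
    ‖F w₁ - F w₂ - fderiv ℝ F w₀ (w₁ - w₂)‖ ≤ ω * ‖w₁ - w₂‖ := by
  refine (convex_ball w₀ δ).norm_image_sub_le_of_norm_fderiv_le' (𝕜 := ℝ) (fun x hx => hd x ?_)
    (fun x hx => hb x ?_) ?_ ?_
  all_goals first
    | simpa [← dist_eq_norm] using hx
    | simpa [← dist_eq_norm] using h1
    | simpa [← dist_eq_norm] using h2

theorem tay2 {F : Z → Y} {w₀ : Z} {δ ω : ℝ} (hω : 0 ≤ ω)
    (hd : ∀ w, ‖w - w₀‖ < δ → DifferentiableAt ℝ F w)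
    (hd' : ∀ w, ‖w - w₀‖ < δ → DifferentiableAt ℝ (fderiv ℝ F) w)
    (hb : ∀ w, ‖w - w₀‖ < δ → ‖fderiv ℝ (fderiv ℝ F) w - fderiv ℝ (fderiv ℝ F) w₀‖ ≤ ω) {d : Z}
    (h1 : ‖d‖ < δ) :
    ‖F (w₀ + d) - F w₀ - fderiv ℝ F w₀ d - (1/2:ℝ) • fderiv ℝ (fderiv ℝ F) w₀ d d‖ ≤ ω * ‖d‖ ^ 2 := by
  have hseg : ∀ θ ∈ Icc (0:ℝ) 1, ‖(w₀ + θ • d) - w₀‖ < δ := by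
    intro θ hθ
    rw [add_sub_cancel_left, norm_smul, Real.norm_of_nonneg hθ.1]
    exact (mul_le_of_le_one_left (norm_nonneg _) hθ.2).trans_lt h1
  have h0 : ‖w₀ - w₀‖ < δ := by simpa using (norm_nonneg _).trans_lt h1
  have hder : ∀ θ ∈ Icc (0:ℝ) 1, HasDerivWithinAt (fun θ : ℝ => F (w₀ + θ • d) - F w₀ - 
      θ • fderiv ℝ F w₀ d - (θ ^ 2 / 2) • fderiv ℝ (fderiv ℝ F) w₀ d d)
      (fderiv ℝ F (w₀ + θ • d) d - fderiv ℝ F w₀ d - θ • fderiv ℝ (fderiv ℝ F) w₀ d d) 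
      (Icc 0 1) θ := by
    intro θ hθ
    have a1 : HasDerivAt (fun θ : ℝ => w₀ + θ • d) d θ := by
      simpa using ((hasDerivAt_id θ).smul_const d).const_add w₀
    have a2 := (hd _ (hseg θ hθ)).hasFDerivAt.comp_hasDerivAt θ a1
    have a3 : HasDerivAt (fun θ : ℝ => θ • fderiv ℝ F w₀ d) (fderiv ℝ F w₀ d) θ := by
      simpa using (hasDerivAt_id θ).smul_const (fderiv ℝ F w₀ d)
    have a4 : HasDerivAt (fun θ : ℝ => (θ ^ 2 / 2) • fderiv ℝ (fderiv ℝ F) w₀ d d) 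
        (θ • fderiv ℝ (fderiv ℝ F) w₀ d d) θ := by
      have : HasDerivAt (fun θ : ℝ => θ ^ 2 / 2) θ θ := by
        have := (hasDerivAt_pow 2 θ).div_const 2
        simpa using this
      exact this.smul_const _
    exact (((a2.sub_const (F w₀)).sub a3).sub a4).hasDerivWithinAt
  have hbd : ∀ θ ∈ Ico (0:ℝ) 1, ‖fderiv ℝ F (w₀ + θ • d) d - fderiv ℝ F w₀ d - 
      θ • fderiv ℝ (fderiv ℝ F) w₀ d d‖ ≤ ω * ‖d‖ ^ 2 := by
    intro θ hθ
    have h2 := tay1 hd' hb (hseg θ ⟨hθ.1, hθ.2.le⟩) h0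
    rw [add_sub_cancel_left] at h2
    have e1 : fderiv ℝ F (w₀ + θ • d) d - fderiv ℝ F w₀ d - θ • fderiv ℝ (fderiv ℝ F) w₀ d d = 
      (fderiv ℝ F (w₀ + θ • d) - fderiv ℝ F w₀ - fderiv ℝ (fderiv ℝ F) w₀ (θ • d)) d := by
      simp
    rw [e1]
    refine (ContinuousLinearMap.le_opNorm _ _).trans ?_
    have h3 : ‖θ • d‖ ≤ ‖d‖ := by
      rw [norm_smul, Real.norm_of_nonneg hθ.1]
      exact mul_le_of_le_one_left (norm_nonneg _) hθ.2.le
    calc _ ≤ (ω * ‖d‖) * ‖d‖ := by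
          gcongr
          exact h2.trans (by gcongr)
      _ = _ := by ring
  have := norm_image_sub_le_of_norm_deriv_le_segment_01' hder hbd
  simpa using this

/-- Combined second-order expansion at scale `ε`. -/
theorem tay {F : Z → Y} {w₀ : Z} {δ ω : ℝ} (hω : 0 ≤ ω)
    (hd : ∀ w, ‖w - w₀‖ < δ → DifferentiableAt ℝ F w)
    (hd' : ∀ w, ‖w - w₀‖ < δ → DifferentiableAt ℝ (fderiv ℝ F) w)
    (hb1 : ∀ w, ‖w - w₀‖ < δ → ‖fderiv ℝ F w - fderiv ℝ F w₀‖ ≤ ω)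
    (hb : ∀ w, ‖w - w₀‖ < δ → ‖fderiv ℝ (fderiv ℝ F) w - fderiv ℝ (fderiv ℝ F) w₀‖ ≤ ω)
    {q : Z} {ε B : ℝ} (hε : 0 < ε) (hB : 0 ≤ B) (hεδ : ε * ‖q‖ + ε ^ 2 * B < δ)
    {Φ : Z → Y} (hΦ : ∀ ξ, Φ ξ = (ε ^ 2)⁻¹ • (F (w₀ + ε • q + ε ^ 2 • ξ) - F w₀ - ε • fderiv ℝ F w₀ q)) :
    (∀ ξ ξ', ‖ξ‖ ≤ B → ‖ξ'‖ ≤ B → ‖Φ ξ - Φ ξ' - fderiv ℝ F w₀ (ξ - ξ')‖ ≤ ω * ‖ξ - ξ'‖) ∧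
    ‖Φ 0 - (1/2:ℝ) • fderiv ℝ (fderiv ℝ F) w₀ q q‖ ≤ ω * ‖q‖ ^ 2 := by
  have hε2 : (0:ℝ) < ε ^ 2 := by positivity
  have hin : ∀ ξ, ‖ξ‖ ≤ B → ‖w₀ + ε • q + ε ^ 2 • ξ - w₀‖ < δ := by
    intro ξ hξ
    have : w₀ + ε • q + ε ^ 2 • ξ - w₀ = ε • q + ε ^ 2 • ξ := by abel
    rw [this]
    refine (norm_add_le _ _).trans_lt (lt_of_le_of_lt ?_ hεδ)
    rw [norm_smul, norm_smul, Real.norm_of_nonneg hε.le, Real.norm_of_nonneg hε2.le]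
    gcongr
  constructor
  · intro ξ ξ' hξ hξ'
    have h1 := tay1 hd hb1 (hin ξ hξ) (hin ξ' hξ')
    have e1 : w₀ + ε • q + ε ^ 2 • ξ - (w₀ + ε • q + ε ^ 2 • ξ') = ε ^ 2 • (ξ - ξ') := by
      rw [smul_sub]; abel
    rw [e1, map_smul, norm_smul, Real.norm_of_nonneg hε2.le] at h1
    have e2 : Φ ξ - Φ ξ' - fderiv ℝ F w₀ (ξ - ξ') = (ε ^ 2)⁻¹ • (F (w₀ + ε • q + ε ^ 2 • ξ) - 
        F (w₀ + ε • q + ε ^ 2 • ξ') - ε ^ 2 • fderiv ℝ F w₀ (ξ - ξ')) := by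
      rw [hΦ, hΦ, ← smul_sub, smul_sub (ε ^ 2)⁻¹ _ (ε ^ 2 • _), smul_smul, inv_mul_cancel₀ hε2.ne', one_smul]
      congr 2
      abel
    rw [e2, norm_smul, Real.norm_of_nonneg (by positivity)]
    calc _ ≤ (ε ^ 2)⁻¹ * (ω * (ε ^ 2 * ‖ξ - ξ'‖)) := by gcongr
      _ = _ := by field_simp
  · have h1 := tay2 (d := ε • q) hω hd hd' hb (by
      rw [norm_smul, Real.norm_of_nonneg hε.le]
      nlinarith [mul_nonneg hε2.le hB])
    have e2 : Φ 0 - (1/2:ℝ) • fderiv ℝ (fderiv ℝ F) w₀ q q = (ε ^ 2)⁻¹ • (F (w₀ + ε • q) - F w₀ - 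
        fderiv ℝ F w₀ (ε • q) - (1/2:ℝ) • fderiv ℝ (fderiv ℝ F) w₀ (ε • q) (ε • q)) := by
      rw [hΦ]
      simp only [smul_zero, add_zero, map_smul, _root_.smul_apply, smul_sub, smul_smul]
      congr 2
      field_simp
    rw [e2, norm_smul, Real.norm_of_nonneg (by positivity)]
    rw [norm_smul, Real.norm_of_nonneg hε.le] at h1
    calc _ ≤ (ε ^ 2)⁻¹ * (ω * (ε * ‖q‖) ^ 2) := by gcongr
      _ = _ := by field_simp

end Taylor

theorem meas_comp {X Y : Type*} [TopologicalSpace X] [MeasurableSpace X] [BorelSpace X] 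
    [SecondCountableTopology X] [TopologicalSpace.PseudoMetrizableSpace X]
    [TopologicalSpace Y] [TopologicalSpace.PseudoMetrizableSpace Y] {μ : Measure ℝ}
    {O : Set X} (hO : IsOpen O) {Ψ : X → Y} (hΨ : ContinuousOn Ψ O) {γ : ℝ → X}
    (hγ : AEMeasurable γ μ) (hm : ∀ᵐ s ∂μ, γ s ∈ O) :
    AEStronglyMeasurable (fun s => Ψ (γ s)) μ := by
  have h1 : (μ.map γ).restrict O = μ.map γ := by
    refine Measure.restrict_eq_self_of_ae_mem ?_
    exact (ae_map_iff hγ (p := fun x => x ∈ O) hO.measurableSet).2 hm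
  have h2 : AEStronglyMeasurable Ψ ((μ.map γ).restrict O) := hΨ.aestronglyMeasurable hO.measurableSet
  rw [h1] at h2
  exact h2.comp_aemeasurable hγ

end SOC

namespace SOC

/-- The dynamics at a frozen time, as a function of state and control. -/
def Fs {n r : ℕ} (φ : ℝ × (Fin n → ℝ) × (Fin r → ℝ) → Fin n → ℝ) (s : ℝ) 
    (w : (Fin n → ℝ) × (Fin r → ℝ)) : Fin n → ℝ := φ (s, w.1, w.2)

/-- Smoothness of the dynamics. -/
structure Smooth {n r : ℕ} (U : Set (Fin r → ℝ)) 
    (φ : ℝ × (Fin n → ℝ) × (Fin r → ℝ) → Fin n → ℝ) : Prop where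
  hU : IsOpen U
  c0 : ContinuousOn φ {p : ℝ × (Fin n → ℝ) × (Fin r → ℝ) | p.2.2 ∈ U}
  c2 : ∀ t : ℝ, ContDiffOn ℝ 2 (Fs φ t) (univ ×ˢ U)
  c1' : ContinuousOn (fun p : ℝ × (Fin n → ℝ) × (Fin r → ℝ) => fderiv ℝ (Fs φ p.1) (p.2.1, p.2.2))
      {p : ℝ × (Fin n → ℝ) × (Fin r → ℝ) | p.2.2 ∈ U}
  c2' : ContinuousOn (fun p : ℝ × (Fin n → ℝ) × (Fin r → ℝ) => 
        fderiv ℝ (fderiv ℝ (Fs φ p.1)) (p.2.1, p.2.2))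
      {p : ℝ × (Fin n → ℝ) × (Fin r → ℝ) | p.2.2 ∈ U}

section
variable {n r : ℕ} {U : Set (Fin r → ℝ)} {φ : ℝ × (Fin n → ℝ) × (Fin r → ℝ) → Fin n → ℝ}

theorem Smooth.isOpen (H : Smooth U φ) : IsOpen {p : ℝ × (Fin n → ℝ) × (Fin r → ℝ) | p.2.2 ∈ U} :=
  H.hU.preimage (by fun_prop)

theorem Smooth.diff (H : Smooth U φ) (s : ℝ) {w : (Fin n → ℝ) × (Fin r → ℝ)} (hw : w.2 ∈ U) :
    DifferentiableAt ℝ (Fs φ s) w ∧ DifferentiableAt ℝ (fderiv ℝ (Fs φ s)) w := by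
  have h1 : ContDiffAt ℝ 2 (Fs φ s) w := 
    (H.c2 s).contDiffAt ((isOpen_univ.prod H.hU).mem_nhds ⟨mem_univ _, hw⟩)
  refine ⟨h1.differentiableAt (by norm_num), ?_⟩
  exact (h1.fderiv_right (m := 1) (by norm_num)).differentiableAt (by norm_num)

variable {t₀ t₁ : ℝ} {xh : ℝ → Fin n → ℝ}

theorem graph_compact (hxc : ContinuousOn xh (Icc t₀ t₁)) {K : Set (Fin r → ℝ)} (hK : IsCompact K) :
    IsCompact ((fun p : ℝ × (Fin r → ℝ) => (p.1, xh p.1, p.2)) '' (Icc t₀ t₁ ×ˢ K)) := by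
  refine (isCompact_Icc.prod hK).image_of_continuousOn ?_
  refine continuous_fst.continuousOn.prodMk (ContinuousOn.prodMk ?_ continuous_snd.continuousOn)
  exact hxc.comp continuous_fst.continuousOn (fun p hp => hp.1)

theorem locC (H : Smooth U φ) (hxc : ContinuousOn xh (Icc t₀ t₁)) {K : Set (Fin r → ℝ)} 
    (hK : IsCompact K) (hKU : K ⊆ U) : ∃ C : ℝ, 0 ≤ C ∧ ∀ s ∈ Icc t₀ t₁, ∀ u ∈ K, 
      ‖φ (s, xh s, u)‖ ≤ C ∧ ‖fderiv ℝ (Fs φ s) (xh s, u)‖ ≤ C ∧ 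
      ‖fderiv ℝ (fderiv ℝ (Fs φ s)) (xh s, u)‖ ≤ C := by
  have hc := graph_compact hxc hK
  have hsub : (fun p : ℝ × (Fin r → ℝ) => (p.1, xh p.1, p.2)) '' (Icc t₀ t₁ ×ˢ K) ⊆ 
      {p : ℝ × (Fin n → ℝ) × (Fin r → ℝ) | p.2.2 ∈ U} := by
    rintro _ ⟨p, hp, rfl⟩
    exact hKU hp.2
  obtain ⟨C0, h0⟩ := hc.exists_bound_of_continuousOn (H.c0.mono hsub)
  obtain ⟨C1, h1⟩ := hc.exists_bound_of_continuousOn (H.c1'.mono hsub)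
  obtain ⟨C2, h2⟩ := hc.exists_bound_of_continuousOn
    (E := ((Fin n → ℝ) × (Fin r → ℝ) →L[ℝ] (Fin n → ℝ) × (Fin r → ℝ) →L[ℝ] Fin n → ℝ))
    (H.c2'.mono hsub)
  refine ⟨|C0| + |C1| + |C2|, by positivity, fun s hs u hu => ?_⟩
  have hm : (s, xh s, u) ∈ (fun p : ℝ × (Fin r → ℝ) => (p.1, xh p.1, p.2)) '' (Icc t₀ t₁ ×ˢ K) :=
    ⟨(s, u), ⟨hs, hu⟩, rfl⟩
  have a0 := h0 _ hm
  have a1 := h1 _ hm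
  have a2 := h2 _ hm
  have b0 := le_abs_self C0
  have b1 := le_abs_self C1
  have b2 := le_abs_self C2
  have d0 := abs_nonneg C0
  have d1 := abs_nonneg C1
  have d2 := abs_nonneg C2
  exact ⟨by linarith, a1.trans (by linarith), a2.trans (by linarith)⟩

theorem loc (H : Smooth U φ) (hxc : ContinuousOn xh (Icc t₀ t₁)) {K : Set (Fin r → ℝ)} 
    (hK : IsCompact K) (hKU : K ⊆ U) {ω : ℝ} (hω : 0 < ω) : ∃ δ > 0, ∀ s ∈ Icc t₀ t₁, ∀ u ∈ K, 
      ∀ w : (Fin n → ℝ) × (Fin r → ℝ), ‖w - (xh s, u)‖ < δ → w.2 ∈ U ∧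
      ‖Fs φ s w - Fs φ s (xh s, u)‖ ≤ ω ∧ 
      ‖fderiv ℝ (Fs φ s) w - fderiv ℝ (Fs φ s) (xh s, u)‖ ≤ ω ∧ 
      ‖fderiv ℝ (fderiv ℝ (Fs φ s)) w - fderiv ℝ (fderiv ℝ (Fs φ s)) (xh s, u)‖ ≤ ω := by
  have hc := graph_compact hxc hK
  have hsub : (fun p : ℝ × (Fin r → ℝ) => (p.1, xh p.1, p.2)) '' (Icc t₀ t₁ ×ˢ K) ⊆ 
      {p : ℝ × (Fin n → ℝ) × (Fin r → ℝ) | p.2.2 ∈ U} := by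
    rintro _ ⟨p, hp, rfl⟩
    exact hKU hp.2
  obtain ⟨δ0, hδ0, h0⟩ := unif H.isOpen hc hsub H.c0 hω
  obtain ⟨δ1, hδ1, h1⟩ := unif H.isOpen hc hsub H.c1' hω
  obtain ⟨δ2, hδ2, h2⟩ := unif 
    (Y := ((Fin n → ℝ) × (Fin r → ℝ) →L[ℝ] (Fin n → ℝ) × (Fin r → ℝ) →L[ℝ] Fin n → ℝ))
    H.isOpen hc hsub H.c2' hω
  refine ⟨min δ0 (min δ1 δ2), lt_min hδ0 (lt_min hδ1 hδ2), fun s hs u hu w hw => ?_⟩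
  have hm : (s, xh s, u) ∈ (fun p : ℝ × (Fin r → ℝ) => (p.1, xh p.1, p.2)) '' (Icc t₀ t₁ ×ˢ K) :=
    ⟨(s, u), ⟨hs, hu⟩, rfl⟩
  have hn : ‖((s, w.1, w.2) : ℝ × (Fin n → ℝ) × (Fin r → ℝ)) - (s, xh s, u)‖ = ‖w - (xh s, u)‖ := by
    have : ((s, w.1, w.2) : ℝ × (Fin n → ℝ) × (Fin r → ℝ)) - (s, xh s, u) = (0, w - (xh s, u)) := by
      ext <;> simp
    rw [this, Prod.norm_def]
    simp
  obtain ⟨p0, q0⟩ := h0 _ hm (s, w.1, w.2) (by rw [hn]; exact hw.trans_le (min_le_left _ _))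
  obtain ⟨p1, q1⟩ := h1 _ hm (s, w.1, w.2) (by 
    rw [hn]; exact hw.trans_le ((min_le_right _ _).trans (min_le_left _ _)))
  obtain ⟨p2, q2⟩ := h2 _ hm (s, w.1, w.2) (by 
    rw [hn]; exact hw.trans_le ((min_le_right _ _).trans (min_le_right _ _)))
  exact ⟨p0, q0, q1, q2⟩

/-- Selection along disjoint sets. -/
theorem sel {X Y V : Type*} [AddCommGroup V] [AddCommGroup Y] {N : ℕ} {S : Fin N → Set X}
    (hS : ∀ k l s, s ∈ S k → s ∈ S l → k = l) (u0 : V) (ub : Fin N → V) (Ψ : V → Y) (s : X) :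
    Ψ (u0 + ∑ k, (S k).indicator (fun _ => ub k - u0) s) = 
      Ψ u0 + ∑ k, (S k).indicator (fun _ => Ψ (ub k) - Ψ u0) s := by
  by_cases h : ∃ k, s ∈ S k
  · obtain ⟨k, hk⟩ := h
    have hn : ∀ l, l ≠ k → s ∉ S l := fun l hl hs => hl (hS l k s hs hk)
    rw [Finset.sum_eq_single k (fun l _ hl => indicator_of_notMem (hn l hl) _) (by simp),
      Finset.sum_eq_single k (fun l _ hl => indicator_of_notMem (hn l hl) _) (by simp),
      indicator_of_mem hk, indicator_of_mem hk]
    simp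
  · push Not at h
    rw [Finset.sum_eq_zero (fun k _ => indicator_of_notMem (h k) _), 
      Finset.sum_eq_zero (fun k _ => indicator_of_notMem (h k) _)]
    simp

theorem sel_mem {X V : Type*} [AddCommGroup V] {N : ℕ} {S : Fin N → Set X}
    (hS : ∀ k l s, s ∈ S k → s ∈ S l → k = l) (u0 : V) (ub : Fin N → V) (s : X) :
    u0 + ∑ k, (S k).indicator (fun _ => ub k - u0) s = u0 ∨ 
     ∃ k, u0 + ∑ k, (S k).indicator (fun _ => ub k - u0) s = ub k := by
  by_cases h : ∃ k, s ∈ S k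
  · obtain ⟨k, hk⟩ := h
    have hn : ∀ l, l ≠ k → s ∉ S l := fun l hl hs => hl (hS l k s hs hk)
    right
    refine ⟨k, ?_⟩
    rw [Finset.sum_eq_single k (fun l _ hl => indicator_of_notMem (hn l hl) _) (by simp),
      indicator_of_mem hk]
    simp
  · push Not at h
    left
    rw [Finset.sum_eq_zero (fun k _ => indicator_of_notMem (h k) _)]
    simp

theorem band_disj {ρ : ℝ → ℝ} {N : ℕ} {e : ℝ} {α : Fin N → ℝ} 
    (hα : ∀ k, 0 ≤ α k ∧ e * α k ≤ 1 / ((N:ℝ) + 1)) (k l : Fin N) (s : ℝ)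
    (hk : s ∈ band ρ (((k:ℕ):ℝ) / (N + 1)) (((k:ℕ):ℝ) / (N + 1) + e * α k))
    (hl : s ∈ band ρ (((l:ℕ):ℝ) / (N + 1)) (((l:ℕ):ℝ) / (N + 1) + e * α l)) : k = l := by
  have hN : (0:ℝ) < (N:ℝ) + 1 := by positivity
  have key : ∀ i : Fin N, s ∈ band ρ (((i:ℕ):ℝ) / (N + 1)) (((i:ℕ):ℝ) / (N + 1) + e * α i) → 
      ((i:ℕ):ℝ) ≤ ρ s * (N + 1) ∧ ρ s * (N + 1) < (i:ℕ) + 1 := by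
    rintro i ⟨h1, h2⟩
    constructor
    · rwa [div_le_iff₀ hN] at h1
    · have h3 : ρ s < (((i:ℕ):ℝ) + 1) / (N + 1) := by
        rw [add_div]; linarith [(hα i).2]
      rwa [lt_div_iff₀ hN] at h3
  obtain ⟨a1, a2⟩ := key k hk
  obtain ⟨b1, b2⟩ := key l hl
  have c1 : ((k:ℕ):ℝ) < (l:ℕ) + 1 := by linarith
  have c2 : ((l:ℕ):ℝ) < (k:ℕ) + 1 := by linarith
  have d1 : (k:ℕ) < (l:ℕ) + 1 := by exact_mod_cast c1
  have d2 : (l:ℕ) < (k:ℕ) + 1 := by exact_mod_cast c2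
  ext
  omega

end

end SOC

namespace SOC

section
variable {n r : ℕ} {U : Set (Fin r → ℝ)} {φ : ℝ × (Fin n → ℝ) × (Fin r → ℝ) → Fin n → ℝ}
variable {t₀ t₁ : ℝ}

theorem clm_app_meas {Z Y : Type*} [NormedAddCommGroup Z] [NormedSpace ℝ Z] [NormedAddCommGroup Y] [NormedSpace ℝ Y]
    {μ : Measure ℝ} {L : ℝ → Z →L[ℝ] Y} {q : ℝ → Z} (hL : AEStronglyMeasurable L μ) 
    (hq : AEStronglyMeasurable q μ) : AEStronglyMeasurable (fun s => L s (q s)) μ :=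
  (isBoundedBilinearMap_apply (𝕜 := ℝ) (E := Z) (F := Y)).continuous.comp_aestronglyMeasurable
    (hL.prodMk hq)

theorem graph_meas {μ : Measure ℝ} {x : ℝ → Fin n → ℝ} {u : ℝ → Fin r → ℝ} (hx : AEMeasurable x μ)
    (hu : AEMeasurable u μ) : AEMeasurable (fun s => (s, x s, u s)) μ :=
  aemeasurable_id.prodMk (hx.prodMk hu)

theorem phi_meas (H : Smooth U φ) {μ : Measure ℝ} {x : ℝ → Fin n → ℝ} {u : ℝ → Fin r → ℝ} 
    (hx : AEMeasurable x μ) (hu : AEMeasurable u μ) (hm : ∀ᵐ s ∂μ, u s ∈ U) :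
    AEStronglyMeasurable (fun s => φ (s, x s, u s)) μ :=
  meas_comp H.isOpen H.c0 (graph_meas hx hu) hm

theorem phi1_meas (H : Smooth U φ) {μ : Measure ℝ} {x : ℝ → Fin n → ℝ} {u : ℝ → Fin r → ℝ} 
    (hx : AEMeasurable x μ) (hu : AEMeasurable u μ) (hm : ∀ᵐ s ∂μ, u s ∈ U) :
    AEStronglyMeasurable (fun s => fderiv ℝ (Fs φ s) (x s, u s)) μ :=
  meas_comp H.isOpen H.c1' (graph_meas hx hu) hm

theorem phi2_meas (H : Smooth U φ) {μ : Measure ℝ} {x : ℝ → Fin n → ℝ} {u : ℝ → Fin r → ℝ} 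
    (hx : AEMeasurable x μ) (hu : AEMeasurable u μ) (hm : ∀ᵐ s ∂μ, u s ∈ U) :
    AEStronglyMeasurable (fun s => fderiv ℝ (fderiv ℝ (Fs φ s)) (x s, u s)) μ :=
  meas_comp 
    (Y := ((Fin n → ℝ) × (Fin r → ℝ) →L[ℝ] (Fin n → ℝ) × (Fin r → ℝ) →L[ℝ] Fin n → ℝ))
    H.isOpen H.c2' (graph_meas hx hu) hm

/-- A reference process with a tangent direction. -/
structure Proc (U : Set (Fin r → ℝ)) (φ : ℝ × (Fin n → ℝ) × (Fin r → ℝ) → Fin n → ℝ) (t₀ t₁ : ℝ)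
    (xh h : ℝ → Fin n → ℝ) (uh v : ℝ → Fin r → ℝ) : Prop where
  sm : Smooth U φ
  ht : t₀ < t₁
  xc : ContinuousOn xh (Icc t₀ t₁)
  hc : ContinuousOn h (Icc t₀ t₁)
  um : Measurable uh
  vm : Measurable v
  reg : ∃ Kc : Set (Fin r → ℝ), IsCompact Kc ∧ Kc ⊆ U ∧ ∀ᵐ t ∂(volume.restrict (Icc t₀ t₁)), uh t ∈ Kc
  vb : ∃ C : ℝ, ∀ᵐ t ∂(volume.restrict (Icc t₀ t₁)), ‖v t‖ ≤ C

variable {xh h : ℝ → Fin n → ℝ} {uh v : ℝ → Fin r → ℝ}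

theorem Proc.q_bd (P : Proc U φ t₀ t₁ xh h uh v) : ∃ C : ℝ, 0 ≤ C ∧ 
    ∀ᵐ t ∂(volume.restrict (Icc t₀ t₁)), ‖(h t, v t)‖ ≤ C := by
  obtain ⟨C1, h1⟩ := P.vb
  obtain ⟨C2, h2⟩ := isCompact_Icc.exists_bound_of_continuousOn P.hc
  refine ⟨max 0 (max C1 C2), le_max_left _ _, ?_⟩
  filter_upwards [h1, ae_restrict_mem measurableSet_Icc] with s hs hs'
  refine (max_le ?_ ?_)
  · exact (h2 s hs').trans ((le_max_right _ _).trans (le_max_right _ _))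
  · exact hs.trans ((le_max_left _ _).trans (le_max_right _ _))

theorem Proc.uU (P : Proc U φ t₀ t₁ xh h uh v) : ∀ᵐ t ∂(volume.restrict (Icc t₀ t₁)), uh t ∈ U := by
  obtain ⟨Kc, _, h2, h3⟩ := P.reg
  exact h3.mono (fun t ht => h2 ht)

theorem Proc.xm (P : Proc U φ t₀ t₁ xh h uh v) : AEMeasurable xh (volume.restrict (Icc t₀ t₁)) :=
  P.xc.aemeasurable measurableSet_Icc

theorem Proc.hm (P : Proc U φ t₀ t₁ xh h uh v) : AEMeasurable h (volume.restrict (Icc t₀ t₁)) :=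
  P.hc.aemeasurable measurableSet_Icc

/-- State derivative along the reference process. -/
noncomputable def AA (φ : ℝ × (Fin n → ℝ) × (Fin r → ℝ) → Fin n → ℝ) (xh : ℝ → Fin n → ℝ) 
    (uh : ℝ → Fin r → ℝ) (s : ℝ) : (Fin n → ℝ) →L[ℝ] (Fin n → ℝ) :=
  (fderiv ℝ (Fs φ s) (xh s, uh s)).comp (ContinuousLinearMap.inl ℝ _ _)

/-- Second-order forcing along the reference process. -/
noncomputable def BB (φ : ℝ × (Fin n → ℝ) × (Fin r → ℝ) → Fin n → ℝ) (xh h : ℝ → Fin n → ℝ) 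
    (uh v : ℝ → Fin r → ℝ) (s : ℝ) : Fin n → ℝ :=
  (1/2:ℝ) • fderiv ℝ (fderiv ℝ (Fs φ s)) (xh s, uh s) (h s, v s) (h s, v s)

/-- Needle forcing. -/
noncomputable def ZZ (φ : ℝ × (Fin n → ℝ) × (Fin r → ℝ) → Fin n → ℝ) (xh : ℝ → Fin n → ℝ) 
    (uh : ℝ → Fin r → ℝ) (K : Set ℝ) (ub : Fin r → ℝ) : ℝ → Fin n → ℝ :=
  K.indicator (fun s => φ (s, xh s, ub) - φ (s, xh s, uh s))

theorem Proc.A_meas (P : Proc U φ t₀ t₁ xh h uh v) :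
    AEStronglyMeasurable (AA φ xh uh) (volume.restrict (Icc t₀ t₁)) := by
  have h1 := phi1_meas P.sm P.xm P.um.aemeasurable P.uU
  exact (ContinuousLinearMap.precomp (Fin n → ℝ) 
    (ContinuousLinearMap.inl ℝ (Fin n → ℝ) (Fin r → ℝ))).continuous.comp_aestronglyMeasurable h1

theorem Proc.A_bd (P : Proc U φ t₀ t₁ xh h uh v) : ∃ M : ℝ, 
    ∀ᵐ s ∂(volume.restrict (Icc t₀ t₁)), ‖AA φ xh uh s‖ ≤ M := by
  obtain ⟨Kc, h1, h2, h3⟩ := P.reg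
  obtain ⟨C, hC0, hC⟩ := locC P.sm P.xc h1 h2
  refine ⟨C, ?_⟩
  filter_upwards [h3, ae_restrict_mem measurableSet_Icc] with s hs hs'
  refine ContinuousLinearMap.opNorm_le_bound _ hC0 (fun x => ?_)
  have h4 := (fderiv ℝ (Fs φ s) (xh s, uh s)).le_opNorm (x, 0)
  have h5 : ‖((x, 0) : (Fin n → ℝ) × (Fin r → ℝ))‖ = ‖x‖ := by
    rw [Prod.norm_def]; simp
  rw [h5] at h4
  exact h4.trans (by gcongr; exact (hC s hs' _ hs).2.1)

theorem Proc.B_int (P : Proc U φ t₀ t₁ xh h uh v) : IntegrableOn (BB φ xh h uh v) (Icc t₀ t₁) := by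
  obtain ⟨Kc, h1, h2, h3⟩ := P.reg
  obtain ⟨C, hC0, hC⟩ := locC P.sm P.xc h1 h2
  obtain ⟨Cq, hCq0, hCq⟩ := P.q_bd
  have hq : AEStronglyMeasurable (fun s => (h s, v s)) (volume.restrict (Icc t₀ t₁)) :=
    (P.hm.prodMk P.vm.aemeasurable).aestronglyMeasurable
  have hm := clm_app_meas (clm_app_meas (phi2_meas P.sm P.xm P.um.aemeasurable P.uU) hq) hq
  refine Integrable.smul (1/2:ℝ) (integrableOn_of_bdd (C := C * Cq * Cq) hm ?_)
  filter_upwards [h3, ae_restrict_mem measurableSet_Icc, hCq] with s hs hs' hs''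
  refine (ContinuousLinearMap.le_opNorm₂ _ _ _).trans ?_
  gcongr
  exact (hC s hs' _ hs).2.2

theorem Proc.Z_meas (P : Proc U φ t₀ t₁ xh h uh v) {K : Set ℝ} (hK : MeasurableSet K) 
    {ub : Fin r → ℝ} (hub : ub ∈ U) : 
    AEStronglyMeasurable (ZZ φ xh uh K ub) (volume.restrict (Icc t₀ t₁)) :=
  ((phi_meas P.sm P.xm aemeasurable_const (Eventually.of_forall fun _ => hub)).sub
    (phi_meas P.sm P.xm P.um.aemeasurable P.uU)).indicator hK

theorem Proc.Z_bd (P : Proc U φ t₀ t₁ xh h uh v) {N : ℕ} (K : Fin N → Set ℝ)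
    {ub : Fin N → Fin r → ℝ} (hub : ∀ k, ub k ∈ U) : ∃ C : ℝ, ∀ k,
      ∀ᵐ s ∂(volume.restrict (Icc t₀ t₁)), ‖ZZ φ xh uh (K k) (ub k) s‖ ≤ C := by
  obtain ⟨Kc, h1, h2, h3⟩ := P.reg
  obtain ⟨C, hC0, hC⟩ := locC P.sm P.xc (h1.union (finite_range ub).isCompact) 
    (union_subset h2 (range_subset_iff.2 hub))
  refine ⟨C + C, fun k => ?_⟩
  filter_upwards [h3, ae_restrict_mem measurableSet_Icc] with s hs hs'
  refine (norm_indicator_le_norm_self _ _).trans ((norm_sub_le _ _).trans ?_)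
  exact add_le_add (hC s hs' _ (Or.inr ⟨k, rfl⟩)).1 (hC s hs' _ (Or.inl hs)).1

theorem Proc.Z_int (P : Proc U φ t₀ t₁ xh h uh v) {K : Set ℝ} (hK : MeasurableSet K) 
    {ub : Fin r → ℝ} (hub : ub ∈ U) : IntegrableOn (ZZ φ xh uh K ub) (Icc t₀ t₁) := by
  obtain ⟨C, hC⟩ := P.Z_bd (N := 1) (fun _ => K) (ub := fun _ => ub) (fun _ => hub)
  exact integrableOn_of_bdd (P.Z_meas hK hub) (hC 0)

end
end SOC

namespace SOC

section
variable {Z Y : Type*} [NormedAddCommGroup Z] [NormedSpace ℝ Z] [NormedAddCommGroup Y] [NormedSpace ℝ Y]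

theorem locG {F : Z → Y} (hF : ContDiff ℝ 2 F) (z : Z) {ω : ℝ} (hω : 0 < ω) : ∃ δ > 0, ∀ w, ‖w - z‖ < δ →
    DifferentiableAt ℝ F w ∧ DifferentiableAt ℝ (fderiv ℝ F) w ∧
    ‖fderiv ℝ F w - fderiv ℝ F z‖ ≤ ω ∧ 
    ‖fderiv ℝ (fderiv ℝ F) w - fderiv ℝ (fderiv ℝ F) z‖ ≤ ω := by
  have h1 : ContDiff ℝ 1 (fderiv ℝ F) := hF.fderiv_right (by norm_num)
  have h2 : Continuous (fderiv ℝ (fderiv ℝ F)) := h1.continuous_fderiv (by norm_num)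
  obtain ⟨δ1, hδ1, a1⟩ := Metric.continuous_iff.1 h1.continuous z ω hω
  obtain ⟨δ2, hδ2, a2⟩ := (Metric.continuous_iff (β := Z →L[ℝ] Z →L[ℝ] Y)).1 h2 z ω hω
  refine ⟨min δ1 δ2, lt_min hδ1 hδ2, fun w hw => ⟨hF.differentiable (by norm_num) w, 
    h1.differentiable (by norm_num) w, ?_, ?_⟩⟩
  · rw [← dist_eq_norm] at hw ⊢
    exact (a1 w (hw.trans_le (min_le_left _ _))).le
  · rw [← dist_eq_norm] at hw
    have h3 := (a2 w (hw.trans_le (min_le_right _ _))).le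
    rw [dist_eq_norm (E := Z →L[ℝ] Z →L[ℝ] Y)] at h3
    exact h3

/-- Second-order expansion of a smooth endpoint map, uniform in a bounded correction. -/
theorem expG {F : Z → Y} (hF : ContDiff ℝ 2 F) (z η : Z) {B c : ℝ} (hB : 0 ≤ B) (hc : 0 < c) :
    ∀ᶠ ε : ℝ in 𝓝[>] 0, ∀ Φ : Z → Y, (∀ ξ, Φ ξ = (ε ^ 2)⁻¹ • (F (z + ε • η + ε ^ 2 • ξ) - F z - 
      ε • fderiv ℝ F z η)) → 
    (∀ ξ ξ', ‖ξ‖ ≤ B → ‖ξ'‖ ≤ B → ‖Φ ξ - Φ ξ' - fderiv ℝ F z (ξ - ξ')‖ ≤ c * ‖ξ - ξ'‖) ∧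
    ‖Φ 0 - (1/2:ℝ) • fderiv ℝ (fderiv ℝ F) z η η‖ ≤ c := by
  obtain ⟨ω, hω, hω1, hω2⟩ : ∃ ω > 0, ω ≤ c ∧ ω * ‖η‖ ^ 2 ≤ c := by
    refine ⟨c / (1 + ‖η‖ ^ 2), by positivity, div_le_self hc.le (by nlinarith [sq_nonneg ‖η‖]), ?_⟩
    rw [div_mul_eq_mul_div, div_le_iff₀ (by positivity)]
    nlinarith [sq_nonneg ‖η‖]
  obtain ⟨δ, hδ, hl⟩ := locG hF z hω
  have e1 : ∀ᶠ ε : ℝ in 𝓝[>] 0, ε * ‖η‖ + ε ^ 2 * B < δ := by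
    have : Tendsto (fun ε : ℝ => ε * ‖η‖ + ε ^ 2 * B) (𝓝 0) (𝓝 (0 * ‖η‖ + 0 ^ 2 * B)) := by
      apply Continuous.tendsto; fun_prop
    exact (this.mono_left nhdsWithin_le_nhds).eventually_lt_const (by simpa using hδ)
  filter_upwards [e1, self_mem_nhdsWithin] with ε h1 h2 Φ hΦ
  obtain ⟨p, q⟩ := tay hω.le (fun w hw => (hl w hw).1) (fun w hw => (hl w hw).2.1) 
    (fun w hw => (hl w hw).2.2.1) (fun w hw => (hl w hw).2.2.2) h2 hB h1 hΦ
  exact ⟨fun ξ ξ' h3 h4 => (p ξ ξ' h3 h4).trans (by gcongr), q.trans hω2⟩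

end

section
variable {n r : ℕ} {U : Set (Fin r → ℝ)} {φ : ℝ × (Fin n → ℝ) × (Fin r → ℝ) → Fin n → ℝ}
variable {t₀ t₁ : ℝ} {xh h : ℝ → Fin n → ℝ} {uh v : ℝ → Fin r → ℝ}

theorem pair_norm_le (x : Fin n → ℝ) : ‖((x, 0) : (Fin n → ℝ) × (Fin r → ℝ))‖ = ‖x‖ := by
  rw [Prod.norm_def]; simp

/-- Verification of the hypotheses of the fixed point theorem. -/
theorem Proc.verify (P : Proc U φ t₀ t₁ xh h uh v) {N : ℕ} {K : Fin N → Set ℝ}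
    (hK : ∀ k, MeasurableSet (K k)) {ub : Fin N → Fin r → ℝ} (hub : ∀ k, ub k ∈ U)
    {c B : ℝ} (hc : 0 < c) (hB : 0 < B) :
    ∀ᶠ ε : ℝ in 𝓝[>] 0, ∀ (Φ : ℝ → (Fin n → ℝ) → Fin n → ℝ) 
      (ψ : Fin N → ℝ → (Fin n → ℝ) → Fin n → ℝ), 
      (∀ s ξ, Φ s ξ = (ε ^ 2)⁻¹ • (Fs φ s (xh s + ε • h s + ε ^ 2 • ξ, uh s + ε • v s) - 
        Fs φ s (xh s, uh s) - ε • fderiv ℝ (Fs φ s) (xh s, uh s) (h s, v s))) →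
      (∀ k s ξ, ψ k s ξ = (K k).indicator (fun s => Fs φ s (xh s + ε • h s + ε ^ 2 • ξ, ub k) - 
        Fs φ s (xh s + ε • h s + ε ^ 2 • ξ, uh s + ε • v s)) s) →
      (∀ y : C(Icc t₀ t₁, Fin n → ℝ), ‖y‖ ≤ B → 
        IntegrableOn (fun s => Φ s (ev P.ht.le y s)) (Icc t₀ t₁)) ∧
      (∀ k, ∀ y : C(Icc t₀ t₁, Fin n → ℝ), ‖y‖ ≤ B → 
        IntegrableOn (fun s => ψ k s (ev P.ht.le y s)) (Icc t₀ t₁)) ∧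
      (∀ᵐ s ∂(volume.restrict (Icc t₀ t₁)), ∀ ξ ξ' : Fin n → ℝ, ‖ξ‖ ≤ B → ‖ξ'‖ ≤ B →
        ‖Φ s ξ - Φ s ξ' - AA φ xh uh s (ξ - ξ')‖ ≤ c * ‖ξ - ξ'‖) ∧
      (∀ᵐ s ∂(volume.restrict (Icc t₀ t₁)), ‖Φ s 0 - BB φ xh h uh v s‖ ≤ c) ∧
      (∀ k, ∀ᵐ s ∂(volume.restrict (Icc t₀ t₁)), ∀ ξ ξ' : Fin n → ℝ, ‖ξ‖ ≤ B → ‖ξ'‖ ≤ B →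
        ‖ψ k s ξ - ψ k s ξ'‖ ≤ c * ‖ξ - ξ'‖) ∧
      (∀ k, ∀ᵐ s ∂(volume.restrict (Icc t₀ t₁)), ∀ ξ : Fin n → ℝ, ‖ξ‖ ≤ B → 
        ‖ψ k s ξ - ZZ φ xh uh (K k) (ub k) s‖ ≤ c) := by
  obtain ⟨Kc, hKc, hKcU, hKcm⟩ := P.reg
  have hK' := hKc.union (finite_range ub).isCompact
  have hK'U : Kc ∪ range ub ⊆ U := union_subset hKcU (range_subset_iff.2 hub)
  obtain ⟨C, hC0, hC⟩ := locC P.sm P.xc hK' hK'U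
  obtain ⟨Cq, hCq0, hCq⟩ := P.q_bd
  obtain ⟨ω, hω, hω1, hω2, hω3⟩ : ∃ ω > 0, ω ≤ c ∧ ω * Cq ^ 2 ≤ c ∧ ω + ω ≤ c := by
    refine ⟨c / (2 + Cq ^ 2), by positivity, div_le_self hc.le (by nlinarith [sq_nonneg Cq]), ?_, ?_⟩
    · rw [div_mul_eq_mul_div, div_le_iff₀ (by positivity)]
      nlinarith [sq_nonneg Cq]
    · rw [← add_div, div_le_iff₀ (by positivity)]
      nlinarith [sq_nonneg Cq]
  obtain ⟨δ, hδ, hl⟩ := loc P.sm P.xc hK' hK'U hω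
  have e1 : ∀ᶠ ε : ℝ in 𝓝[>] 0, ε * Cq + ε ^ 2 * B < δ := by
    have : Tendsto (fun ε : ℝ => ε * Cq + ε ^ 2 * B) (𝓝 0) (𝓝 (0 * Cq + 0 ^ 2 * B)) := by
      apply Continuous.tendsto; fun_prop
    exact (this.mono_left nhdsWithin_le_nhds).eventually_lt_const (by simpa using hδ)
  have e2 : ∀ᶠ ε : ℝ in 𝓝[>] 0, (2 * (C + ω)) * ε ^ 2 < c := by
    have : Tendsto (fun ε : ℝ => (2 * (C + ω)) * ε ^ 2) (𝓝 0) (𝓝 ((2 * (C + ω)) * 0 ^ 2)) := by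
      apply Continuous.tendsto; fun_prop
    exact (this.mono_left nhdsWithin_le_nhds).eventually_lt_const (by simpa using hc)
  filter_upwards [e1, e2, self_mem_nhdsWithin] with ε h1 h2 hε Φ ψ hΦ hψ
  replace hε : 0 < ε := hε
  have hε2 : (0:ℝ) < ε ^ 2 := by positivity
  -- pointwise good set
  obtain ⟨gd, hgd⟩ : ∃ gd : ℝ → Prop, ∀ s, gd s ↔ (s ∈ Icc t₀ t₁ ∧ uh s ∈ Kc ∧ ‖(h s, v s)‖ ≤ Cq) :=
    ⟨_, fun s => Iff.rfl⟩
  have hgda : ∀ᵐ s ∂(volume.restrict (Icc t₀ t₁)), gd s := by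
    filter_upwards [hKcm, hCq, ae_restrict_mem measurableSet_Icc] with s a1 a2 a3
    exact (hgd s).2 ⟨a3, a1, a2⟩
  -- closeness
  have near1 : ∀ s, gd s → ∀ ξ : Fin n → ℝ, ‖ξ‖ ≤ B → 
      ‖((xh s + ε • h s + ε ^ 2 • ξ, uh s + ε • v s) : (Fin n → ℝ) × (Fin r → ℝ)) - (xh s, uh s)‖ < δ := by
    intro s hs ξ hξ
    have : ((xh s + ε • h s + ε ^ 2 • ξ, uh s + ε • v s) : (Fin n → ℝ) × (Fin r → ℝ)) - (xh s, uh s) = 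
        ε • (h s, v s) + ε ^ 2 • (ξ, 0) := by
      refine Prod.ext ?_ ?_
      · simp only [Prod.fst_sub, Prod.fst_add, Prod.smul_fst]; abel
      · simp only [Prod.snd_sub, Prod.snd_add, Prod.smul_snd, smul_zero]; abel
    rw [this]
    refine (norm_add_le _ _).trans_lt (lt_of_le_of_lt ?_ h1)
    rw [norm_smul, norm_smul, Real.norm_of_nonneg hε.le, Real.norm_of_nonneg hε2.le, pair_norm_le]
    gcongr
    exact ((hgd s).1 hs).2.2
  have near2 : ∀ s, gd s → ∀ ξ : Fin n → ℝ, ‖ξ‖ ≤ B → ∀ u : Fin r → ℝ, 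
      ‖((xh s + ε • h s + ε ^ 2 • ξ, u) : (Fin n → ℝ) × (Fin r → ℝ)) - (xh s, u)‖ < δ := by
    intro s hs ξ hξ u
    refine lt_of_le_of_lt ?_ (near1 s hs ξ hξ)
    rw [Prod.norm_def, Prod.norm_def]
    refine max_le (le_max_left _ _) ?_
    simp
  have lip : ∀ s, gd s → ∀ u ∈ Kc ∪ range ub, ∀ w₁ w₂ : (Fin n → ℝ) × (Fin r → ℝ), 
      ‖w₁ - (xh s, u)‖ < δ → ‖w₂ - (xh s, u)‖ < δ → 
      ‖Fs φ s w₁ - Fs φ s w₂‖ ≤ (C + ω) * ‖w₁ - w₂‖ := by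
    intro s hs u hu w₁ w₂ a1 a2
    have hsI := ((hgd s).1 hs).1
    have a3 := tay1 (F := Fs φ s) (fun w hw => (P.sm.diff s (hl s hsI u hu w hw).1).1)
      (fun w hw => (hl s hsI u hu w hw).2.2.1) a1 a2
    have a4 := (fderiv ℝ (Fs φ s) (xh s, u)).le_opNorm (w₁ - w₂)
    have a5 := (hC s hsI u hu).2.1
    have a6 := norm_le_norm_sub_add (Fs φ s w₁ - Fs φ s w₂) (fderiv ℝ (Fs φ s) (xh s, u) (w₁ - w₂))
    nlinarith [norm_nonneg (w₁ - w₂)]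
  -- measurability of trajectories
  have hym : ∀ y : C(Icc t₀ t₁, Fin n → ℝ), AEMeasurable 
      (fun s => xh s + ε • h s + ε ^ 2 • ev P.ht.le y s) (volume.restrict (Icc t₀ t₁)) := by
    intro y
    exact (P.xm.add (P.hm.const_smul ε)).add 
      ((ev_continuous P.ht.le y).measurable.aemeasurable.const_smul (ε ^ 2))
  have hum : AEMeasurable (fun s => uh s + ε • v s) (volume.restrict (Icc t₀ t₁)) :=
    (P.um.add (P.vm.const_smul ε)).aemeasurable
  have huU : ∀ᵐ s ∂(volume.restrict (Icc t₀ t₁)), uh s + ε • v s ∈ U := by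
    filter_upwards [hgda] with s hs
    exact (hl s ((hgd s).1 hs).1 _ (Or.inl ((hgd s).1 hs).2.1) _ (near1 s hs 0 (by simpa using hB.le))).1
  have hbase : IntegrableOn (fun s => Fs φ s (xh s, uh s)) (Icc t₀ t₁) := by
    refine integrableOn_of_bdd (C := C) (phi_meas P.sm P.xm P.um.aemeasurable P.uU) ?_
    filter_upwards [hgda] with s hs
    exact (hC s ((hgd s).1 hs).1 _ (Or.inl ((hgd s).1 hs).2.1)).1
  have hqm : AEStronglyMeasurable (fun s => (h s, v s)) (volume.restrict (Icc t₀ t₁)) :=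
    (P.hm.prodMk P.vm.aemeasurable).aestronglyMeasurable
  have hlinI : IntegrableOn (fun s => fderiv ℝ (Fs φ s) (xh s, uh s) (h s, v s)) (Icc t₀ t₁) := by
    refine integrableOn_of_bdd (C := C * Cq) 
      (clm_app_meas (phi1_meas P.sm P.xm P.um.aemeasurable P.uU) hqm) ?_
    filter_upwards [hgda] with s hs
    refine (ContinuousLinearMap.le_opNorm _ _).trans ?_
    gcongr
    · exact (hC s ((hgd s).1 hs).1 _ (Or.inl ((hgd s).1 hs).2.1)).2.1
    · exact ((hgd s).1 hs).2.2
  have hpert : ∀ y : C(Icc t₀ t₁, Fin n → ℝ), ‖y‖ ≤ B → IntegrableOn (fun s => 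
      Fs φ s (xh s + ε • h s + ε ^ 2 • ev P.ht.le y s, uh s + ε • v s)) (Icc t₀ t₁) := by
    intro y hy
    refine integrableOn_of_bdd (C := ω + C) (phi_meas P.sm (hym y) hum huU) ?_
    filter_upwards [hgda] with s hs
    have b1 := (hl s ((hgd s).1 hs).1 _ (Or.inl ((hgd s).1 hs).2.1) _ (near1 s hs _ 
      ((norm_ev_le P.ht.le y s).trans hy))).2.1
    have b2 := (hC s ((hgd s).1 hs).1 _ (Or.inl ((hgd s).1 hs).2.1)).1
    exact (norm_le_norm_sub_add _ (Fs φ s (xh s, uh s))).trans (add_le_add b1 b2)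
  have hpert2 : ∀ k, ∀ y : C(Icc t₀ t₁, Fin n → ℝ), ‖y‖ ≤ B → IntegrableOn (fun s => 
      Fs φ s (xh s + ε • h s + ε ^ 2 • ev P.ht.le y s, ub k)) (Icc t₀ t₁) := by
    intro k y hy
    refine integrableOn_of_bdd (C := ω + C) (phi_meas P.sm (hym y) aemeasurable_const 
      (Eventually.of_forall fun _ => hub k)) ?_
    filter_upwards [hgda] with s hs
    have b1 := (hl s ((hgd s).1 hs).1 (ub k) (Or.inr ⟨k, rfl⟩) _ (near2 s hs _ 
      ((norm_ev_le P.ht.le y s).trans hy) _)).2.1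
    have b2 := (hC s ((hgd s).1 hs).1 (ub k) (Or.inr ⟨k, rfl⟩)).1
    exact (norm_le_norm_sub_add _ (Fs φ s (xh s, ub k))).trans (add_le_add b1 b2)
  have htay : ∀ s, gd s → (∀ ξ ξ' : (Fin n → ℝ), ‖ξ‖ ≤ B → ‖ξ'‖ ≤ B → 
        ‖Φ s ξ - Φ s ξ' - AA φ xh uh s (ξ - ξ')‖ ≤ ω * ‖ξ - ξ'‖) ∧
      ‖Φ s 0 - BB φ xh h uh v s‖ ≤ ω * ‖(h s, v s)‖ ^ 2 := by
    intro s hs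
    obtain ⟨hsI, hsK, hsq⟩ := (hgd s).1 hs
    have hl' := hl s hsI _ (Or.inl hsK)
    obtain ⟨p, q⟩ := tay (F := Fs φ s) (w₀ := (xh s, uh s)) (q := (h s, v s)) (ε := ε) (B := B) hω.le
      (fun w hw => (P.sm.diff s (hl' w hw).1).1) (fun w hw => (P.sm.diff s (hl' w hw).1).2)
      (fun w hw => (hl' w hw).2.2.1) (fun w hw => (hl' w hw).2.2.2) hε hB.le 
      (lt_of_le_of_lt (by gcongr) h1) (Φ := fun ξ => (ε ^ 2)⁻¹ • (Fs φ s ((xh s, uh s) + ε • (h s, v s) + 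
        ε ^ 2 • ξ) - Fs φ s (xh s, uh s) - ε • fderiv ℝ (Fs φ s) (xh s, uh s) (h s, v s))) (fun ξ => rfl)
    have e3 : ∀ ξ : Fin n → ℝ, Φ s ξ = (ε ^ 2)⁻¹ • (Fs φ s ((xh s, uh s) + ε • (h s, v s) + 
        ε ^ 2 • (ξ, 0)) - Fs φ s (xh s, uh s) - ε • fderiv ℝ (Fs φ s) (xh s, uh s) (h s, v s)) := by
      intro ξ
      rw [hΦ]
      congr 5
      simp
    constructor
    · intro ξ ξ' a1 a2
      have := p (ξ, 0) (ξ', 0) (by rwa [pair_norm_le]) (by rwa [pair_norm_le])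
      simp only [← e3] at this
      have e4 : ((ξ, 0) : (Fin n → ℝ) × (Fin r → ℝ)) - (ξ', 0) = (ξ - ξ', 0) := by simp
      rw [e4, pair_norm_le] at this
      exact this
    · have e5 : (0 : (Fin n → ℝ) × (Fin r → ℝ)) = (0, 0) := rfl
      simp only [e5, ← e3] at q
      exact q
  refine ⟨?_, ?_, ?_, ?_, ?_, ?_⟩
  · intro y hy
    simp only [hΦ]
    exact Integrable.smul (ε ^ 2)⁻¹ (((hpert y hy).sub hbase).sub (hlinI.smul ε))
  · intro k y hy
    have e6 : (fun s => ψ k s (ev P.ht.le y s)) = (K k).indicator (fun s => 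
        Fs φ s (xh s + ε • h s + ε ^ 2 • ev P.ht.le y s, ub k) - 
        Fs φ s (xh s + ε • h s + ε ^ 2 • ev P.ht.le y s, uh s + ε • v s)) := by
      funext s
      rw [hψ]
      by_cases hs : s ∈ K k <;> simp [hs]
    rw [e6]
    exact Integrable.indicator ((hpert2 k y hy).sub (hpert y hy)) (hK k)
  · filter_upwards [hgda] with s hs ξ ξ' a1 a2
    exact ((htay s hs).1 ξ ξ' a1 a2).trans (by gcongr)
  · filter_upwards [hgda] with s hs
    refine (htay s hs).2.trans (le_trans ?_ hω2)
    gcongr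
    exact ((hgd s).1 hs).2.2
  · intro k
    filter_upwards [hgda] with s hs ξ ξ' a1 a2
    obtain ⟨hsI, hsK, hsq⟩ := (hgd s).1 hs
    rw [hψ, hψ]
    by_cases hk : s ∈ K k
    · rw [indicator_of_mem hk, indicator_of_mem hk]
      have b1 := lip s hs (ub k) (Or.inr ⟨k, rfl⟩) _ _ (near2 s hs ξ a1 _) (near2 s hs ξ' a2 _)
      have b2 := lip s hs _ (Or.inl hsK) _ _ (near1 s hs ξ a1) (near1 s hs ξ' a2)
      have b3 : ∀ u : Fin r → ℝ, ((xh s + ε • h s + ε ^ 2 • ξ, u) : (Fin n → ℝ) × (Fin r → ℝ)) - 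
          (xh s + ε • h s + ε ^ 2 • ξ', u) = ε ^ 2 • (ξ - ξ', 0) := by
        intro u
        refine Prod.ext ?_ ?_
        · simp only [Prod.fst_sub, Prod.smul_fst, smul_sub]; abel
        · simp
      rw [b3, norm_smul, Real.norm_of_nonneg hε2.le, pair_norm_le] at b1 b2
      rw [sub_sub_sub_comm]
      refine (norm_sub_le _ _).trans ((add_le_add b1 b2).trans ?_)
      nlinarith [norm_nonneg (ξ - ξ')]
    · rw [indicator_of_notMem hk, indicator_of_notMem hk]
      simp only [sub_self, norm_zero]
      positivity
  · intro k
    filter_upwards [hgda] with s hs ξ a1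
    obtain ⟨hsI, hsK, hsq⟩ := (hgd s).1 hs
    rw [hψ, ZZ]
    by_cases hk : s ∈ K k
    · rw [indicator_of_mem hk, indicator_of_mem hk]
      have b1 := (hl s hsI (ub k) (Or.inr ⟨k, rfl⟩) _ (near2 s hs ξ a1 _)).2.1
      have b2 := (hl s hsI _ (Or.inl hsK) _ (near1 s hs ξ a1)).2.1
      rw [sub_sub_sub_comm]
      exact (norm_sub_le _ _).trans ((add_le_add b1 b2).trans hω3)
    · rw [indicator_of_notMem hk, indicator_of_notMem hk]
      simp only [sub_self, norm_zero]
      positivity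

end
end SOC

namespace SOC

section
variable {n r : ℕ} {U : Set (Fin r → ℝ)} {φ : ℝ × (Fin n → ℝ) × (Fin r → ℝ) → Fin n → ℝ}
variable {t₀ t₁ : ℝ} {xh h : ℝ → Fin n → ℝ} {uh v : ℝ → Fin r → ℝ}

theorem int_comb {a b c d : ℝ} {f₁ f₂ f₃ : ℝ → Fin n → ℝ} (h₁ : IntervalIntegrable f₁ volume a b)
    (h₂ : IntervalIntegrable f₂ volume a b) (h₃ : IntervalIntegrable f₃ volume a b) :
    ∫ s in a..b, (f₁ s + c • f₂ s + d • f₃ s) = 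
      (∫ s in a..b, f₁ s) + c • (∫ s in a..b, f₂ s) + d • ∫ s in a..b, f₃ s := by
  have h₂' : IntervalIntegrable (fun s => c • f₂ s) volume a b := h₂.smul c
  have h₃' : IntervalIntegrable (fun s => d • f₃ s) volume a b := h₃.smul d
  rw [intervalIntegral.integral_add (h₁.add h₂') h₃', intervalIntegral.integral_add h₁ h₂', 
    intervalIntegral.integral_smul, intervalIntegral.integral_smul]

/-- Existence of second-order variations satisfying the equality constraints. -/
theorem Proc.variation (P : Proc U φ t₀ t₁ xh h uh v) {m₂ : ℕ}
    (hodeint : IntervalIntegrable (fun s => φ (s, xh s, uh s)) volume t₀ t₁)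
    (hode : ∀ t ∈ Icc t₀ t₁, xh t = xh t₀ + ∫ s in t₀..t, φ (s, xh s, uh s))
    (hlinint : IntervalIntegrable (fun s => fderiv ℝ (Fs φ s) (xh s, uh s) (h s, v s)) volume t₀ t₁)
    (hlin : ∀ t ∈ Icc t₀ t₁, h t = h t₀ + ∫ s in t₀..t, fderiv ℝ (Fs φ s) (xh s, uh s) (h s, v s))
    {g : (Fin n → ℝ) × (Fin n → ℝ) → Fin m₂ → ℝ} (hg : ContDiff ℝ 2 g)
    (hbg : g (xh t₀, xh t₁) = 0) (hqg : fderiv ℝ g (xh t₀, xh t₁) (h t₀, h t₁) = 0)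
    {N : ℕ} {K : Fin N → Set ℝ}
    (hK : ∀ k, MeasurableSet (K k)) {ub : Fin N → Fin r → ℝ} (hub : ∀ k, ub k ∈ U)
    (ys : C(Icc t₀ t₁, Fin n → ℝ)) (as : Fin n → ℝ) (αs : Fin N → ℝ)
    (hαs : ∀ k, 0 < αs k)
    (hys : ys - ContinuousMap.const _ as - prim t₀ t₁ (fun s => AA φ xh uh s (ev P.ht.le ys s)) - 
      prim t₀ t₁ (BB φ xh h uh v) - ∑ k, αs k • prim t₀ t₁ (ZZ φ xh uh (K k) (ub k)) = 0)
    (hgs : fderiv ℝ g (xh t₀, xh t₁) (ends P.ht.le ys) + 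
      (1/2:ℝ) • fderiv ℝ (fderiv ℝ g) (xh t₀, xh t₁) (h t₀, h t₁) (h t₀, h t₁) = 0)
    (hsurj : ∀ w : Fin m₂ → ℝ, ∃ (y : C(Icc t₀ t₁, Fin n → ℝ)) (a : Fin n → ℝ) (α : Fin N → ℝ),
      y - ContinuousMap.const _ a - prim t₀ t₁ (fun s => AA φ xh uh s (ev P.ht.le y s)) - 
        ∑ k, α k • prim t₀ t₁ (ZZ φ xh uh (K k) (ub k)) = 0 ∧ 
        fderiv ℝ g (xh t₀, xh t₁) (ends P.ht.le y) = w)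
    {τ : ℝ} (hτ : 0 < τ) :
    ∀ᶠ ε : ℝ in 𝓝[>] 0, ∃ (y : C(Icc t₀ t₁, Fin n → ℝ)) (u : ℝ → Fin r → ℝ) (x : ℝ → Fin n → ℝ), 
      ‖y - ys‖ ≤ τ ∧ (∀ s, x s = xh s + ε • h s + ε ^ 2 • ev P.ht.le y s) ∧ Measurable u ∧
      (∃ Kc : Set (Fin r → ℝ), IsCompact Kc ∧ Kc ⊆ U ∧
        ∀ᵐ t ∂(volume.restrict (Icc t₀ t₁)), u t ∈ Kc) ∧
      IntervalIntegrable (fun s => φ (s, x s, u s)) volume t₀ t₁ ∧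
      (∀ t ∈ Icc t₀ t₁, x t = x t₀ + ∫ s in t₀..t, φ (s, x s, u s)) ∧
      g (x t₀, x t₁) = 0 := by
  obtain ⟨M, hM⟩ := P.A_bd
  obtain ⟨Cζ, hCζ⟩ := P.Z_bd K hub
  obtain ⟨c, hc, B, hB, e₀, he₀, hfix⟩ := fixpt P.ht P.A_meas hM P.B_int 
    (fun k => P.Z_meas (hK k) (hub k)) hCζ (fderiv ℝ g (xh t₀, xh t₁)) _ ys as αs hαs hys hgs hsurj hτ
  obtain ⟨Kc, hKc, hKcU, hKcm⟩ := P.reg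
  obtain ⟨δ, hδ, hδU⟩ := hKc.exists_cthickening_subset_open P.sm.hU hKcU
  obtain ⟨Cq, hCq0, hCq⟩ := P.q_bd
  have e1 : ∀ᶠ ε : ℝ in 𝓝[>] 0, ε * Cq < δ := by
    have : Tendsto (fun ε : ℝ => ε * Cq) (𝓝 0) (𝓝 (0 * Cq)) := by
      apply Continuous.tendsto; fun_prop
    exact (this.mono_left nhdsWithin_le_nhds).eventually_lt_const (by simpa using hδ)
  have e2 : ∀ᶠ ε : ℝ in 𝓝[>] 0, ε ^ 2 < e₀ := by
    have : Tendsto (fun ε : ℝ => ε ^ 2) (𝓝 0) (𝓝 (0 ^ 2)) := by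
      apply Continuous.tendsto; fun_prop
    exact (this.mono_left nhdsWithin_le_nhds).eventually_lt_const (by simpa using he₀)
  filter_upwards [e1, e2, self_mem_nhdsWithin, P.verify hK hub hc hB, 
    expG hg (xh t₀, xh t₁) (h t₀, h t₁) hB.le hc] with ε h1 h2 hε hver hexp
  replace hε : 0 < ε := hε
  have hε2 : (0:ℝ) < ε ^ 2 := by positivity
  obtain ⟨Φ, hΦ⟩ : ∃ Φ : ℝ → (Fin n → ℝ) → Fin n → ℝ, ∀ s ξ, Φ s ξ = (ε ^ 2)⁻¹ • 
      (Fs φ s (xh s + ε • h s + ε ^ 2 • ξ, uh s + ε • v s) - 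
        Fs φ s (xh s, uh s) - ε • fderiv ℝ (Fs φ s) (xh s, uh s) (h s, v s)) := ⟨_, fun s ξ => rfl⟩
  obtain ⟨ψ, hψ⟩ : ∃ ψ : Fin N → ℝ → (Fin n → ℝ) → Fin n → ℝ, ∀ k s ξ, ψ k s ξ = 
      (K k).indicator (fun s => Fs φ s (xh s + ε • h s + ε ^ 2 • ξ, ub k) - 
        Fs φ s (xh s + ε • h s + ε ^ 2 • ξ, uh s + ε • v s)) s := ⟨_, fun k s ξ => rfl⟩
  obtain ⟨G, hG⟩ : ∃ G : (Fin n → ℝ) × (Fin n → ℝ) → Fin m₂ → ℝ, ∀ ξ, G ξ = (ε ^ 2)⁻¹ • 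
      (g ((xh t₀, xh t₁) + ε • (h t₀, h t₁) + ε ^ 2 • ξ) - g (xh t₀, xh t₁) - 
      ε • fderiv ℝ g (xh t₀, xh t₁) (h t₀, h t₁)) := ⟨_, fun _ => rfl⟩
  obtain ⟨v1, v2, v3, v4, v5, v6⟩ := hver Φ ψ hΦ hψ
  obtain ⟨g1, g2⟩ := hexp G hG
  obtain ⟨y, a, α, ρ, hρ, hα, hy, hGy, hyτ, hyB⟩ := hfix (ε ^ 2) hε2 h2 Φ ψ G v1 v2 v3 v4 v5 v6 g1 g2
  -- the needle sets
  obtain ⟨bd, hbd⟩ : ∃ bd : Fin N → Set ℝ, ∀ k, bd k = 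
    band ρ (((k:ℕ):ℝ) / (N + 1)) (((k:ℕ):ℝ) / (N + 1) + ε ^ 2 * α k) := ⟨_, fun k => rfl⟩
  have hbdm : ∀ k, MeasurableSet (bd k) := fun k => by rw [hbd]; exact band_meas hρ _ _
  have hdisj : ∀ k l s, s ∈ bd k ∩ K k → s ∈ bd l ∩ K l → k = l := by
    intro k l s hk hl
    refine band_disj (ρ := ρ) hα k l s ?_ ?_
    · rw [← hbd]; exact hk.1
    · rw [← hbd]; exact hl.1
  simp only [← hbd] at hy
  obtain ⟨x, hx⟩ : ∃ x : ℝ → Fin n → ℝ, ∀ s, x s = xh s + ε • h s + ε ^ 2 • ev P.ht.le y s := 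
    ⟨_, fun s => rfl⟩
  obtain ⟨u, hu⟩ : ∃ u : ℝ → Fin r → ℝ, ∀ s, u s = (uh s + ε • v s) + ∑ k, (bd k ∩ K k).indicator 
      (fun _ => ub k - (uh s + ε • v s)) s := ⟨_, fun s => rfl⟩
  have hphi : ∀ s, φ (s, x s, u s) = φ (s, xh s, uh s) + ε • fderiv ℝ (Fs φ s) (xh s, uh s) (h s, v s) + 
      ε ^ 2 • (Φ s (ev P.ht.le y s) + ∑ k : Fin N, (ε ^ 2)⁻¹ • (bd k).indicator 
            (fun s => ψ k s (ev P.ht.le y s)) s) := by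
    intro s
    rw [hu, sel hdisj (uh s + ε • v s) ub (fun u => φ (s, x s, u)) s, smul_add, Finset.smul_sum]
    simp only [smul_smul, mul_inv_cancel₀ hε2.ne', one_smul, hΦ]
    have e3 : ∀ k, (bd k ∩ K k).indicator (fun _ => φ (s, x s, ub k) - φ (s, x s, uh s + ε • v s)) s = 
        (bd k).indicator (fun s => ψ k s (ev P.ht.le y s)) s := by
      intro k
      by_cases b1 : s ∈ bd k
      · rw [indicator_of_mem b1, hψ]
        by_cases b2 : s ∈ K k
        · have b3 : s ∈ bd k ∩ K k := mem_inter b1 b2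
          rw [indicator_of_mem b2, indicator_of_mem b3, hx]
          rfl
        · have b3 : s ∉ bd k ∩ K k := fun hh => b2 hh.2
          rw [indicator_of_notMem b2, indicator_of_notMem b3]
      · have b3 : s ∉ bd k ∩ K k := fun hh => b1 hh.1
        rw [indicator_of_notMem b1, indicator_of_notMem b3]
    rw [Finset.sum_congr rfl (fun k _ => e3 k), ← add_assoc]
    congr 1
    rw [hx]
    simp only [Fs]
    abel
  have hbr : IntegrableOn (fun s => Φ s (ev P.ht.le y s) + ∑ k : Fin N, (ε ^ 2)⁻¹ • (bd k).indicator 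
            (fun s => ψ k s (ev P.ht.le y s)) s) (Icc t₀ t₁) := by
    refine Integrable.add (v1 y hyB) (integrable_finsetSum _ (fun k _ => ?_))
    exact Integrable.smul (ε ^ 2)⁻¹ (Integrable.indicator (v2 k y hyB) (hbdm k))
  have hI1 := on_of_ii P.ht.le hodeint
  have hI2 := on_of_ii P.ht.le hlinint
  have hphiI : IntegrableOn (fun s => φ (s, x s, u s)) (Icc t₀ t₁) := by
    simp only [hphi]
    exact (Integrable.add hI1 (Integrable.smul ε hI2)).add (Integrable.smul (ε ^ 2) hbr)
  have hevt : ∀ t ∈ Icc t₀ t₁, ev P.ht.le y t = a + ∫ s in t₀..t, (Φ s (ev P.ht.le y s) + 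
      ∑ k : Fin N, (ε ^ 2)⁻¹ • (bd k).indicator (fun s => ψ k s (ev P.ht.le y s)) s) := by
    intro t ht
    rw [ev_of_mem P.ht.le y ht]
    have := congrArg (fun z : C(Icc t₀ t₁, Fin n → ℝ) => z ⟨t, ht⟩) hy
    simp only [ContinuousMap.add_apply, ContinuousMap.const_apply] at this
    rw [prim_apply P.ht.le hbr] at this
    exact this
  have ht0 : t₀ ∈ Icc t₀ t₁ := ⟨le_rfl, P.ht.le⟩
  have hev0 : ev P.ht.le y t₀ = a := by
    rw [hevt t₀ ht0]; simp
  refine ⟨y, u, x, hyτ, hx, ?_, ?_, ?_, ?_, ?_⟩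
  · have : u = fun s => (uh s + ε • v s) + ∑ k, (bd k ∩ K k).indicator 
      (fun s => ub k - (uh s + ε • v s)) s := by
      funext s
      rw [hu]
      congr 1
    rw [this]
    have hm0 : Measurable (fun s => uh s + ε • v s) := P.um.add (P.vm.const_smul ε)
    refine hm0.add (Finset.measurable_sum _ (fun k _ => ?_))
    exact (measurable_const.sub hm0).indicator ((hbdm k).inter (hK k))
  · refine ⟨Metric.cthickening δ Kc ∪ range ub, (hKc.cthickening).union (finite_range ub).isCompact, 
      union_subset hδU (range_subset_iff.2 hub), ?_⟩
    filter_upwards [hKcm, hCq] with s s1 s2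
    rcases sel_mem hdisj (uh s + ε • v s) ub s with h3 | ⟨k, h3⟩
    · left
      rw [hu, h3]
      refine Metric.mem_cthickening_of_dist_le _ (uh s) _ _ s1 ?_
      rw [dist_eq_norm, add_sub_cancel_left, norm_smul, Real.norm_of_nonneg hε.le]
      refine le_trans ?_ h1.le
      gcongr
      exact (le_max_right _ _).trans s2
    · right
      rw [hu, h3]
      exact ⟨k, rfl⟩
  · exact ii_of_on hphiI ⟨P.ht.le, le_rfl⟩
  · intro t ht
    have i1 := ii_of_on hI1 ht
    have i2 := ii_of_on hI2 ht
    have i3 := ii_of_on hbr ht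
    simp only [hphi]
    rw [int_comb i1 i2 i3, hx, hx, hev0, hevt t ht, hode t ht, hlin t ht]
    simp only [smul_add]
    abel
  · rw [hG] at hGy
    have h3 := (smul_eq_zero.1 hGy).resolve_left (inv_ne_zero hε2.ne')
    rw [hbg, hqg, smul_zero, sub_zero, sub_zero, ends_apply] at h3
    rw [hx, hx]
    exact h3

end
end SOC

namespace SOC

section
variable {Z Y : Type*} [NormedAddCommGroup Z] [NormedSpace ℝ Z] [NormedAddCommGroup Y] [NormedSpace ℝ Y]

theorem decr {F : Z → Y} (hF : ContDiff ℝ 2 F) (ℓ : Y →L[ℝ] ℝ) {z η ws : Z} 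
    (h1 : ℓ (fderiv ℝ F z η) ≤ 0) 
    (h2 : ℓ (fderiv ℝ F z ws) + (1/2:ℝ) * ℓ (fderiv ℝ (fderiv ℝ F) z η η) < 0) :
    ∀ᶠ τ : ℝ in 𝓝[>] 0, ∀ᶠ ε : ℝ in 𝓝[>] 0, ∀ w, ‖w - ws‖ ≤ τ → 
      ℓ (F (z + ε • η + ε ^ 2 • w)) < ℓ (F z) := by
  obtain ⟨m, hm, hm0⟩ : ∃ m : ℝ, m = -(ℓ (fderiv ℝ F z ws) + (1/2:ℝ) * ℓ (fderiv ℝ (fderiv ℝ F) z η η)) ∧ 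
    0 < m := ⟨_, rfl, by linarith⟩
  obtain ⟨L, hL, hL0⟩ : ∃ L : ℝ, ‖ℓ‖ ≤ L ∧ 0 < L := ⟨‖ℓ‖ + 1, by linarith, by positivity⟩
  obtain ⟨B, hB, hB0⟩ : ∃ B : ℝ, B = ‖ws‖ + 1 ∧ 0 < B := ⟨_, rfl, by positivity⟩
  obtain ⟨c, hc, hc0⟩ : ∃ c : ℝ, L * (c * B + c) = m / 2 ∧ 0 < c := 
    ⟨m / (2 * L * (B + 1)), by field_simp, by positivity⟩
  have e1 : ∀ᶠ τ : ℝ in 𝓝[>] 0, L * (‖fderiv ℝ F z‖ * τ) < m / 2 := by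
    have : Tendsto (fun ε : ℝ => L * (‖fderiv ℝ F z‖ * ε)) (𝓝 0) (𝓝 (L * (‖fderiv ℝ F z‖ * 0))) := by
      apply Continuous.tendsto; fun_prop
    exact (this.mono_left nhdsWithin_le_nhds).eventually_lt_const (by simpa using hm0)
  have e2 : ∀ᶠ τ : ℝ in 𝓝[>] 0, τ < 1 := 
    (tendsto_id.mono_left nhdsWithin_le_nhds).eventually_lt_const (by norm_num)
  filter_upwards [e1, e2] with τ hτ hτ1
  filter_upwards [expG hF z η hB0.le hc0, self_mem_nhdsWithin] with ε hexp hε w hw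
  replace hε : 0 < ε := hε
  have hε2 : (0:ℝ) < ε ^ 2 := by positivity
  obtain ⟨Φ, hΦ⟩ : ∃ Φ : Z → Y, ∀ ξ, Φ ξ = (ε ^ 2)⁻¹ • (F (z + ε • η + ε ^ 2 • ξ) - F z - 
      ε • fderiv ℝ F z η) := ⟨_, fun _ => rfl⟩
  obtain ⟨p, q⟩ := hexp Φ hΦ
  have hwB : ‖w‖ ≤ B := by
    have := norm_le_norm_sub_add w ws
    linarith
  have p' := p w 0 hwB (by simpa using hB0.le)
  rw [sub_zero] at p'
  have hFe : F (z + ε • η + ε ^ 2 • w) = F z + ε • fderiv ℝ F z η + ε ^ 2 • Φ w := by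
    rw [hΦ, smul_smul, mul_inv_cancel₀ hε2.ne', one_smul]; abel
  have dec : Φ w = (Φ w - Φ 0 - fderiv ℝ F z w) + (Φ 0 - (1/2:ℝ) • fderiv ℝ (fderiv ℝ F) z η η) + 
      fderiv ℝ F z (w - ws) + (fderiv ℝ F z ws + (1/2:ℝ) • fderiv ℝ (fderiv ℝ F) z η η) := by
    rw [map_sub]; abel
  have hl : ∀ y, ℓ y ≤ L * ‖y‖ := fun y => (le_abs_self _).trans ((ℓ.le_opNorm y).trans (by gcongr))
  have b1 := hl (Φ w - Φ 0 - fderiv ℝ F z w)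
  have b2 := hl (Φ 0 - (1/2:ℝ) • fderiv ℝ (fderiv ℝ F) z η η)
  have b3 := hl (fderiv ℝ F z (w - ws))
  have b4 := (fderiv ℝ F z).le_opNorm (w - ws)
  have hΦneg : ℓ (Φ w) < 0 := by
    rw [dec, map_add, map_add, map_add, map_add ℓ (fderiv ℝ F z ws), map_smul, smul_eq_mul]
    have c1 : L * ‖Φ w - Φ 0 - fderiv ℝ F z w‖ ≤ L * (c * B) := by
      gcongr; exact p'.trans (by gcongr)
    have c2 : L * ‖Φ 0 - (1/2:ℝ) • fderiv ℝ (fderiv ℝ F) z η η‖ ≤ L * c := by gcongr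
    have c3 : L * ‖fderiv ℝ F z (w - ws)‖ ≤ L * (‖fderiv ℝ F z‖ * τ) := by
      gcongr; exact b4.trans (by gcongr)
    linarith
  rw [hFe, map_add, map_add, map_smul, map_smul, smul_eq_mul, smul_eq_mul]
  nlinarith

theorem inact {F : Z → Y} (hF : Continuous F) (ℓ : Y →L[ℝ] ℝ) {z η ws : Z} (h1 : ℓ (F z) < 0) :
    ∀ᶠ τ : ℝ in 𝓝[>] 0, ∀ᶠ ε : ℝ in 𝓝[>] 0, ∀ w, ‖w - ws‖ ≤ τ → 
      ℓ (F (z + ε • η + ε ^ 2 • w)) < 0 := by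
  have e2 : ∀ᶠ τ : ℝ in 𝓝[>] 0, τ < 1 := 
    (tendsto_id.mono_left nhdsWithin_le_nhds).eventually_lt_const (by norm_num)
  have h2 : ∀ᶠ x in 𝓝 z, ℓ (F x) < 0 := (ℓ.continuous.comp hF).continuousAt.eventually_lt_const h1
  obtain ⟨δ, hδ, h3⟩ := Metric.eventually_nhds_iff.1 h2
  have e1 : ∀ᶠ ε : ℝ in 𝓝[>] 0, ε * ‖η‖ + ε ^ 2 * (‖ws‖ + 1) < δ := by
    have : Tendsto (fun ε : ℝ => ε * ‖η‖ + ε ^ 2 * (‖ws‖ + 1)) (𝓝 0) (𝓝 (0 * ‖η‖ + 0 ^ 2 * (‖ws‖ + 1))) := by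
      apply Continuous.tendsto; fun_prop
    exact (this.mono_left nhdsWithin_le_nhds).eventually_lt_const (by simpa using hδ)
  filter_upwards [e2] with τ hτ
  filter_upwards [e1, self_mem_nhdsWithin] with ε h4 hε w hw
  replace hε : 0 < ε := hε
  have hε2 : (0:ℝ) < ε ^ 2 := by positivity
  refine h3 ?_
  have : z + ε • η + ε ^ 2 • w - z = ε • η + ε ^ 2 • w := by abel
  rw [dist_eq_norm, this]
  refine (norm_add_le _ _).trans_lt (lt_of_le_of_lt ?_ h4)
  rw [norm_smul, norm_smul, Real.norm_of_nonneg hε.le, Real.norm_of_nonneg hε2.le]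
  gcongr
  have := norm_le_norm_sub_add w ws
  linarith

end

section
variable {n r : ℕ} {U : Set (Fin r → ℝ)} {φ : ℝ × (Fin n → ℝ) × (Fin r → ℝ) → Fin n → ℝ}
variable {t₀ t₁ : ℝ} {xh h : ℝ → Fin n → ℝ} {uh v : ℝ → Fin r → ℝ}

theorem Proc.caseB (P : Proc U φ t₀ t₁ xh h uh v) {m₁ m₂ : ℕ}
    (hodeint : IntervalIntegrable (fun s => φ (s, xh s, uh s)) volume t₀ t₁)
    (hode : ∀ t ∈ Icc t₀ t₁, xh t = xh t₀ + ∫ s in t₀..t, φ (s, xh s, uh s))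
    (hlinint : IntervalIntegrable (fun s => fderiv ℝ (Fs φ s) (xh s, uh s) (h s, v s)) volume t₀ t₁)
    (hlin : ∀ t ∈ Icc t₀ t₁, h t = h t₀ + ∫ s in t₀..t, fderiv ℝ (Fs φ s) (xh s, uh s) (h s, v s))
    {f₀ : (Fin n → ℝ) × (Fin n → ℝ) → ℝ} {f : (Fin n → ℝ) × (Fin n → ℝ) → Fin m₁ → ℝ}
    {g : (Fin n → ℝ) × (Fin n → ℝ) → Fin m₂ → ℝ} 
    (hf₀ : ContDiff ℝ 2 f₀) (hf : ContDiff ℝ 2 f) (hg : ContDiff ℝ 2 g)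
    (hbf : ∀ i, f (xh t₀, xh t₁) i ≤ 0)
    (hbg : g (xh t₀, xh t₁) = 0) 
    (hmin : ∃ δ > (0:ℝ), ∀ (x : ℝ → Fin n → ℝ) (u : ℝ → Fin r → ℝ),
      ContinuousOn x (Icc t₀ t₁) → Measurable u →
      (∃ Kc : Set (Fin r → ℝ), IsCompact Kc ∧ Kc ⊆ U ∧
        ∀ᵐ t ∂(volume.restrict (Icc t₀ t₁)), u t ∈ Kc) →
      IntervalIntegrable (fun s => φ (s, x s, u s)) volume t₀ t₁ →
      (∀ t ∈ Icc t₀ t₁, x t = x t₀ + ∫ s in t₀..t, φ (s, x s, u s)) →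
      (∀ i, f (x t₀, x t₁) i ≤ 0) → g (x t₀, x t₁) = 0 →
      (∀ t ∈ Icc t₀ t₁, ‖x t - xh t‖ < δ) →
      f₀ (xh t₀, xh t₁) ≤ f₀ (x t₀, x t₁))
    (hqf₀ : fderiv ℝ f₀ (xh t₀, xh t₁) (h t₀, h t₁) ≤ 0)
    (hqf : ∀ i, fderiv ℝ f (xh t₀, xh t₁) (h t₀, h t₁) i ≤ 0)
    (hqg : fderiv ℝ g (xh t₀, xh t₁) (h t₀, h t₁) = 0)
    {N : ℕ} {K : Fin N → Set ℝ}
    (hK : ∀ k, MeasurableSet (K k)) {ub : Fin N → Fin r → ℝ} (hub : ∀ k, ub k ∈ U)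
    (ys : C(Icc t₀ t₁, Fin n → ℝ)) (as : Fin n → ℝ) (αs : Fin N → ℝ)
    (hαs : ∀ k, 0 < αs k)
    (hys : ys - ContinuousMap.const _ as - prim t₀ t₁ (fun s => AA φ xh uh s (ev P.ht.le ys s)) - 
      prim t₀ t₁ (BB φ xh h uh v) - ∑ k, αs k • prim t₀ t₁ (ZZ φ xh uh (K k) (ub k)) = 0)
    (hf₀s : fderiv ℝ f₀ (xh t₀, xh t₁) (ends P.ht.le ys) + 
      (1/2:ℝ) * fderiv ℝ (fderiv ℝ f₀) (xh t₀, xh t₁) (h t₀, h t₁) (h t₀, h t₁) < 0)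
    (hfs : ∀ i, f (xh t₀, xh t₁) i = 0 → fderiv ℝ f (xh t₀, xh t₁) (ends P.ht.le ys) i + 
      (1/2:ℝ) * fderiv ℝ (fderiv ℝ f) (xh t₀, xh t₁) (h t₀, h t₁) (h t₀, h t₁) i < 0)
    (hgs : fderiv ℝ g (xh t₀, xh t₁) (ends P.ht.le ys) + 
      (1/2:ℝ) • fderiv ℝ (fderiv ℝ g) (xh t₀, xh t₁) (h t₀, h t₁) (h t₀, h t₁) = 0)
    (hsurj : ∀ w : Fin m₂ → ℝ, ∃ (y : C(Icc t₀ t₁, Fin n → ℝ)) (a : Fin n → ℝ) (α : Fin N → ℝ),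
      y - ContinuousMap.const _ a - prim t₀ t₁ (fun s => AA φ xh uh s (ev P.ht.le y s)) - 
        ∑ k, α k • prim t₀ t₁ (ZZ φ xh uh (K k) (ub k)) = 0 ∧ 
        fderiv ℝ g (xh t₀, xh t₁) (ends P.ht.le y) = w) : False := by
  obtain ⟨δ, hδ, hmin⟩ := hmin
  have d0 := decr hf₀ (ContinuousLinearMap.id ℝ ℝ) (z := (xh t₀, xh t₁)) (η := (h t₀, h t₁)) 
    (ws := ends P.ht.le ys) hqf₀ hf₀s
  have d1 : ∀ᶠ τ : ℝ in 𝓝[>] 0, ∀ i : Fin m₁, ∀ᶠ ε : ℝ in 𝓝[>] 0, ∀ w, ‖w - ends P.ht.le ys‖ ≤ τ → 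
      f ((xh t₀, xh t₁) + ε • (h t₀, h t₁) + ε ^ 2 • w) i < 0 := by
    rw [eventually_all]
    intro i
    rcases (hbf i).lt_or_eq with h1 | h1
    · exact inact hf.continuous (ContinuousLinearMap.proj (R := ℝ) (φ := fun _ : Fin m₁ => ℝ) i) h1
    · have := decr hf (ContinuousLinearMap.proj (R := ℝ) (φ := fun _ : Fin m₁ => ℝ) i) 
        (z := (xh t₀, xh t₁)) (η := (h t₀, h t₁)) (ws := ends P.ht.le ys) (hqf i) (hfs i h1)
      filter_upwards [this] with τ hτ
      filter_upwards [hτ] with ε hε w hw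
      have h2 := hε w hw
      rw [← h1]
      exact h2
  obtain ⟨τ, ⟨d0, d1⟩, hτ⟩ := ((d0.and d1).and self_mem_nhdsWithin).exists
  replace hτ : 0 < τ := hτ
  obtain ⟨Ch, hCh⟩ := isCompact_Icc.exists_bound_of_continuousOn P.hc
  have e1 : ∀ᶠ ε : ℝ in 𝓝[>] 0, ε * |Ch| + ε ^ 2 * (‖ys‖ + τ) < δ := by
    have : Tendsto (fun ε : ℝ => ε * |Ch| + ε ^ 2 * (‖ys‖ + τ)) (𝓝 0) 
        (𝓝 (0 * |Ch| + 0 ^ 2 * (‖ys‖ + τ))) := by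
      apply Continuous.tendsto; fun_prop
    exact (this.mono_left nhdsWithin_le_nhds).eventually_lt_const (by simpa using hδ)
  have dv := P.variation hodeint hode hlinint hlin hg hbg hqg hK hub ys as αs hαs hys hgs hsurj hτ
  obtain ⟨ε, ⟨⟨⟨d0, d1⟩, e1⟩, y, u, x, hy, hx, hum, hureg, hI, hO, hG⟩, hε⟩ := 
    ((((d0.and (eventually_all.2 d1)).and e1).and dv).and self_mem_nhdsWithin).exists
  replace hε : 0 < ε := hε
  have hε2 : (0:ℝ) < ε ^ 2 := by positivity
  have hw : ‖ends P.ht.le y - ends P.ht.le ys‖ ≤ τ := by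
    rw [← map_sub]
    exact (norm_ends_le _ _).trans hy
  have hxe : (x t₀, x t₁) = (xh t₀, xh t₁) + ε • (h t₀, h t₁) + ε ^ 2 • ends P.ht.le y := by
    rw [hx, hx, ends_apply]; rfl
  have hlt := d0 _ hw
  have hle := hmin x u ?_ hum hureg hI hO ?_ hG ?_
  · rw [hxe] at hle
    simp only [ContinuousLinearMap.id_apply] at hlt
    linarith
  · have : x = fun s => xh s + ε • h s + ε ^ 2 • ev P.ht.le y s := funext hx
    rw [this]
    exact (P.xc.add (P.hc.const_smul ε)).add ((ev_continuous P.ht.le y).continuousOn.const_smul (ε ^ 2))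
  · intro i
    rw [hxe]
    exact (d1 i _ hw).le
  · intro t ht
    have : x t - xh t = ε • h t + ε ^ 2 • ev P.ht.le y t := by rw [hx]; abel
    rw [this]
    refine (norm_add_le _ _).trans_lt (lt_of_le_of_lt ?_ e1)
    rw [norm_smul, norm_smul, Real.norm_of_nonneg hε.le, Real.norm_of_nonneg hε2.le]
    have h4 := norm_le_norm_sub_add y ys
    gcongr
    · exact (hCh t ht).trans (le_abs_self _)
    · exact (norm_ev_le _ _ _).trans (by linarith)

end
end SOC

namespace SOC

theorem ibp {t₀ t₁ : ℝ} (ht : t₀ ≤ t₁) {p y a b : ℝ → ℝ} (ha : IntervalIntegrable a volume t₀ t₁)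
    (hb : IntervalIntegrable b volume t₀ t₁)
    (hp : ∀ t ∈ Icc t₀ t₁, p t = p t₀ + ∫ s in t₀..t, a s)
    (hy : ∀ t ∈ Icc t₀ t₁, y t = y t₀ + ∫ s in t₀..t, b s) :
    ∫ s in t₀..t₁, (a s * y s + p s * b s) = p t₁ * y t₁ - p t₀ * y t₀ := by
  have ac : ∀ {c : ℝ → ℝ} (c0 : ℝ), IntervalIntegrable c volume t₀ t₁ → 
      AbsolutelyContinuousOnInterval (fun t => (∫ s in t₀..t, c s) + c0) t₀ t₁ := by
    intro c c0 hc
    refine AbsolutelyContinuousOnInterval.add (f := fun t => ∫ s in t₀..t, c s) (g := fun _ => c0)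
      (hc.absolutelyContinuousOnInterval_intervalIntegral (by simp)) ?_
    exact (LipschitzWith.const c0).lipschitzOnWith.absolutelyContinuousOnInterval
  have h1 := (ac (p t₀) ha).integral_deriv_mul_eq_sub (ac (y t₀) hb)
  have e1 : ∀ t ∈ Icc t₀ t₁, (∫ s in t₀..t, a s) + p t₀ = p t := fun t h => by rw [hp t h, add_comm]
  have e2 : ∀ t ∈ Icc t₀ t₁, (∫ s in t₀..t, b s) + y t₀ = y t := fun t h => by rw [hy t h, add_comm]
  rw [e1 _ ⟨ht, le_rfl⟩, e1 _ ⟨le_rfl, ht⟩, e2 _ ⟨ht, le_rfl⟩, e2 _ ⟨le_rfl, ht⟩] at h1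
  rw [← h1]
  apply intervalIntegral.integral_congr_ae
  filter_upwards [ha.ae_hasDerivAt_integral, hb.ae_hasDerivAt_integral] with x k1 k2 k3
  have k4 := uIoc_subset_uIcc k3
  have k5 : x ∈ Icc t₀ t₁ := by rwa [uIcc_of_le ht] at k4
  rw [((k1 k4 t₀ left_mem_uIcc).add_const _).deriv, ((k2 k4 t₀ left_mem_uIcc).add_const _).deriv,
    e1 _ k5, e2 _ k5]

theorem ii_pi {n : ℕ} {t₀ t₁ : ℝ} {a : ℝ → Fin n → ℝ} (ha : IntervalIntegrable a volume t₀ t₁) (i : Fin n) :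
    IntervalIntegrable (fun s => a s i) volume t₀ t₁ :=
  ⟨(ContinuousLinearMap.proj (R := ℝ) (φ := fun _ : Fin n => ℝ) i).integrable_comp ha.1,
   (ContinuousLinearMap.proj (R := ℝ) (φ := fun _ : Fin n => ℝ) i).integrable_comp ha.2⟩

theorem int_pi {n : ℕ} {t₀ t₁ : ℝ} {a : ℝ → Fin n → ℝ} (ha : IntervalIntegrable a volume t₀ t₁) (i : Fin n) :
    (∫ s in t₀..t₁, a s) i = ∫ s in t₀..t₁, a s i :=
  ((ContinuousLinearMap.proj (R := ℝ) (φ := fun _ : Fin n => ℝ) i).intervalIntegral_comp_comm ha).symm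

theorem ibpv {n : ℕ} {t₀ t₁ : ℝ} (ht : t₀ ≤ t₁) {p y a b : ℝ → Fin n → ℝ} 
    (ha : IntegrableOn a (Icc t₀ t₁)) (hb : IntegrableOn b (Icc t₀ t₁))
    (hpc : ContinuousOn p (Icc t₀ t₁)) (hyc : ContinuousOn y (Icc t₀ t₁))
    (hp : ∀ t ∈ Icc t₀ t₁, p t = p t₀ + ∫ s in t₀..t, a s)
    (hy : ∀ t ∈ Icc t₀ t₁, y t = y t₀ + ∫ s in t₀..t, b s) :
    ∫ s in t₀..t₁, (a s ⬝ᵥ y s + p s ⬝ᵥ b s) = p t₁ ⬝ᵥ y t₁ - p t₀ ⬝ᵥ y t₀ := by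
  have ha' := ii_of_on ha (right_mem_Icc.2 ht)
  have hb' := ii_of_on hb (right_mem_Icc.2 ht)
  have hpc' : ContinuousOn p (uIcc t₀ t₁) := by rwa [uIcc_of_le ht]
  have hyc' : ContinuousOn y (uIcc t₀ t₁) := by rwa [uIcc_of_le ht]
  simp only [dotProduct, ← Finset.sum_add_distrib, ← Finset.sum_sub_distrib]
  rw [intervalIntegral.integral_finsetSum]
  · refine Finset.sum_congr rfl (fun i _ => ?_)
    refine ibp ht (p := fun s => p s i) (y := fun s => y s i) (ii_pi ha' i) (ii_pi hb' i) ?_ ?_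
    · intro t h
      rw [← int_pi (ii_of_on ha h), hp t h]; rfl
    · intro t h
      rw [← int_pi (ii_of_on hb h), hy t h]; rfl
  · intro i _
    refine ((ii_pi ha' i).mul_continuousOn ?_).add ((ii_pi hb' i).continuousOn_mul ?_)
    · exact (continuous_apply i).comp_continuousOn hyc'
    · exact (continuous_apply i).comp_continuousOn hpc'

/-- Transposition of linear maps as a linear map. -/
noncomputable def trp (n : ℕ) : ((Fin n → ℝ) →L[ℝ] (Fin n → ℝ)) →ₗ[ℝ] ((Fin n → ℝ) →L[ℝ] (Fin n → ℝ)) where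
  toFun A := LinearMap.toContinuousLinearMap 
    { toFun := fun p i => p ⬝ᵥ A (Pi.single i 1)
      map_add' := fun p q => by ext i; simp [add_dotProduct]
      map_smul' := fun c p => by ext i; simp }
  map_add' A B := by ext p i; simp [dotProduct_add]
  map_smul' c A := by ext p i; simp

theorem trp_apply {n : ℕ} (A : (Fin n → ℝ) →L[ℝ] (Fin n → ℝ)) (p : Fin n → ℝ) : 
  trp n A p = fun i => p ⬝ᵥ A (Pi.single i 1) := rfl

theorem trp_dot {n : ℕ} (A : (Fin n → ℝ) →L[ℝ] (Fin n → ℝ)) (p y : Fin n → ℝ) : 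
    trp n A p ⬝ᵥ y = p ⬝ᵥ A y := by
  rw [trp_apply]
  have : y = ∑ i, y i • (Pi.single i (1:ℝ) : Fin n → ℝ) := by
    ext j; simp [Finset.sum_apply, Pi.single_apply]
  conv_rhs => rw [this, map_sum, dotProduct_sum]
  simp only [dotProduct, map_smul, Pi.smul_apply, smul_eq_mul]
  refine Finset.sum_congr rfl (fun i _ => ?_)
  rw [Finset.sum_mul]
  exact Finset.sum_congr rfl (fun j _ => by ring)

theorem adjoint_exists {n : ℕ} {t₀ t₁ : ℝ} (ht : t₀ ≤ t₁) {A : ℝ → (Fin n → ℝ) →L[ℝ] (Fin n → ℝ)} {M : ℝ}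
    (hA : AEStronglyMeasurable A (volume.restrict (Icc t₀ t₁)))
    (hM : ∀ᵐ s ∂(volume.restrict (Icc t₀ t₁)), ‖A s‖ ≤ M) (p0 : Fin n → ℝ) :
    ∃ p : ℝ → Fin n → ℝ, ContinuousOn p (Icc t₀ t₁) ∧ p t₀ = p0 ∧
      IntegrableOn (fun s => (fun i => p s ⬝ᵥ A s (Pi.single i 1))) (Icc t₀ t₁) ∧
      (∀ t ∈ Icc t₀ t₁, p t = p t₀ - ∫ s in t₀..t, (fun i => p s ⬝ᵥ A s (Pi.single i 1))) ∧
      ∀ (y : C(Icc t₀ t₁, Fin n → ℝ)) (a : Fin n → ℝ) (ζ : ℝ → Fin n → ℝ), IntegrableOn ζ (Icc t₀ t₁) → 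
        y - prim t₀ t₁ (fun s => A s (ev ht y s)) = ContinuousMap.const _ a + prim t₀ t₁ ζ → 
        p t₁ ⬝ᵥ ev ht y t₁ - p0 ⬝ᵥ ev ht y t₀ = ∫ s in t₀..t₁, p s ⬝ᵥ ζ s := by
  obtain ⟨T, hT⟩ : ∃ T : ((Fin n → ℝ) →L[ℝ] (Fin n → ℝ)) →L[ℝ] ((Fin n → ℝ) →L[ℝ] (Fin n → ℝ)), 
      ∀ B, T B = trp n B := ⟨LinearMap.toContinuousLinearMap (trp n), fun _ => rfl⟩
  have hA' : AEStronglyMeasurable (fun s => - T (A s)) (volume.restrict (Icc t₀ t₁)) :=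
    (T.continuous.comp_aestronglyMeasurable hA).neg
  have hM' : ∀ᵐ s ∂(volume.restrict (Icc t₀ t₁)), ‖- T (A s)‖ ≤ ‖T‖ * M := by
    filter_upwards [hM] with s hs
    rw [norm_neg]
    exact T.le_of_opNorm_le_of_le le_rfl hs
  obtain ⟨q, hq, -⟩ := volt_solve ht hA' hM' (ContinuousMap.const _ p0)
  have hqc : ContinuousOn (ev ht q) (Icc t₀ t₁) := (ev_continuous ht q).continuousOn
  have hI := volt_integrable ht hA' hM' hqc
  have hqt : ∀ t ∈ Icc t₀ t₁, ev ht q t = p0 + ∫ s in t₀..t, (- T (A s)) (ev ht q s) := by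
    intro t h
    have := congrArg (fun z => z ⟨t, h⟩) hq
    simp only [ContinuousMap.sub_apply, ContinuousMap.const_apply, prim_apply ht hI] at this
    rw [ev_of_mem ht q h, ← this]; abel
  have hq0 : ev ht q t₀ = p0 := by
    rw [hqt t₀ (left_mem_Icc.2 ht)]; simp
  have hneg : (fun s => (fun i => ev ht q s ⬝ᵥ A s (Pi.single i 1))) = 
      fun s => - ((- T (A s)) (ev ht q s)) := by
    funext s
    rw [_root_.neg_apply, neg_neg, hT, trp_apply]
  refine ⟨ev ht q, hqc, hq0, ?_, ?_, ?_⟩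
  · rw [hneg]; exact hI.neg
  · intro t h
    rw [hneg, intervalIntegral.integral_neg, sub_neg_eq_add, hq0, ← hqt t h]
  · intro y a ζ hζ hy
    have hAy := volt_integrable ht hA hM (ev_continuous ht y).continuousOn
    have hyt : ∀ t ∈ Icc t₀ t₁, ev ht y t = a + ∫ s in t₀..t, (A s (ev ht y s) + ζ s) := by
      intro t h
      have := congrArg (fun z => z ⟨t, h⟩) hy
      simp only [ContinuousMap.sub_apply, ContinuousMap.add_apply, ContinuousMap.const_apply, prim_apply ht hAy,
        prim_apply ht hζ] at this
      rw [ev_of_mem ht y h, intervalIntegral.integral_add (ii_of_on hAy h) (ii_of_on hζ h), 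
        eq_add_of_sub_eq this]; abel
    have hy0 : ev ht y t₀ = a := by
      rw [hyt t₀ (left_mem_Icc.2 ht)]; simp
    have := ibpv ht hI (hAy.add hζ) hqc (ev_continuous ht y).continuousOn 
      (by rw [hq0]; exact hqt) (by rw [hy0]; exact hyt)
    rw [hq0] at this
    rw [← this]
    refine intervalIntegral.integral_congr (fun s _ => ?_)
    simp only [_root_.neg_apply, hT, neg_dotProduct, trp_dot, Pi.add_apply, dotProduct_add]
    ring

theorem sol_exists {E : Type*} [NormedAddCommGroup E] [NormedSpace ℝ E] [CompleteSpace E] {t₀ t₁ : ℝ} 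
    (ht : t₀ ≤ t₁) {A : ℝ → E →L[ℝ] E} {M : ℝ}
    (hA : AEStronglyMeasurable A (volume.restrict (Icc t₀ t₁)))
    (hM : ∀ᵐ s ∂(volume.restrict (Icc t₀ t₁)), ‖A s‖ ≤ M) :
    ∃ S : C(Icc t₀ t₁, E) →ₗ[ℝ] C(Icc t₀ t₁, E), ∀ b, 
      S b - prim t₀ t₁ (fun s => A s (ev ht (S b) s)) = b := by
  have hM' : ∀ᵐ s ∂(volume.restrict (Icc t₀ t₁)), ‖A s‖ ≤ |M| := by
    filter_upwards [hM] with s hs using hs.trans (le_abs_self M)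
  obtain ⟨u, hu⟩ := volt_isUnit ht (abs_nonneg M) hA hM'
  have key : ∀ y, y - prim t₀ t₁ (fun s => A s (ev ht y s)) = (u : _ →L[ℝ] _) y := by
    intro y; rw [hu]; rfl
  refine ⟨ContinuousLinearMap.toLinearMap (↑u⁻¹ : C(Icc t₀ t₁, E) →L[ℝ] C(Icc t₀ t₁, E)), fun b => ?_⟩
  rw [key]
  change (u : C(Icc t₀ t₁, E) →L[ℝ] C(Icc t₀ t₁, E)) ((↑u⁻¹ : C(Icc t₀ t₁, E) →L[ℝ] C(Icc t₀ t₁, E)) b) = b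
  rw [← mul_apply_eq_comp, Units.mul_inv]; rfl

end SOC

namespace SOC

theorem lin_dot {n : ℕ} (L : (Fin n → ℝ) →ₗ[ℝ] ℝ) (y : Fin n → ℝ) : 
    L y = (fun i => L (Pi.single i 1)) ⬝ᵥ y := by
  have : y = ∑ i, y i • (Pi.single i (1:ℝ) : Fin n → ℝ) := by
    ext j; simp [Finset.sum_apply, Pi.single_apply]
  conv_lhs => rw [this, map_sum]
  simp only [dotProduct, map_smul, smul_eq_mul]
  exact Finset.sum_congr rfl (fun j _ => by ring)

theorem prim_zero {E : Type*} [NormedAddCommGroup E] [NormedSpace ℝ E] {t₀ t₁ : ℝ} (ht : t₀ ≤ t₁) :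
    prim t₀ t₁ (fun _ => (0:E)) = 0 := by
  ext1 t
  rw [prim_apply (g := fun _ => (0:E)) ht (integrable_zero _ _ _)]; simp

theorem adj_mult {n : ℕ} {t₀ t₁ : ℝ} (ht : t₀ ≤ t₁) {A : ℝ → (Fin n → ℝ) →L[ℝ] (Fin n → ℝ)} {M : ℝ}
    (hA : AEStronglyMeasurable A (volume.restrict (Icc t₀ t₁)))
    (hM : ∀ᵐ s ∂(volume.restrict (Icc t₀ t₁)), ‖A s‖ ≤ M)
    (S : C(Icc t₀ t₁, Fin n → ℝ) →ₗ[ℝ] C(Icc t₀ t₁, Fin n → ℝ))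
    (hS : ∀ b, S b - prim t₀ t₁ (fun s => A s (ev ht (S b) s)) = b)
    (L : (Fin n → ℝ) × (Fin n → ℝ) →ₗ[ℝ] ℝ) 
    (hL : ∀ a, L (ends ht (S (ContinuousMap.const _ a))) = 0) :
    ∃ p : ℝ → Fin n → ℝ, ContinuousOn p (Icc t₀ t₁) ∧ 
      IntegrableOn (fun s => (fun i => p s ⬝ᵥ A s (Pi.single i 1))) (Icc t₀ t₁) ∧
      (∀ t ∈ Icc t₀ t₁, p t = p t₀ - ∫ s in t₀..t, (fun i => p s ⬝ᵥ A s (Pi.single i 1))) ∧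
      p t₀ = (fun i => L (Pi.single i 1, 0)) ∧ p t₁ = (fun i => - L (0, Pi.single i 1)) ∧ 
      ∀ (ζ : ℝ → Fin n → ℝ), IntegrableOn ζ (Icc t₀ t₁) → 
        L (ends ht (S (prim t₀ t₁ ζ))) = - ∫ s in t₀..t₁, p s ⬝ᵥ ζ s := by
  have hS0 : ∀ a ζ, IntegrableOn ζ (Icc t₀ t₁) → 
      ev ht (S (ContinuousMap.const _ a + prim t₀ t₁ ζ)) t₀ = a := by
    intro a ζ hζ
    have hAy := volt_integrable ht hA hM 
      (ev_continuous ht (S (ContinuousMap.const _ a + prim t₀ t₁ ζ))).continuousOn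
    have := congrArg (fun z => z ⟨t₀, left_mem_Icc.2 ht⟩) (hS (ContinuousMap.const _ a + prim t₀ t₁ ζ))
    simp only [ContinuousMap.sub_apply, ContinuousMap.add_apply, ContinuousMap.const_apply, prim_apply ht hAy,
        prim_apply ht hζ, intervalIntegral.integral_same, sub_zero, add_zero] at this
    rw [ev_of_mem ht _ (left_mem_Icc.2 ht), this]
  have hz : IntegrableOn (fun _ : ℝ => (0 : Fin n → ℝ)) (Icc t₀ t₁) := integrable_zero _ _ _
  have hS0' : ∀ a, ev ht (S (ContinuousMap.const _ a)) t₀ = a := by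
    intro a
    have := hS0 a _ hz
    rwa [prim_zero ht, add_zero] at this
  have hduo : ∀ (p : ℝ → Fin n → ℝ) (p0 : Fin n → ℝ), 
      (∀ (y : C(Icc t₀ t₁, Fin n → ℝ)) (a : Fin n → ℝ) (ζ : ℝ → Fin n → ℝ), IntegrableOn ζ (Icc t₀ t₁) → 
        y - prim t₀ t₁ (fun s => A s (ev ht y s)) = ContinuousMap.const _ a + prim t₀ t₁ ζ → 
        p t₁ ⬝ᵥ ev ht y t₁ - p0 ⬝ᵥ ev ht y t₀ = ∫ s in t₀..t₁, p s ⬝ᵥ ζ s) → 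
      ∀ a, p t₁ ⬝ᵥ ev ht (S (ContinuousMap.const _ a)) t₁ = p0 ⬝ᵥ a := by
    intro p p0 hp a
    have := hp (S (ContinuousMap.const _ a)) a _ hz (by rw [hS, prim_zero ht, add_zero])
    rw [hS0'] at this
    simpa [sub_eq_zero] using this
  obtain ⟨R, hR⟩ : ∃ R : (Fin n → ℝ) →ₗ[ℝ] (Fin n → ℝ), ∀ a, R a = ev ht (S (ContinuousMap.const _ a)) t₁ := by
    refine ⟨{ toFun := fun a => ev ht (S (ContinuousMap.const _ a)) t₁, map_add' := ?_, map_smul' := ?_ }, 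
      fun _ => rfl⟩
    · intro a b
      rw [show ContinuousMap.const (Icc t₀ t₁) (a + b) = ContinuousMap.const _ a + ContinuousMap.const _ b from rfl, 
        map_add]; rfl
    · intro c b
      rw [show ContinuousMap.const (Icc t₀ t₁) (c • b) = c • ContinuousMap.const _ b from rfl, 
        map_smul]; rfl
  have hRinj : Function.Injective R := by
    rw [← LinearMap.ker_eq_bot, LinearMap.ker_eq_bot']
    intro a ha
    obtain ⟨p, -, -, -, -, hp⟩ := adjoint_exists ht hA hM a
    have := hduo p a hp a
    rw [← hR, ha, dotProduct_zero] at this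
    exact dotProduct_self_eq_zero.1 this.symm
  have hRs : Function.Surjective R := LinearMap.injective_iff_surjective.1 hRinj
  obtain ⟨L1, hL1⟩ : ∃ L1 : (Fin n → ℝ) →ₗ[ℝ] ℝ, ∀ a, L1 a = L (a, 0) := 
    ⟨L.comp (LinearMap.inl ℝ _ _), fun _ => rfl⟩
  obtain ⟨L2, hL2⟩ : ∃ L2 : (Fin n → ℝ) →ₗ[ℝ] ℝ, ∀ a, L2 a = L (0, a) := 
    ⟨L.comp (LinearMap.inr ℝ _ _), fun _ => rfl⟩
  have hLs : ∀ a b, L (a, b) = L1 a + L2 b := by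
    intro a b
    rw [hL1, hL2, ← map_add]; simp
  obtain ⟨p, pc, p0, pI, pO, hp⟩ := adjoint_exists ht hA hM (fun i => L1 (Pi.single i 1))
  have hp1 : p t₁ = (fun i => - L2 (Pi.single i 1)) := by
    funext i
    obtain ⟨a, ha⟩ := hRs (Pi.single i 1)
    have h1 := hduo p _ hp a
    have h2 := hL a
    rw [ends_apply, hS0', ← hR, hLs, ha] at h2
    rw [← lin_dot, ← hR, ha, dotProduct_single_one] at h1
    linarith
  refine ⟨p, pc, pI, pO, ?_, ?_, ?_⟩
  · simp only [p0, hL1]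
  · simp only [hp1, hL2]
  · intro ζ hζ
    have hc0 : ContinuousMap.const (Icc t₀ t₁) (0 : Fin n → ℝ) = 0 := rfl
    have h1 := hS0 0 ζ hζ
    have h2 := hp (S (prim t₀ t₁ ζ)) 0 ζ hζ (by rw [hS, hc0, zero_add])
    rw [hc0, zero_add] at h1
    rw [h1, dotProduct_zero, sub_zero] at h2
    rw [ends_apply, h1, hLs, map_zero, zero_add, lin_dot L2, ← h2, hp1]
    simp [dotProduct]

section
variable {n r : ℕ} {U : Set (Fin r → ℝ)} {φ : ℝ × (Fin n → ℝ) × (Fin r → ℝ) → Fin n → ℝ}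
variable {t₀ t₁ : ℝ} {xh h : ℝ → Fin n → ℝ} {uh v : ℝ → Fin r → ℝ}

theorem dot_int {p ζ : ℝ → Fin n → ℝ} (hp : ContinuousOn p (Icc t₀ t₁)) 
    (hζ : IntegrableOn ζ (Icc t₀ t₁)) : IntegrableOn (fun s => p s ⬝ᵥ ζ s) (Icc t₀ t₁) := by
  simp only [dotProduct]
  refine integrable_finsetSum _ (fun i _ => ?_)
  have h1 : IntegrableOn (fun s => ζ s i) (Icc t₀ t₁) := 
    (ContinuousLinearMap.proj (R := ℝ) (φ := fun _ : Fin n => ℝ) i).integrable_comp hζ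
  exact h1.continuousOn_mul ((continuous_apply i).comp_continuousOn hp) isCompact_Icc

theorem Proc.maxcond (P : Proc U φ t₀ t₁ xh h uh v) {p : ℝ → Fin n → ℝ} (hp : ContinuousOn p (Icc t₀ t₁))
    (H : ∀ K : Set ℝ, MeasurableSet K → ∀ ub ∈ U, ∫ s in t₀..t₁, p s ⬝ᵥ ZZ φ xh uh K ub s ≤ 0) :
    ∀ᵐ t ∂(volume.restrict (Icc t₀ t₁)), ∀ u ∈ U, p t ⬝ᵥ φ (t, xh t, u) ≤ p t ⬝ᵥ φ (t, xh t, uh t) := by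
  obtain ⟨s, hsc, hsd⟩ := TopologicalSpace.exists_countable_dense U
  have h1 : ∀ u ∈ U, ∀ᵐ t ∂(volume.restrict (Icc t₀ t₁)), 
      p t ⬝ᵥ φ (t, xh t, u) ≤ p t ⬝ᵥ φ (t, xh t, uh t) := by
    intro u hu
    have hI := dot_int hp (P.Z_int (K := univ) MeasurableSet.univ hu)
    have h2 : 0 ≤ᵐ[volume.restrict (Icc t₀ t₁)] fun s => - (p s ⬝ᵥ ZZ φ xh uh univ u s) := by
      refine ae_nonneg_of_forall_setIntegral_nonneg hI.neg (fun K hK _ => ?_)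
      have h3 := H K hK u hu
      rw [intervalIntegral.integral_of_le P.ht.le, ← integral_Icc_eq_integral_Ioc] at h3
      have h4 : (fun s => p s ⬝ᵥ ZZ φ xh uh K u s) = K.indicator (fun s => p s ⬝ᵥ ZZ φ xh uh univ u s) := by
        funext s
        by_cases hs : s ∈ K
        · rw [indicator_of_mem hs]; simp only [ZZ, indicator_of_mem hs, indicator_univ]
        · rw [indicator_of_notMem hs]; simp only [ZZ, indicator_of_notMem hs, dotProduct_zero]
      rw [h4, MeasureTheory.integral_indicator hK] at h3
      rw [MeasureTheory.integral_neg]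
      linarith
    filter_upwards [h2] with t ht
    simp only [Pi.zero_apply, ZZ, indicator_univ, dotProduct_sub] at ht
    linarith
  have h2 : ∀ᵐ t ∂(volume.restrict (Icc t₀ t₁)), ∀ u ∈ s, 
      p t ⬝ᵥ φ (t, xh t, u) ≤ p t ⬝ᵥ φ (t, xh t, uh t) := 
    (ae_ball_iff hsc).2 (fun u _ => h1 u u.2)
  filter_upwards [h2] with t ht u hu
  have hcl : IsClosed {w : U | p t ⬝ᵥ φ (t, xh t, w) ≤ p t ⬝ᵥ φ (t, xh t, uh t)} := by
    refine isClosed_le ?_ continuous_const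
    have hc : Continuous (fun w : U => φ (t, xh t, w)) :=
      P.sm.c0.comp_continuous (f := fun w : U => ((t, xh t, (w : Fin r → ℝ)) : ℝ × (Fin n → ℝ) × (Fin r → ℝ))) 
        (by fun_prop) (fun w => w.2)
    exact continuous_const.dotProduct hc
  have := hcl.closure_subset_iff.2 (fun w hw => ht w hw)
  rw [hsd.closure_eq] at this
  exact this (mem_univ (⟨u, hu⟩ : U))

end
end SOC

namespace SOC
section
variable {n r : ℕ} {U : Set (Fin r → ℝ)} {φ : ℝ × (Fin n → ℝ) × (Fin r → ℝ) → Fin n → ℝ}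
variable {t₀ t₁ : ℝ} {xh h : ℝ → Fin n → ℝ} {uh v : ℝ → Fin r → ℝ}

theorem lin_split {m₁ m₂ : ℕ} (l : ℝ × (Fin m₁ → ℝ) × (Fin m₂ → ℝ) →ₗ[ℝ] ℝ) (a : ℝ) (b : Fin m₁ → ℝ) (c : Fin m₂ → ℝ) :
    l (a, b, c) = l (1, 0, 0) * a + (fun i => l (0, Pi.single i 1, 0)) ⬝ᵥ b + 
      (fun i => l (0, 0, Pi.single i 1)) ⬝ᵥ c := by
  have h1 := lin_dot (l.comp (LinearMap.inr ℝ ℝ _ ∘ₗ LinearMap.inl ℝ _ _)) b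
  have h2 := lin_dot (l.comp (LinearMap.inr ℝ ℝ _ ∘ₗ LinearMap.inr ℝ _ _)) c
  have h3 : l (a, 0, 0) = l (1, 0, 0) * a := by
    have : ((a, 0, 0) : ℝ × (Fin m₁ → ℝ) × (Fin m₂ → ℝ)) = a • (1, 0, 0) := by simp
    rw [this, map_smul, smul_eq_mul, mul_comm]
  have h4 : l (a, b, c) = l (a, 0, 0) + l (0, b, 0) + l (0, 0, c) := by
    rw [← map_add, ← map_add]; simp
  rw [h4, h3]
  exact congrArg₂ (· + ·) (congrArg₂ (· + ·) rfl h1) h2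

theorem Proc.mult (P : Proc U φ t₀ t₁ xh h uh v) {m₁ m₂ : ℕ}
    (hodeint : IntervalIntegrable (fun s => φ (s, xh s, uh s)) volume t₀ t₁)
    (hode : ∀ t ∈ Icc t₀ t₁, xh t = xh t₀ + ∫ s in t₀..t, φ (s, xh s, uh s))
    (hlinint : IntervalIntegrable (fun s => fderiv ℝ (Fs φ s) (xh s, uh s) (h s, v s)) volume t₀ t₁)
    (hlin : ∀ t ∈ Icc t₀ t₁, h t = h t₀ + ∫ s in t₀..t, fderiv ℝ (Fs φ s) (xh s, uh s) (h s, v s))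
    {f₀ : (Fin n → ℝ) × (Fin n → ℝ) → ℝ} {f : (Fin n → ℝ) × (Fin n → ℝ) → Fin m₁ → ℝ}
    {g : (Fin n → ℝ) × (Fin n → ℝ) → Fin m₂ → ℝ} 
    (hf₀ : ContDiff ℝ 2 f₀) (hf : ContDiff ℝ 2 f) (hg : ContDiff ℝ 2 g)
    (hbf : ∀ i, f (xh t₀, xh t₁) i ≤ 0)
    (hbg : g (xh t₀, xh t₁) = 0) 
    (hmin : ∃ δ > (0:ℝ), ∀ (x : ℝ → Fin n → ℝ) (u : ℝ → Fin r → ℝ),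
      ContinuousOn x (Icc t₀ t₁) → Measurable u →
      (∃ Kc : Set (Fin r → ℝ), IsCompact Kc ∧ Kc ⊆ U ∧
        ∀ᵐ t ∂(volume.restrict (Icc t₀ t₁)), u t ∈ Kc) →
      IntervalIntegrable (fun s => φ (s, x s, u s)) volume t₀ t₁ →
      (∀ t ∈ Icc t₀ t₁, x t = x t₀ + ∫ s in t₀..t, φ (s, x s, u s)) →
      (∀ i, f (x t₀, x t₁) i ≤ 0) → g (x t₀, x t₁) = 0 →
      (∀ t ∈ Icc t₀ t₁, ‖x t - xh t‖ < δ) →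
      f₀ (xh t₀, xh t₁) ≤ f₀ (x t₀, x t₁))
    (hqf₀ : fderiv ℝ f₀ (xh t₀, xh t₁) (h t₀, h t₁) ≤ 0)
    (hqf : ∀ i, fderiv ℝ f (xh t₀, xh t₁) (h t₀, h t₁) i ≤ 0)
    (hqg : fderiv ℝ g (xh t₀, xh t₁) (h t₀, h t₁) = 0) :
    ∃ (l₀ : ℝ) (l₁ : Fin m₁ → ℝ) (l₂ : Fin m₂ → ℝ) (p : ℝ → Fin n → ℝ),
      0 ≤ l₀ ∧ (∀ i, 0 ≤ l₁ i) ∧ ¬ (l₀ = 0 ∧ l₁ = 0 ∧ l₂ = 0) ∧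
      ContinuousOn p (Icc t₀ t₁) ∧
      IntervalIntegrable (fun s => (fun i => p s ⬝ᵥ
          fderiv ℝ (Fs φ s) (xh s, uh s) (Pi.single i 1, 0))) volume t₀ t₁ ∧
      (∀ t ∈ Icc t₀ t₁, p t = p t₀ - ∫ s in t₀..t, (fun i => p s ⬝ᵥ
          fderiv ℝ (Fs φ s) (xh s, uh s) (Pi.single i 1, 0))) ∧
      p t₀ = (fun i => l₀ * fderiv ℝ f₀ (xh t₀, xh t₁) (Pi.single i 1, 0)
                     + l₁ ⬝ᵥ fderiv ℝ f (xh t₀, xh t₁) (Pi.single i 1, 0)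
                     + l₂ ⬝ᵥ fderiv ℝ g (xh t₀, xh t₁) (Pi.single i 1, 0)) ∧
      p t₁ = (fun i => -(l₀ * fderiv ℝ f₀ (xh t₀, xh t₁) (0, Pi.single i 1))
                     - l₁ ⬝ᵥ fderiv ℝ f (xh t₀, xh t₁) (0, Pi.single i 1)
                     - l₂ ⬝ᵥ fderiv ℝ g (xh t₀, xh t₁) (0, Pi.single i 1)) ∧
      (∀ᵐ t ∂(volume.restrict (Icc t₀ t₁)), ∀ u ∈ U,
        p t ⬝ᵥ φ (t, xh t, u) ≤ p t ⬝ᵥ φ (t, xh t, uh t)) ∧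
      l₁ ⬝ᵥ f (xh t₀, xh t₁) = 0 ∧
      0 ≤ -(∫ t in t₀..t₁, p t ⬝ᵥ
              (fderiv ℝ (fderiv ℝ (Fs φ t)) (xh t, uh t) (h t, v t) (h t, v t)))
          + l₀ * fderiv ℝ (fderiv ℝ f₀) (xh t₀, xh t₁) (h t₀, h t₁) (h t₀, h t₁)
          + l₁ ⬝ᵥ fderiv ℝ (fderiv ℝ f) (xh t₀, xh t₁) (h t₀, h t₁) (h t₀, h t₁)
          + l₂ ⬝ᵥ fderiv ℝ (fderiv ℝ g) (xh t₀, xh t₁) (h t₀, h t₁) (h t₀, h t₁) := by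
  obtain ⟨M, hM⟩ := P.A_bd
  have hA := P.A_meas
  obtain ⟨S, hS⟩ := sol_exists P.ht.le hA hM
  obtain ⟨b0, hb0⟩ : ∃ b0, b0 = fderiv ℝ (fderiv ℝ f₀) (xh t₀, xh t₁) (h t₀, h t₁) (h t₀, h t₁) := ⟨_, rfl⟩
  obtain ⟨b1, hb1⟩ : ∃ b1, b1 = fderiv ℝ (fderiv ℝ f) (xh t₀, xh t₁) (h t₀, h t₁) (h t₀, h t₁) := ⟨_, rfl⟩
  obtain ⟨b2, hb2⟩ : ∃ b2, b2 = fderiv ℝ (fderiv ℝ g) (xh t₀, xh t₁) (h t₀, h t₁) (h t₀, h t₁) := ⟨_, rfl⟩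
  obtain ⟨d0, hd0⟩ : ∃ d0, d0 = fderiv ℝ f₀ (xh t₀, xh t₁) := ⟨_, rfl⟩
  obtain ⟨d1, hd1⟩ : ∃ d1, d1 = fderiv ℝ f (xh t₀, xh t₁) := ⟨_, rfl⟩
  obtain ⟨d2, hd2⟩ : ∃ d2, d2 = fderiv ℝ g (xh t₀, xh t₁) := ⟨_, rfl⟩
  obtain ⟨Γ, hΓ⟩ : ∃ Γ : C(Icc t₀ t₁, Fin n → ℝ) →ₗ[ℝ] ℝ × (Fin m₁ → ℝ) × (Fin m₂ → ℝ), 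
      ∀ y, Γ y = (d0 (ends P.ht.le (S y)), d1 (ends P.ht.le (S y)), d2 (ends P.ht.le (S y))) := 
    ⟨((d0.prod (d1.prod d2)).comp (ends P.ht.le)).toLinearMap ∘ₗ S, fun _ => rfl⟩
  obtain ⟨cc, hcc⟩ : ∃ cc : (Fin n → ℝ) →ₗ[ℝ] C(Icc t₀ t₁, Fin n → ℝ), ∀ a, cc a = ContinuousMap.const _ a :=
    ⟨{ toFun := fun a => ContinuousMap.const _ a, map_add' := fun _ _ => rfl, map_smul' := fun _ _ => rfl }, 
      fun _ => rfl⟩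
  have alt := cone_alt (κ := {k : Set ℝ × (Fin r → ℝ) // MeasurableSet k.1 ∧ k.2 ∈ U}) (Γ ∘ₗ cc) 
    (fun k => Γ (prim t₀ t₁ (ZZ φ xh uh k.1.1 k.1.2))) 
    ((1/2:ℝ) • (b0, b1, b2) + Γ (prim t₀ t₁ (BB φ xh h uh v)))
    (Sg := {s | 0 < s.1 ∧ (∀ i, f (xh t₀, xh t₁) i = 0 → 0 < s.2.1 i) ∧ s.2.2 = 0}) ?_ ?_ ?_
    (LinearMap.snd ℝ _ _ ∘ₗ LinearMap.snd ℝ _ _) ?_ ?_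
  rotate_left
  · intro x hx y hy a b ha hb hab
    obtain ⟨x1, x2, x3⟩ := hx
    obtain ⟨y1, y2, y3⟩ := hy
    have key : ∀ p q : ℝ, 0 < p → 0 < q → 0 < a * p + b * q := by
      intro p q hp hq
      rcases ha.lt_or_eq with h | h
      · have := mul_pos h hp; have := mul_nonneg hb hq.le; linarith
      · have : b = 1 := by linarith
        rw [← h, this]; linarith
    refine ⟨key _ _ x1 y1, fun i hi => key _ _ (x2 i hi) (y2 i hi), ?_⟩
    simp [x3, y3]
  · exact ⟨(1, 1, 0), by simp⟩
  · rintro s ⟨s1, s2, s3⟩ t ht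
    refine ⟨mul_pos ht s1, fun i hi => mul_pos ht (s2 i hi), ?_⟩
    simp [s3]
  · intro w; exact ⟨(0, 0, w), rfl⟩
  · intro s hs; exact hs.2.2
  rcases alt with ⟨l, hl0, hlD, hle, hls, hlc⟩ | ⟨N, k, a, α, s, hα, hs, heq, hsurj⟩
  · -- multipliers
    obtain ⟨L, hL⟩ : ∃ L : (Fin n → ℝ) × (Fin n → ℝ) →ₗ[ℝ] ℝ, ∀ w, L w = l (d0 w, d1 w, d2 w) :=
      ⟨l ∘ₗ (d0.prod (d1.prod d2)).toLinearMap, fun _ => rfl⟩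
    have hΓL : ∀ y, l (Γ y) = L (ends P.ht.le (S y)) := fun y => by rw [hL, hΓ]
    obtain ⟨p, pc, pI, pO, p0, p1, hpζ⟩ := adj_mult P.ht.le hA hM S hS L (by
      intro a
      rw [← hΓL, ← hcc]; exact hlD a)
    obtain ⟨l₀, hl₀⟩ : ∃ l₀, l₀ = l (1, 0, 0) := ⟨_, rfl⟩
    obtain ⟨l₁, hl₁⟩ : ∃ l₁ : Fin m₁ → ℝ, l₁ = fun i => l (0, Pi.single i 1, 0) := ⟨_, rfl⟩
    obtain ⟨l₂, hl₂⟩ : ∃ l₂ : Fin m₂ → ℝ, l₂ = fun i => l (0, 0, Pi.single i 1) := ⟨_, rfl⟩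
    have hsp : ∀ a b c, l (a, b, c) = l₀ * a + l₁ ⬝ᵥ b + l₂ ⬝ᵥ c := by
      intro a b c
      rw [lin_split l a b c, hl₀, hl₁, hl₂]
    -- signs
    have hsg : ∀ (a : ℝ) (b : Fin m₁ → ℝ), 0 < a → (∀ i, f (xh t₀, xh t₁) i = 0 → 0 < b i) → 
        0 ≤ l₀ * a + l₁ ⬝ᵥ b := by
      intro a b ha hb
      have := hls (a, b, 0) ⟨ha, hb, rfl⟩
      rw [hsp] at this
      simpa using this
    have hsg' : ∀ (a : ℝ) (b : Fin m₁ → ℝ), 0 ≤ a → (∀ i, f (xh t₀, xh t₁) i = 0 → 0 ≤ b i) → 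
        0 ≤ l₀ * a + l₁ ⬝ᵥ b := by
      intro a b ha hb
      have hev : ∀ ε : ℝ, 0 < ε → 0 ≤ (l₀ * a + l₁ ⬝ᵥ b) + ε * (l₀ + l₁ ⬝ᵥ 1) := by
        intro ε hε
        have := hsg (a + ε) (b + ε • 1) (by linarith) (fun i hi => by
          have := hb i hi
          simp only [Pi.add_apply, Pi.smul_apply, Pi.one_apply, smul_eq_mul, mul_one]; linarith)
        rw [dotProduct_add, dotProduct_smul, smul_eq_mul] at this
        linarith
      have ht : Tendsto (fun ε : ℝ => (l₀ * a + l₁ ⬝ᵥ b) + ε * (l₀ + l₁ ⬝ᵥ 1)) (𝓝[>] 0) 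
          (𝓝 ((l₀ * a + l₁ ⬝ᵥ b) + 0 * (l₀ + l₁ ⬝ᵥ 1))) := by
        refine Tendsto.mono_left (Continuous.tendsto ?_ 0) nhdsWithin_le_nhds
        fun_prop
      rw [zero_mul, add_zero] at ht
      exact ge_of_tendsto ht (by filter_upwards [self_mem_nhdsWithin] with ε hε using hev ε hε)
    have hl₀p : 0 ≤ l₀ := by simpa using hsg' 1 0 zero_le_one (by simp)
    have hl₁p : ∀ i, 0 ≤ l₁ i := by
      intro i
      have := hsg' 0 (Pi.single i 1) le_rfl (fun j _ => by
        by_cases hij : j = i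
        · subst hij; simp
        · simp [hij])
      simpa using this
    have hl₁s : ∀ i, f (xh t₀, xh t₁) i ≠ 0 → l₁ i = 0 := by
      intro i hi
      refine le_antisymm ?_ (hl₁p i)
      have := hsg' 0 (Pi.single i (-1)) le_rfl (fun j hj => by
        have hij : j ≠ i := by rintro rfl; exact hi hj
        simp [hij])
      simpa using this
    refine ⟨l₀, l₁, l₂, p, hl₀p, hl₁p, ?_, pc, ?_, pO, ?_, ?_, ?_, ?_, ?_⟩
    · rintro ⟨e0, e1, e2⟩
      apply hl0
      refine LinearMap.ext (fun w => ?_)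
      obtain ⟨a, b, c⟩ := w
      rw [hsp, e0, e1, e2]; simp
    · exact ii_of_on pI (right_mem_Icc.2 P.ht.le)
    · rw [p0]; funext i; rw [hL, hsp, hd0, hd1, hd2]
    · rw [p1]; funext i; rw [hL, hsp, hd0, hd1, hd2]; ring
    · refine P.maxcond pc (fun K hK ub hub => ?_)
      have h1 := hle ⟨(K, ub), hK, hub⟩
      rw [hΓL, hpζ _ (P.Z_int hK hub)] at h1
      linarith
    · refine Finset.sum_eq_zero (fun i _ => ?_)
      by_cases hi : f (xh t₀, xh t₁) i = 0
      · rw [hi, mul_zero]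
      · rw [hl₁s i hi, zero_mul]
    · rw [map_add, map_smul, hsp, hΓL, hpζ _ P.B_int] at hlc
      have h1 : ∫ s in t₀..t₁, p s ⬝ᵥ BB φ xh h uh v s = (1/2:ℝ) * ∫ t in t₀..t₁, p t ⬝ᵥ
              (fderiv ℝ (fderiv ℝ (Fs φ t)) (xh t, uh t) (h t, v t) (h t, v t)) := by
        rw [← intervalIntegral.integral_const_mul]
        refine intervalIntegral.integral_congr (fun s _ => ?_)
        simp only [BB, dotProduct_smul, smul_eq_mul]
      rw [h1, smul_eq_mul] at hlc
      rw [← hb0, ← hb1, ← hb2]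
      linarith
  · -- contradiction
    exfalso
    obtain ⟨s1, s2, s3⟩ := hs
    obtain ⟨b, hb⟩ : ∃ b : C(Icc t₀ t₁, Fin n → ℝ), b = prim t₀ t₁ (BB φ xh h uh v) + cc a + 
      ∑ j, α j • prim t₀ t₁ (ZZ φ xh uh (k j).1.1 (k j).1.2) := ⟨_, rfl⟩
    have hΓb : (1/2:ℝ) • (b0, b1, b2) + Γ b + s = 0 := by
      rw [← heq, hb, map_add, map_add, map_sum]
      simp only [map_smul, LinearMap.comp_apply]
      abel
    rw [hΓ] at hΓb
    have g1 := congrArg (fun z => z.1) hΓb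
    have g2 := congrArg (fun z => z.2.1) hΓb
    have g3 := congrArg (fun z => z.2.2) hΓb
    simp only [Prod.fst_add, Prod.snd_add, Prod.smul_fst, Prod.smul_snd, Prod.fst_zero, Prod.snd_zero, 
      smul_eq_mul] at g1 g2 g3
    refine P.caseB hodeint hode hlinint hlin hf₀ hf hg hbf hbg hmin hqf₀ hqf hqg 
      (K := fun j => (k j).1.1) (ub := fun j => (k j).1.2) (fun j => (k j).2.1) (fun j => (k j).2.2)
      (S b) a α hα ?_ ?_ ?_ ?_ ?_
    · have := hS b
      rw [sub_right_comm (S b) (ContinuousMap.const _ a), this, hb, hcc]; abel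
    · rw [← hb0, ← hd0]; linarith
    · intro i hi
      have g4 := congrFun g2 i
      have := s2 i hi
      rw [← hb1, ← hd1]
      simp only [Pi.add_apply, Pi.smul_apply, smul_eq_mul, Pi.zero_apply] at g4
      linarith
    · rw [← hb2, ← hd2]
      rw [s3, add_zero] at g3
      rw [add_comm]; exact g3
    · intro w
      obtain ⟨a', α', h'⟩ := hsurj w
      refine ⟨S (cc a' + ∑ j, α' j • prim t₀ t₁ (ZZ φ xh uh (k j).1.1 (k j).1.2)), a', α', ?_, ?_⟩
      · have := hS (cc a' + ∑ j, α' j • prim t₀ t₁ (ZZ φ xh uh (k j).1.1 (k j).1.2))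
        rw [sub_right_comm (S _) (ContinuousMap.const _ a'), this, hcc]; abel
      · rw [← hd2, ← h']
        have : (Γ ∘ₗ cc) a' + ∑ j, α' j • Γ (prim t₀ t₁ (ZZ φ xh uh (k j).1.1 (k j).1.2)) = 
            Γ (cc a' + ∑ j, α' j • prim t₀ t₁ (ZZ φ xh uh (k j).1.1 (k j).1.2)) := by
          rw [map_add, map_sum]; simp only [map_smul, LinearMap.comp_apply]
        rw [this, hΓ]; rfl

end
end SOC

/-- **Corollary 2 (second-order necessary conditions for a strong minimum in the optimal
control problem).**  If `(xh,uh)` is a strong minimum point of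
`f₀(x(t₀),x(t₁)) → min`, `ẋ = φ(t,x,u)`, `u(t) ∈ U` a.e., `f(x(t₀),x(t₁)) ≤ 0`,
`g(x(t₀),x(t₁)) = 0`, then for any `q = (h,v) ∈ K₀(xh,uh)` there exist a nonzero tuple
`(λ₀,λ₁,λ₂) ∈ ℝ₊ × (ℝ^{m₁})*₊ × (ℝ^{m₂})*` and `p ∈ AC([t₀,t₁],(ℝⁿ)*)` satisfying the
adjoint equation with transversality, the maximum condition, complementary slackness and the
second-order inequality; moreover if `Λ(xh,uh,q) = ∅` then every such tuple has `λ₀ ≠ 0`. -/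
theorem ode_second_order_necessary_conditions
    {n r m₁ m₂ : ℕ} (t₀ t₁ : ℝ) (ht : t₀ < t₁)
    (U : Set (Fin r → ℝ)) (hU : IsOpen U)
    (φ : ℝ × (Fin n → ℝ) × (Fin r → ℝ) → Fin n → ℝ)
    (f₀ : (Fin n → ℝ) × (Fin n → ℝ) → ℝ)
    (f : (Fin n → ℝ) × (Fin n → ℝ) → Fin m₁ → ℝ)
    (g : (Fin n → ℝ) × (Fin n → ℝ) → Fin m₂ → ℝ)
    -- smoothness of the data
    (hφc : ContinuousOn φ {p : ℝ × (Fin n → ℝ) × (Fin r → ℝ) | p.2.2 ∈ U})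
    (hφ2 : ∀ t : ℝ, ContDiffOn ℝ 2
      (fun w : (Fin n → ℝ) × (Fin r → ℝ) => φ (t, w.1, w.2)) (univ ×ˢ U))
    (hφ'c : ContinuousOn (fun p : ℝ × (Fin n → ℝ) × (Fin r → ℝ) =>
        fderiv ℝ (fun w : (Fin n → ℝ) × (Fin r → ℝ) => φ (p.1, w.1, w.2)) (p.2.1, p.2.2))
      {p : ℝ × (Fin n → ℝ) × (Fin r → ℝ) | p.2.2 ∈ U})
    (hφ''c : ContinuousOn (fun p : ℝ × (Fin n → ℝ) × (Fin r → ℝ) =>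
        fderiv ℝ (fderiv ℝ (fun w : (Fin n → ℝ) × (Fin r → ℝ) => φ (p.1, w.1, w.2)))
          (p.2.1, p.2.2))
      {p : ℝ × (Fin n → ℝ) × (Fin r → ℝ) | p.2.2 ∈ U})
    (hf₀ : ContDiff ℝ 2 f₀) (hf : ContDiff ℝ 2 f) (hg : ContDiff ℝ 2 g)
    -- (xh, uh) is an admissible process (with a regular control uh)
    (xh : ℝ → Fin n → ℝ) (uh : ℝ → Fin r → ℝ)
    (hxc : ContinuousOn xh (Icc t₀ t₁))
    (humeas : Measurable uh)
    (hreg : ∃ Kc : Set (Fin r → ℝ), IsCompact Kc ∧ Kc ⊆ U ∧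
      ∀ᵐ t ∂(volume.restrict (Icc t₀ t₁)), uh t ∈ Kc)
    (hodeint : IntervalIntegrable (fun s => φ (s, xh s, uh s)) volume t₀ t₁)
    (hode : ∀ t ∈ Icc t₀ t₁, xh t = xh t₀ + ∫ s in t₀..t, φ (s, xh s, uh s))
    (hbf : ∀ i, f (xh t₀, xh t₁) i ≤ 0)
    (hbg : g (xh t₀, xh t₁) = 0)
    -- (xh, uh) is a strong minimum point
    (hmin : ∃ δ > (0:ℝ), ∀ (x : ℝ → Fin n → ℝ) (u : ℝ → Fin r → ℝ),
      ContinuousOn x (Icc t₀ t₁) → Measurable u →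
      (∃ Kc : Set (Fin r → ℝ), IsCompact Kc ∧ Kc ⊆ U ∧
        ∀ᵐ t ∂(volume.restrict (Icc t₀ t₁)), u t ∈ Kc) →
      IntervalIntegrable (fun s => φ (s, x s, u s)) volume t₀ t₁ →
      (∀ t ∈ Icc t₀ t₁, x t = x t₀ + ∫ s in t₀..t, φ (s, x s, u s)) →
      (∀ i, f (x t₀, x t₁) i ≤ 0) → g (x t₀, x t₁) = 0 →
      (∀ t ∈ Icc t₀ t₁, ‖x t - xh t‖ < δ) →
      f₀ (xh t₀, xh t₁) ≤ f₀ (x t₀, x t₁))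
    -- q = (h, v) ∈ K₀(xh, uh)
    (h : ℝ → Fin n → ℝ) (v : ℝ → Fin r → ℝ)
    (hhc : ContinuousOn h (Icc t₀ t₁))
    (hvmeas : Measurable v)
    (hvbd : ∃ C : ℝ, ∀ᵐ t ∂(volume.restrict (Icc t₀ t₁)), ‖v t‖ ≤ C)
    (hlinint : IntervalIntegrable (fun s =>
        fderiv ℝ (fun w : (Fin n → ℝ) × (Fin r → ℝ) => φ (s, w.1, w.2)) (xh s, uh s)
          (h s, v s)) volume t₀ t₁)
    (hlin : ∀ t ∈ Icc t₀ t₁, h t = h t₀ + ∫ s in t₀..t,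
        fderiv ℝ (fun w : (Fin n → ℝ) × (Fin r → ℝ) => φ (s, w.1, w.2)) (xh s, uh s)
          (h s, v s))
    (hqf₀ : fderiv ℝ f₀ (xh t₀, xh t₁) (h t₀, h t₁) ≤ 0)
    (hqf : ∀ i, fderiv ℝ f (xh t₀, xh t₁) (h t₀, h t₁) i ≤ 0)
    (hqg : fderiv ℝ g (xh t₀, xh t₁) (h t₀, h t₁) = 0) :
    -- conclusion
    (∃ (l₀ : ℝ) (l₁ : Fin m₁ → ℝ) (l₂ : Fin m₂ → ℝ) (p : ℝ → Fin n → ℝ),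
      0 ≤ l₀ ∧ (∀ i, 0 ≤ l₁ i) ∧ ¬ (l₀ = 0 ∧ l₁ = 0 ∧ l₂ = 0) ∧
      ContinuousOn p (Icc t₀ t₁) ∧
      IntervalIntegrable (fun s => (fun i => p s ⬝ᵥ
          fderiv ℝ (fun w : (Fin n → ℝ) × (Fin r → ℝ) => φ (s, w.1, w.2)) (xh s, uh s)
            (Pi.single i 1, 0))) volume t₀ t₁ ∧
      (∀ t ∈ Icc t₀ t₁, p t = p t₀ - ∫ s in t₀..t, (fun i => p s ⬝ᵥ
          fderiv ℝ (fun w : (Fin n → ℝ) × (Fin r → ℝ) => φ (s, w.1, w.2)) (xh s, uh s)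
            (Pi.single i 1, 0))) ∧
      p t₀ = (fun i => l₀ * fderiv ℝ f₀ (xh t₀, xh t₁) (Pi.single i 1, 0)
                     + l₁ ⬝ᵥ fderiv ℝ f (xh t₀, xh t₁) (Pi.single i 1, 0)
                     + l₂ ⬝ᵥ fderiv ℝ g (xh t₀, xh t₁) (Pi.single i 1, 0)) ∧
      p t₁ = (fun i => -(l₀ * fderiv ℝ f₀ (xh t₀, xh t₁) (0, Pi.single i 1))
                     - l₁ ⬝ᵥ fderiv ℝ f (xh t₀, xh t₁) (0, Pi.single i 1)
                     - l₂ ⬝ᵥ fderiv ℝ g (xh t₀, xh t₁) (0, Pi.single i 1)) ∧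
      (∀ᵐ t ∂(volume.restrict (Icc t₀ t₁)), ∀ u ∈ U,
        p t ⬝ᵥ φ (t, xh t, u) ≤ p t ⬝ᵥ φ (t, xh t, uh t)) ∧
      l₁ ⬝ᵥ f (xh t₀, xh t₁) = 0 ∧
      0 ≤ -(∫ t in t₀..t₁, p t ⬝ᵥ
              (fderiv ℝ (fderiv ℝ (fun w : (Fin n → ℝ) × (Fin r → ℝ) => φ (t, w.1, w.2)))
                (xh t, uh t) (h t, v t) (h t, v t)))
          + l₀ * fderiv ℝ (fderiv ℝ f₀) (xh t₀, xh t₁) (h t₀, h t₁) (h t₀, h t₁)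
          + l₁ ⬝ᵥ fderiv ℝ (fderiv ℝ f) (xh t₀, xh t₁) (h t₀, h t₁) (h t₀, h t₁)
          + l₂ ⬝ᵥ fderiv ℝ (fderiv ℝ g) (xh t₀, xh t₁) (h t₀, h t₁) (h t₀, h t₁)) ∧
    -- if Λ(xh,uh,q) = ∅ then every such tuple has l₀ ≠ 0
    ((¬ ∃ (p : ℝ → Fin n → ℝ) (l₁ : Fin m₁ → ℝ) (l₂ : Fin m₂ → ℝ),
        (∀ i, 0 ≤ l₁ i) ∧ (l₁ ≠ 0 ∨ l₂ ≠ 0) ∧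
        ContinuousOn p (Icc t₀ t₁) ∧
        IntervalIntegrable (fun s => (fun i => p s ⬝ᵥ
            fderiv ℝ (fun w : (Fin n → ℝ) × (Fin r → ℝ) => φ (s, w.1, w.2)) (xh s, uh s)
              (Pi.single i 1, 0))) volume t₀ t₁ ∧
        (∀ t ∈ Icc t₀ t₁, p t = p t₀ - ∫ s in t₀..t, (fun i => p s ⬝ᵥ
            fderiv ℝ (fun w : (Fin n → ℝ) × (Fin r → ℝ) => φ (s, w.1, w.2)) (xh s, uh s)
              (Pi.single i 1, 0))) ∧
        p t₀ = (fun i => l₁ ⬝ᵥ fderiv ℝ f (xh t₀, xh t₁) (Pi.single i 1, 0)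
                       + l₂ ⬝ᵥ fderiv ℝ g (xh t₀, xh t₁) (Pi.single i 1, 0)) ∧
        p t₁ = (fun i => -(l₁ ⬝ᵥ fderiv ℝ f (xh t₀, xh t₁) (0, Pi.single i 1))
                       - l₂ ⬝ᵥ fderiv ℝ g (xh t₀, xh t₁) (0, Pi.single i 1)) ∧
        (∀ᵐ t ∂(volume.restrict (Icc t₀ t₁)), ∀ u ∈ U,
          p t ⬝ᵥ φ (t, xh t, u) ≤ p t ⬝ᵥ φ (t, xh t, uh t)) ∧
        l₁ ⬝ᵥ f (xh t₀, xh t₁) = 0 ∧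
        0 ≤ -(∫ t in t₀..t₁, p t ⬝ᵥ
                (fderiv ℝ (fderiv ℝ (fun w : (Fin n → ℝ) × (Fin r → ℝ) => φ (t, w.1, w.2)))
                  (xh t, uh t) (h t, v t) (h t, v t)))
            + l₁ ⬝ᵥ fderiv ℝ (fderiv ℝ f) (xh t₀, xh t₁) (h t₀, h t₁) (h t₀, h t₁)
            + l₂ ⬝ᵥ fderiv ℝ (fderiv ℝ g) (xh t₀, xh t₁) (h t₀, h t₁) (h t₀, h t₁)) →
      ∀ (l₀ : ℝ) (l₁ : Fin m₁ → ℝ) (l₂ : Fin m₂ → ℝ) (p : ℝ → Fin n → ℝ),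
        0 ≤ l₀ → (∀ i, 0 ≤ l₁ i) → ¬ (l₀ = 0 ∧ l₁ = 0 ∧ l₂ = 0) →
        ContinuousOn p (Icc t₀ t₁) →
        IntervalIntegrable (fun s => (fun i => p s ⬝ᵥ
            fderiv ℝ (fun w : (Fin n → ℝ) × (Fin r → ℝ) => φ (s, w.1, w.2)) (xh s, uh s)
              (Pi.single i 1, 0))) volume t₀ t₁ →
        (∀ t ∈ Icc t₀ t₁, p t = p t₀ - ∫ s in t₀..t, (fun i => p s ⬝ᵥ
            fderiv ℝ (fun w : (Fin n → ℝ) × (Fin r → ℝ) => φ (s, w.1, w.2)) (xh s, uh s)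
              (Pi.single i 1, 0))) →
        p t₀ = (fun i => l₀ * fderiv ℝ f₀ (xh t₀, xh t₁) (Pi.single i 1, 0)
                       + l₁ ⬝ᵥ fderiv ℝ f (xh t₀, xh t₁) (Pi.single i 1, 0)
                       + l₂ ⬝ᵥ fderiv ℝ g (xh t₀, xh t₁) (Pi.single i 1, 0)) →
        p t₁ = (fun i => -(l₀ * fderiv ℝ f₀ (xh t₀, xh t₁) (0, Pi.single i 1))
                       - l₁ ⬝ᵥ fderiv ℝ f (xh t₀, xh t₁) (0, Pi.single i 1)
                       - l₂ ⬝ᵥ fderiv ℝ g (xh t₀, xh t₁) (0, Pi.single i 1)) →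
        (∀ᵐ t ∂(volume.restrict (Icc t₀ t₁)), ∀ u ∈ U,
          p t ⬝ᵥ φ (t, xh t, u) ≤ p t ⬝ᵥ φ (t, xh t, uh t)) →
        l₁ ⬝ᵥ f (xh t₀, xh t₁) = 0 →
        0 ≤ -(∫ t in t₀..t₁, p t ⬝ᵥ
                (fderiv ℝ (fderiv ℝ (fun w : (Fin n → ℝ) × (Fin r → ℝ) => φ (t, w.1, w.2)))
                  (xh t, uh t) (h t, v t) (h t, v t)))
            + l₀ * fderiv ℝ (fderiv ℝ f₀) (xh t₀, xh t₁) (h t₀, h t₁) (h t₀, h t₁)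
            + l₁ ⬝ᵥ fderiv ℝ (fderiv ℝ f) (xh t₀, xh t₁) (h t₀, h t₁) (h t₀, h t₁)
            + l₂ ⬝ᵥ fderiv ℝ (fderiv ℝ g) (xh t₀, xh t₁) (h t₀, h t₁) (h t₀, h t₁) →
        l₀ ≠ 0) := by
  constructor
  · exact SOC.Proc.mult (U := U) (φ := φ) (xh := xh) (h := h) (uh := uh) (v := v)
      ⟨⟨hU, hφc, hφ2, hφ'c, hφ''c⟩, ht, hxc, hhc, humeas, hvmeas, hreg, hvbd⟩
      hodeint hode hlinint hlin hf₀ hf hg hbf hbg hmin hqf₀ hqf hqg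
  · intro hne l₀ l₁ l₂ p _ hl₁ hnz hc hI hO h0 h1 hmax hs h2 hl₀
    subst hl₀
    refine hne ⟨p, l₁, l₂, hl₁, ?_, hc, hI, hO, ?_, ?_, hmax, hs, ?_⟩
    · by_contra hcon
      push Not at hcon
      exact hnz ⟨rfl, hcon.1, hcon.2⟩
    · rw [h0]; funext i; ring
    · rw [h1]; funext i; ring
    · simpa only [zero_mul, add_zero] using h2
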